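/- arXiv:2601.19230 — 2 statements merged into one kernel-verified Lean document; each statement's English description precedes it below -/
import Mathlib

section
/- Let g, h, c be integers with c > 0 and g = 2h + c > 0, and set h₀ := ⌈c/2⌉ − 1 and c₀ := c − 2h₀. Then for every integer k > 0 and every partition {I_hdl, I_crscp} of [2, h+c+1] with |I_hdl| = h and |I_crscp| = c, the mixed surface grid H^{162^{2g}·k}_{I_hdl,I_crscp} of order 162^{2g}·k with h handles and c crosscaps contains the Dyck-grid D_k^{(h+h₀, c₀)} as a minor. -/
open SimpleGraph

/-- `H` is a minor of `G`: there is a minor model of `H` in `G`, i.e. a family of pairwise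
disjoint connected branch sets, one for each vertex of `H`, such that every edge of `H` is
realised by an edge of `G` between the corresponding branch sets. -/
def IsMinorOf {α β : Type*} (H : SimpleGraph α) (G : SimpleGraph β) : Prop :=
  ∃ X : α → Set β,
    (∀ u v : α, u ≠ v → Disjoint (X u) (X v)) ∧
    (∀ v : α, (G.induce (X v)).Connected) ∧
    (∀ u v : α, H.Adj u v → ∃ a ∈ X u, ∃ b ∈ X v, G.Adj a b)

/-- The mixed surface grid of order `k` built from the `(k, 4*n*k)`-cylindrical grid
(where `n = h + c + 1`), with a handle added at every position in `Ih` and a crosscap added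
at every position in `Ic`.  The vertex `v_j^i` (for `i ∈ [k]`, `j ∈ ℤ/(4nk)`) is encoded as
`(⟨i - 1⟩, j)`, so the top row `v^1` corresponds to first coordinate `0`. -/
def mixedGrid (k n : ℕ) (Ih Ic : Finset ℕ) :
    SimpleGraph (Fin k × ZMod (4 * n * k)) :=
  SimpleGraph.fromRel (fun p q =>
    (p.1 = q.1 ∧ q.2 = p.2 + 1) ∨
    (p.2 = q.2 ∧ (q.1 : ℕ) = (p.1 : ℕ) + 1) ∨
    ((p.1 : ℕ) = 0 ∧ (q.1 : ℕ) = 0 ∧ ∃ i ∈ Ih, ∃ j ∈ Finset.Icc 1 k,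
      ((p.2 = ((4 * k * (i - 1) + j : ℕ) : ZMod (4 * n * k)) ∧
        q.2 = ((4 * k * (i - 1) + 3 * k - j + 1 : ℕ) : ZMod (4 * n * k))) ∨
       (p.2 = ((4 * k * (i - 1) + k + j : ℕ) : ZMod (4 * n * k)) ∧
        q.2 = ((4 * k * (i - 1) + 4 * k - j + 1 : ℕ) : ZMod (4 * n * k))))) ∨
    ((p.1 : ℕ) = 0 ∧ (q.1 : ℕ) = 0 ∧ ∃ i ∈ Ic, ∃ j ∈ Finset.Icc 1 (2 * k),
      p.2 = ((4 * k * (i - 1) + j : ℕ) : ZMod (4 * n * k)) ∧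
      q.2 = ((4 * k * (i - 1) + 2 * k + j : ℕ) : ZMod (4 * n * k))))

/-- The Dyck grid `D_k^{(h,c)}`. -/
def dyckGrid (k h c : ℕ) : SimpleGraph (Fin k × ZMod (4 * (h + c + 1) * k)) :=
  mixedGrid k (h + c + 1) (Finset.Icc 2 (h + 1)) (Finset.Icc (h + 2) (h + c + 1))

namespace DyckMinor

theorem reach_mono {β : Type*} {F : SimpleGraph β} {S T : Set β} (h : S ⊆ T) {a b : β}
    (ha : a ∈ S) (hb : b ∈ S) (hr : (F.induce S).Reachable ⟨a, ha⟩ ⟨b, hb⟩) :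
    (F.induce T).Reachable ⟨a, h ha⟩ ⟨b, h hb⟩ :=
  hr.map (SimpleGraph.induceHomOfLE F h).toHom

theorem IsMinorOf.trans {α β γ : Type*} {H : SimpleGraph α} {G : SimpleGraph β}
    {F : SimpleGraph γ} (h1 : IsMinorOf H G) (h2 : IsMinorOf G F) : IsMinorOf H F := by
  obtain ⟨X, Xd, Xc, Xe⟩ := h1
  obtain ⟨Y, Yd, Yc, Ye⟩ := h2
  refine ⟨fun v => {z | ∃ u ∈ X v, z ∈ Y u}, ?_, ?_, ?_⟩
  · intro u v huv
    rw [Set.disjoint_left]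
    rintro z ⟨a, ha, hza⟩ ⟨b, hb, hzb⟩
    by_cases hab : a = b
    · subst hab
      exact Set.disjoint_left.1 (Xd u v huv) ha hb
    · exact Set.disjoint_left.1 (Yd a b hab) hza hzb
  · intro v
    have sub : ∀ u ∈ X v, Y u ⊆ {z | ∃ u ∈ X v, z ∈ Y u} := fun u hu z hz => ⟨u, hu, hz⟩
    have same : ∀ u (hu : u ∈ X v) a (ha : a ∈ Y u) b (hb : b ∈ Y u),
        (F.induce {z | ∃ u ∈ X v, z ∈ Y u}).Reachable ⟨a, sub u hu ha⟩ ⟨b, sub u hu hb⟩ :=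
      fun u hu a ha b hb => reach_mono (sub u hu) ha hb ((Yc u).preconnected _ _)
    have key : ∀ (p q : X v), Relation.ReflTransGen (G.induce (X v)).Adj p q →
        ∀ a (ha : a ∈ Y p.1) b (hb : b ∈ Y q.1),
        (F.induce {z | ∃ u ∈ X v, z ∈ Y u}).Reachable
          ⟨a, sub p.1 p.2 ha⟩ ⟨b, sub q.1 q.2 hb⟩ := by
      intro p q hpq
      induction hpq with
      | refl => intro a ha b hb; exact same p.1 p.2 a ha b hb
      | @tail q r hpq hqr ih =>
        intro a ha b hb
        obtain ⟨x, hx, y, hy, hxy⟩ := Ye q.1 r.1 hqr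
        refine (ih a ha x hx).trans (SimpleGraph.Reachable.trans (SimpleGraph.Adj.reachable ?_)
          (same r.1 r.2 y hy b hb))
        exact hxy
    obtain ⟨u0, hu0⟩ := (Xc v).nonempty
    obtain ⟨z0, hz0⟩ := (Yc u0).nonempty
    have : Nonempty {z | ∃ u ∈ X v, z ∈ Y u} := ⟨⟨z0, u0, hu0, hz0⟩⟩
    refine SimpleGraph.Connected.mk ?_
    rintro ⟨a, u, hu, ha⟩ ⟨b, w, hw, hb⟩
    exact key ⟨u, hu⟩ ⟨w, hw⟩
      ((SimpleGraph.reachable_iff_reflTransGen _ _).1 ((Xc v).preconnected _ _)) a ha b hb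
  · intro u v huv
    obtain ⟨a, ha, b, hb, hab⟩ := Xe u v huv
    obtain ⟨x, hx, y, hy, hxy⟩ := Ye a b hab
    exact ⟨x, ⟨a, ha, hx⟩, y, ⟨b, hb, hy⟩, hxy⟩

theorem connected_of_measure {β : Type*} {F : SimpleGraph β} {S : Set β} (μ : β → ℕ) (c : β)
    (hc : c ∈ S) (h : ∀ x ∈ S, x ≠ c → ∃ y ∈ S, F.Adj x y ∧ μ y < μ x) :
    (F.induce S).Connected := by
  have key : ∀ n, ∀ x (hx : x ∈ S), μ x < n → (F.induce S).Reachable ⟨x, hx⟩ ⟨c, hc⟩ := by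
    intro n
    induction n with
    | zero => intro x hx h; omega
    | succ n ih =>
      intro x hx hn
      by_cases hxc : x = c
      · subst hxc; exact SimpleGraph.Reachable.refl _
      · obtain ⟨y, hy, hxy, hlt⟩ := h x hx hxc
        refine SimpleGraph.Reachable.trans (SimpleGraph.Adj.reachable ?_) (ih y hy (by omega))
        exact hxy
  have : Nonempty S := ⟨⟨c, hc⟩⟩
  refine SimpleGraph.Connected.mk ?_
  rintro ⟨a, ha⟩ ⟨b, hb⟩
  exact (key _ a ha (Nat.lt_succ_self _)).trans (key _ b hb (Nat.lt_succ_self _)).symm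

theorem minor_of_rel {α β : Type*} (r : α → α → Prop) (s : β → β → Prop) (X : α → Set β)
    (hd : ∀ u v : α, u ≠ v → Disjoint (X u) (X v))
    (hcn : ∀ v : α, ((SimpleGraph.fromRel s).induce (X v)).Connected)
    (he : ∀ u v : α, u ≠ v → r u v → ∃ a ∈ X u, ∃ b ∈ X v, s a b ∨ s b a) :
    IsMinorOf (SimpleGraph.fromRel r) (SimpleGraph.fromRel s) := by
  refine ⟨X, hd, hcn, ?_⟩
  intro u v huv
  rw [SimpleGraph.fromRel_adj] at huv
  obtain ⟨hne, h | h⟩ := huv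
  · obtain ⟨a, ha, b, hb, hab⟩ := he u v hne h
    refine ⟨a, ha, b, hb, ?_⟩
    rw [SimpleGraph.fromRel_adj]
    refine ⟨?_, hab⟩
    rintro rfl
    exact Set.disjoint_left.1 (hd u v hne) ha hb
  · obtain ⟨a, ha, b, hb, hab⟩ := he v u hne.symm h
    refine ⟨b, hb, a, ha, ?_⟩
    rw [SimpleGraph.fromRel_adj]
    refine ⟨?_, hab.symm⟩
    rintro rfl
    exact Set.disjoint_left.1 (hd u v hne) hb ha

theorem minor_of_inj {α β : Type*} (r : α → α → Prop) (s : β → β → Prop) (f : α → β)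
    (hf : Function.Injective f) (he : ∀ u v : α, u ≠ v → r u v → s (f u) (f v) ∨ s (f v) (f u)) :
    IsMinorOf (SimpleGraph.fromRel r) (SimpleGraph.fromRel s) := by
  refine minor_of_rel r s (fun v => {f v}) ?_ ?_ ?_
  · intro u v huv
    rw [Set.disjoint_singleton]
    exact fun h => huv (hf h)
  · intro v
    refine connected_of_measure (fun _ => 0) (f v) rfl ?_
    intro x hx hne
    exact absurd hx hne
  · intro u v hne h
    exact ⟨_, rfl, _, rfl, he u v hne h⟩

/-- Adjacency generator of a cylindrical grid with extra chords `rel` in row `0`. -/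
def gridRel (R N : ℕ) (rel : Fin N → Fin N → Prop) (p q : Fin R × Fin N) : Prop :=
  (p.1 = q.1 ∧ (q.2.val = p.2.val + 1 ∨ (p.2.val + 1 = N ∧ q.2.val = 0))) ∨
  (p.2 = q.2 ∧ q.1.val = p.1.val + 1) ∨
  (p.1.val = 0 ∧ q.1.val = 0 ∧ rel p.2 q.2)

/-- A cylindrical grid with extra chords `rel` in row `0`. -/
def chordGrid (R N : ℕ) (rel : Fin N → Fin N → Prop) : SimpleGraph (Fin R × Fin N) :=
  SimpleGraph.fromRel (gridRel R N rel)

theorem chordGrid_rows {R R' N : ℕ} (h : R' ≤ R) {rel rel' : Fin N → Fin N → Prop}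
    (hr : ∀ i j, i ≠ j → rel' i j → rel i j) :
    IsMinorOf (chordGrid R' N rel') (chordGrid R N rel) := by
  refine minor_of_inj _ _ (fun p => (Fin.castLE h p.1, p.2)) ?_ ?_
  · rintro ⟨a, b⟩ ⟨c, d⟩ h
    simpa using h
  · rintro ⟨a, b⟩ ⟨c, d⟩ hne h
    left
    simp only [gridRel] at h ⊢
    rcases h with ⟨h1, h2⟩ | ⟨h1, h2⟩ | ⟨h1, h2, h3⟩
    · left; exact ⟨by rw [h1], h2⟩
    · right; left; exact ⟨h1, h2⟩
    · right; right
      refine ⟨h1, h2, hr _ _ ?_ h3⟩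
      rintro rfl
      apply hne
      have : a = c := Fin.ext (by omega)
      rw [this]

/-- Splicing two adjacent columns costs one row. -/
theorem chordGrid_splice {R N : ℕ} {rel rel' : Fin N → Fin N → Prop} (i i' b : Fin N)
    (hi : i'.val = i.val + 1) (hb : b ≠ i ∧ b ≠ i') (hib : rel i' b)
    (hr : ∀ u v, u ≠ v → rel' u v → (u ≠ i ∧ u ≠ i' ∧ v ≠ i ∧ v ≠ i') ∧
      (rel u v ∨ (rel u i ∧ v = b) ∨ (u = b ∧ rel i v))) :
    IsMinorOf (chordGrid R N rel') (chordGrid (R + 1) N rel) := by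
  have hii : i ≠ i' := by intro h; rw [h] at hi; omega
  refine minor_of_rel _ _ (fun v => {z | (z.2 = v.2 ∧ z.1.val = v.1.val + 1) ∨
    (v.1.val = 0 ∧ z.1.val = 0 ∧ z.2 = v.2 ∧ v.2 ≠ i ∧ v.2 ≠ i') ∨
    (v.1.val = 0 ∧ z.1.val = 0 ∧ v.2 = b ∧ (z.2 = i ∨ z.2 = i'))}) ?_ ?_ ?_
  · rintro ⟨a, c⟩ ⟨a', c'⟩ hne
    rw [Set.disjoint_left]
    rintro ⟨x, y⟩ h1 h2
    apply hne
    simp only [Set.mem_ofPred_eq] at h1 h2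
    rw [Prod.mk.injEq, Fin.ext_iff]
    rcases h1 with ⟨h, h'⟩ | ⟨h, h', h3, h4⟩ | ⟨h, h', h3, h4⟩ <;>
    rcases h2 with ⟨k, k'⟩ | ⟨k, k', k3, k4⟩ | ⟨k, k', k3, k4⟩ <;>
    first
    | (exfalso; omega)
    | (refine ⟨by omega, ?_⟩; grind)
  · rintro ⟨a, c⟩
    refine connected_of_measure (fun z => if z.1.val ≠ 0 then 0 else if z.2 = c then 1 else
      if z.2 = i' then 2 else 3) (a.succ, c) ?_ ?_
    · left; simp
    · rintro ⟨x, y⟩ hx hne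
      simp only [Set.mem_ofPred_eq] at hx
      rcases hx with ⟨h, h'⟩ | ⟨h, h', h3, h4⟩ | ⟨h, h', h3, h4 | h4⟩
      · exfalso; apply hne
        rw [Prod.mk.injEq, Fin.ext_iff]
        exact ⟨by simpa using h', h⟩
      · refine ⟨(a.succ, c), Or.inl (by simp), ?_, ?_⟩
        · rw [SimpleGraph.fromRel_adj]
          refine ⟨hne, Or.inl (Or.inr (Or.inl ⟨h3, ?_⟩))⟩
          simp; omega
        · simp [h', h3]
      · refine ⟨(x, i'), ?_, ?_, ?_⟩
        · exact Or.inr (Or.inr ⟨h, h', h3, Or.inr rfl⟩)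
        · rw [SimpleGraph.fromRel_adj]
          refine ⟨?_, Or.inl (Or.inl ⟨rfl, Or.inl ?_⟩)⟩
          · rw [h4]; simpa using hii
          · rw [h4]; exact hi
        · have : ¬ i' = c := by rw [h3]; exact hb.2.symm
          have h5 : ¬ i = c := by rw [h3]; exact hb.1.symm
          simp [h', h4, this, h5, hii]
      · refine ⟨(x, c), ?_, ?_, ?_⟩
        · refine Or.inr (Or.inl ⟨h, h', rfl, ?_⟩)
          have h3 : c = b := h3
          rw [h3]; exact hb
        · rw [SimpleGraph.fromRel_adj]
          have h3 : c = b := h3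
          have h4 : y = i' := h4
          subst h3 h4
          refine ⟨?_, Or.inl (Or.inr (Or.inr ⟨h', h', ?_⟩))⟩
          · simpa using hb.2.symm
          · exact hib
        · have : ¬ i' = c := by rw [h3]; exact hb.2.symm
          simp [h', h4, this]
  · rintro ⟨a, c⟩ ⟨a', c'⟩ hne h
    simp only [gridRel] at h
    rcases h with ⟨h1, h2⟩ | ⟨h1, h2⟩ | ⟨h1, h2, h3⟩
    · refine ⟨(a.succ, c), Or.inl (by simp), (a'.succ, c'), Or.inl (by simp), Or.inl (Or.inl ?_)⟩
      exact ⟨by simp [h1], h2⟩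
    · refine ⟨(a.succ, c), Or.inl (by simp), (a'.succ, c'), Or.inl (by simp),
        Or.inl (Or.inr (Or.inl ?_))⟩
      exact ⟨h1, by simp [h2]⟩
    · have hcc : c ≠ c' := by
        rintro rfl
        apply hne
        have : a = a' := Fin.ext (by omega)
        rw [this]
      obtain ⟨⟨n1, n2, n3, n4⟩, hrr⟩ := hr c c' hcc h3
      rcases hrr with hrr | ⟨hrr, hbb⟩ | ⟨hbb, hrr⟩
      · refine ⟨(0, c), Or.inr (Or.inl ⟨h1, rfl, rfl, n1, n2⟩), (0, c'),
          Or.inr (Or.inl ⟨h2, rfl, rfl, n3, n4⟩), Or.inl (Or.inr (Or.inr ⟨rfl, rfl, hrr⟩))⟩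
      · refine ⟨(0, c), Or.inr (Or.inl ⟨h1, rfl, rfl, n1, n2⟩), (0, i),
          Or.inr (Or.inr ⟨h2, rfl, hbb, Or.inl rfl⟩), Or.inl (Or.inr (Or.inr ⟨rfl, rfl, hrr⟩))⟩
      · refine ⟨(0, i), Or.inr (Or.inr ⟨h1, rfl, hbb, Or.inl rfl⟩), (0, c'),
          Or.inr (Or.inl ⟨h2, rfl, rfl, n3, n4⟩), Or.inl (Or.inr (Or.inr ⟨rfl, rfl, hrr⟩))⟩

/-- Restricting to a subset of the columns. -/
theorem chordGrid_sub {R N N' : ℕ} {rel : Fin N → Fin N → Prop} {rel' : Fin N' → Fin N' → Prop}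
    (f : Fin N' ↪o Fin N) (hr : ∀ u v, u ≠ v → rel' u v → rel (f u) (f v)) :
    IsMinorOf (chordGrid R N' rel') (chordGrid R N rel) := by
  -- column `c` belongs to `j` if `f j ≤ c < f (j+1)`, or `j = 0` and `c < f 0`
  refine minor_of_rel _ _ (fun v => {z | z.1 = v.1 ∧ (f v.2 ≤ z.2 ∨ v.2.val = 0) ∧
    ∀ j, v.2 < j → z.2 < f j}) ?_ ?_ ?_
  · rintro ⟨a, c⟩ ⟨a', c'⟩ hne
    rw [Set.disjoint_left]
    rintro ⟨x, y⟩ ⟨h1, h2, h3⟩ ⟨k1, k2, k3⟩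
    apply hne
    simp only at h1 h2 h3 k1 k2 k3
    rw [Prod.mk.injEq]
    refine ⟨h1.symm.trans k1, ?_⟩
    rcases lt_trichotomy c c' with h | h | h
    · have := h3 c' h
      rcases k2 with k2 | k2
      · exact absurd k2 (not_le.2 this)
      · rw [Fin.lt_def] at h; omega
    · exact h
    · have := k3 c h
      rcases h2 with h2 | h2
      · exact absurd h2 (not_le.2 this)
      · rw [Fin.lt_def] at h; omega
  · rintro ⟨a, c⟩
    refine connected_of_measure
      (fun z => (z.2.val - (f c).val) + ((f c).val - z.2.val)) (a, f c) ?_ ?_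
    · exact ⟨rfl, Or.inl le_rfl, fun j hj => f.strictMono hj⟩
    · rintro ⟨x, y⟩ ⟨h1, h2, h3⟩ hne
      simp only at h1 h2 h3
      subst h1
      have hy : y.val ≠ (f c).val := fun h => hne (by rw [Fin.ext h])
      rcases Nat.lt_or_ge y.val (f c).val with hlt | hge
      · have hN : y.val + 1 < N := by have := (f c).isLt; omega
        have hc0 : c.val = 0 := by
          rcases h2 with h2 | h2
          · rw [Fin.le_def] at h2; omega
          · exact h2
        refine ⟨(x, ⟨y.val + 1, hN⟩), ⟨rfl, Or.inr hc0, ?_⟩, ?_, ?_⟩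
        · intro j hj
          have : f c < f j := f.strictMono hj
          rw [Fin.lt_def] at this ⊢
          simp only; omega
        · rw [SimpleGraph.fromRel_adj]
          refine ⟨?_, Or.inl (Or.inl ⟨rfl, Or.inl rfl⟩)⟩
          intro h
          simp [Fin.ext_iff] at h
        · simp only; omega
      · have hN : y.val - 1 < N := by have := y.isLt; omega
        refine ⟨(x, ⟨y.val - 1, hN⟩), ⟨rfl, Or.inl ?_, ?_⟩, ?_, ?_⟩
        · rw [Fin.le_def]; simp only; omega
        · intro j hj
          have := h3 j hj
          rw [Fin.lt_def] at this ⊢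
          simp only; omega
        · rw [SimpleGraph.fromRel_adj]
          refine ⟨?_, Or.inr (Or.inl ⟨rfl, Or.inl ?_⟩)⟩
          · intro h
            simp [Fin.ext_iff] at h
            omega
          · simp only; omega
        · simp only; omega
  · rintro ⟨a, c⟩ ⟨a', c'⟩ hne h
    simp only [gridRel] at h
    have self : ∀ (a : Fin R) c, (a, f c) ∈ {z : Fin R × Fin N | z.1 = a ∧
        (f c ≤ z.2 ∨ c.val = 0) ∧ ∀ j, c < j → z.2 < f j} :=
      fun a c => ⟨rfl, Or.inl le_rfl, fun j hj => f.strictMono hj⟩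
    rcases h with ⟨h1, h2⟩ | ⟨h1, h2⟩ | ⟨h1, h2, h3⟩
    · subst h1
      rcases h2 with h2 | ⟨h2, h2'⟩
      · have hlt : (f c).val < (f c').val := by
          have : c < c' := by rw [Fin.lt_def]; omega
          exact Fin.lt_def.1 (f.strictMono this)
        have hN : (f c').val - 1 < N := by have := (f c').isLt; omega
        refine ⟨(a, ⟨(f c').val - 1, hN⟩), ⟨rfl, Or.inl ?_, ?_⟩, (a, f c'), self a c',
          Or.inl (Or.inl ⟨rfl, Or.inl ?_⟩)⟩
        · rw [Fin.le_def]; simp only; omega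
        · intro j hj
          have : c' ≤ j := by rw [Fin.le_def]; rw [Fin.lt_def] at hj; simp only at hj; omega
          have := f.monotone this
          rw [Fin.lt_def]; rw [Fin.le_def] at this
          simp only; omega
        · simp only; omega
      · have hN : 0 < N := by have := (f c).isLt; omega
        refine ⟨(a, ⟨N - 1, by omega⟩), ⟨rfl, Or.inl ?_, ?_⟩, (a, ⟨0, hN⟩), ⟨rfl, Or.inr h2', ?_⟩,
          Or.inl (Or.inl ⟨rfl, Or.inr ⟨?_, rfl⟩⟩)⟩
        · rw [Fin.le_def]; have := (f c).isLt; simp only; omega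
        · intro j hj
          rw [Fin.lt_def] at hj; have := j.isLt; simp only at hj; omega
        · intro j hj
          have : f c' < f j := f.strictMono hj
          rw [Fin.lt_def] at this ⊢
          simp only; omega
        · simp only; omega
    · refine ⟨_, self a c, _, self a' c', Or.inl (Or.inr (Or.inl ⟨?_, h2⟩))⟩
      rw [h1]
    · refine ⟨_, self a c, _, self a' c', Or.inl (Or.inr (Or.inr ⟨h1, h2, hr _ _ ?_ h3⟩))⟩
      rintro rfl
      apply hne
      have : a = a' := Fin.ext (by omega)
      rw [this]

end DyckMinor

namespace DyckMinor

/-- The grid with `R` rows whose columns are labelled by `w`; equal labels are joined in row `0`. -/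
def wg {ι : Type*} (R : ℕ) (w : List ι) : SimpleGraph (Fin R × Fin w.length) :=
  chordGrid R w.length (fun i j => w.get i = w.get j)

/-- `w` reduces to the second word at the cost of `s` rows. -/
def Red {ι κ : Type*} (s : ℕ) (w : List ι) (w' : List κ) : Prop :=
  ∀ R, IsMinorOf (wg R w') (wg (R + s) w)

theorem Red.trans {ι κ μ : Type*} {s t : ℕ} {w : List ι} {w' : List κ} {w'' : List μ}
    (h : Red s w w') (h' : Red t w' w'') : Red (s + t) w w'' := by
  intro R
  have h1 := h' R
  have h2 := h (R + t)
  have : R + t + s = R + (s + t) := by ring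
  rw [this] at h2
  exact IsMinorOf.trans h1 h2

theorem red_emb {ι κ : Type*} {w : List ι} {w' : List κ}
    (f : Fin w'.length ↪o Fin w.length)
    (hf : ∀ u v, u ≠ v → w'.get u = w'.get v → w.get (f u) = w.get (f v)) : Red 0 w w' :=
  fun _ => chordGrid_sub f hf

theorem red_sub {ι : Type*} {w w' : List ι} (h : w'.Sublist w) : Red 0 w w' := by
  obtain ⟨f, hf⟩ := List.sublist_iff_exists_fin_orderEmbedding_get_eq.1 h
  refine red_emb f ?_
  intro u v _ huv
  rw [← hf, ← hf, huv]

theorem red_map {ι κ : Type*} {w : List ι} (f : ι → κ)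
    (hf : ∀ a ∈ w, ∀ b ∈ w, f a = f b → a = b) : Red 0 w (w.map f) := by
  refine red_emb (Fin.castOrderIso (by simp)).toOrderEmbedding ?_
  intro u v _ huv
  simp only [List.get_eq_getElem, List.getElem_map] at huv
  exact hf _ (List.getElem_mem _) _ (List.getElem_mem _) huv

theorem red_unmap {ι κ : Type*} {w : List ι} (f : ι → κ) : Red 0 (w.map f) w := by
  refine red_emb (Fin.castOrderIso (by simp)).toOrderEmbedding ?_
  intro u v _ huv
  simp only [List.get_eq_getElem] at huv
  simp [huv]

theorem red_splice {ι : Type*} [DecidableEq ι] {w1 w2 : List ι} {x y : ι} (hxy : x ≠ y)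
    (hy : (w1 ++ w2).count y ≤ 1) :
    Red 1 (w1 ++ x :: y :: w2) ((w1 ++ w2).map (fun z => if z = y then x else z)) := by
  have hlen : (w1 ++ x :: y :: w2).length = (w1 ++ w2).length + 2 := by simp; omega
  have hlen1 : (w1 ++ w2).length = w1.length + w2.length := by simp
  let f0 : Fin (w1 ++ w2).length → Fin (w1 ++ x :: y :: w2).length :=
    fun u => if u.val < w1.length then ⟨u.val, by omega⟩ else ⟨u.val + 2, by omega⟩
  have hf0 : StrictMono f0 := by
    intro u v huv
    simp only [f0]
    rw [Fin.lt_def] at huv ⊢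
    split_ifs <;> simp only <;> omega
  have hval : ∀ u, (w1 ++ x :: y :: w2).get (f0 u) = (w1 ++ w2).get u := by
    intro u
    simp only [f0, List.get_eq_getElem]
    split_ifs with h
    · simp [h]
    · have : u.val + 2 - w1.length = (u.val - w1.length) + 2 := by omega
      have h' : ¬ u.val + 2 < w1.length := by omega
      simp [List.getElem_append, h, h', this]
  have hnot : ∀ u, (f0 u).val ≠ w1.length ∧ (f0 u).val ≠ w1.length + 1 := by
    intro u
    simp only [f0]
    split_ifs <;> simp only <;> omega
  by_cases hmem : y ∈ w1 ++ w2
  · obtain ⟨b0, hb0⟩ := List.get_of_mem hmem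
    have huniq : ∀ u, (w1 ++ w2).get u = y → u = b0 := by
      intro u hu
      by_contra hne
      have : 2 ≤ (w1 ++ w2).count y := by
        rw [← List.duplicate_iff_two_le_count, List.duplicate_iff_exists_distinct_get]
        rcases lt_or_gt_of_ne hne with h | h
        · exact ⟨u, b0, h, hu.symm, hb0.symm⟩
        · exact ⟨b0, u, h, hb0.symm, hu.symm⟩
      omega
    have key : ∀ R, IsMinorOf
        (chordGrid R (w1 ++ x :: y :: w2).length (fun p q => ∃ u v, p = f0 u ∧ q = f0 v ∧
          (if (w1 ++ w2).get u = y then x else (w1 ++ w2).get u) =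
          (if (w1 ++ w2).get v = y then x else (w1 ++ w2).get v)))
        (wg (R + 1) (w1 ++ x :: y :: w2)) := by
      intro R
      refine chordGrid_splice ⟨w1.length, by omega⟩ ⟨w1.length + 1, by omega⟩ (f0 b0) rfl ?_ ?_ ?_
      · simp only [ne_eq, Fin.ext_iff]
        exact hnot b0
      · rw [hval, hb0]
        simp
      · rintro p q hpq ⟨u, v, rfl, rfl, huv⟩
        refine ⟨?_, ?_⟩
        · simp only [ne_eq, Fin.ext_iff]
          exact ⟨(hnot u).1, (hnot u).2, (hnot v).1, (hnot v).2⟩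
        · rw [hval, hval]
          have hx : (w1 ++ x :: y :: w2).get ⟨w1.length, by omega⟩ = x := by simp
          rw [hx]
          by_cases h1 : (w1 ++ w2).get u = y
          · rw [if_pos h1] at huv
            have hub := huniq u h1
            by_cases h2 : (w1 ++ w2).get v = y
            · exact absurd (by rw [huniq u h1, huniq v h2]) hpq
            · rw [if_neg h2] at huv
              right; right
              exact ⟨by rw [hub], huv⟩
          · rw [if_neg h1] at huv
            by_cases h2 : (w1 ++ w2).get v = y
            · rw [if_pos h2] at huv
              right; left
              exact ⟨huv, by rw [huniq v h2]⟩
            · rw [if_neg h2] at huv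
              exact Or.inl huv
    intro R
    refine IsMinorOf.trans ?_ (key R)
    refine chordGrid_sub ((Fin.castOrderIso (by simp)).toOrderEmbedding.trans
      (OrderEmbedding.ofStrictMono f0 hf0)) ?_
    intro u v _ huv
    refine ⟨Fin.cast (by simp) u, Fin.cast (by simp) v, rfl, rfl, ?_⟩
    simpa only [List.get_eq_getElem, List.getElem_map, Fin.val_cast] using huv
  · have hid : (w1 ++ w2).map (fun z => if z = y then x else z) = w1 ++ w2 := by
      conv_rhs => rw [← List.map_id (w1 ++ w2)]
      refine List.map_congr_left ?_
      intro a ha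
      rw [if_neg]
      · rfl
      · rintro rfl; exact hmem ha
    rw [hid]
    intro R
    refine IsMinorOf.trans (red_sub (w := w1 ++ x :: y :: w2) ?_ R)
      (chordGrid_rows (by omega) (fun _ _ _ h => h))
    refine List.Sublist.append (List.Sublist.refl _) ?_
    exact (List.sublist_cons_self _ _).trans (List.sublist_cons_self _ _)

theorem red_bundle {ι : Type*} [DecidableEq ι] : ∀ (Y : List ι) (w1 w2 X : List ι) (ρ : ι → ι),
    Y.reverse.map ρ = X → (∀ z, z ∉ Y → ρ z = z) → Y.Nodup → (∀ z ∈ X, z ∉ Y) →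
    (∀ y ∈ Y, (w1 ++ w2).count y ≤ 1) →
    Red Y.length (w1 ++ X ++ Y ++ w2) ((w1 ++ w2).map ρ) := by
  intro Y
  induction Y with
  | nil =>
    intro w1 w2 X ρ hX hρ _ _ _
    simp only [List.reverse_nil, List.map_nil] at hX
    subst hX
    have : (w1 ++ w2).map ρ = w1 ++ w2 := by
      conv_rhs => rw [← List.map_id (w1 ++ w2)]
      exact List.map_congr_left (fun a _ => hρ a (by simp))
    rw [this]
    simpa using red_sub (List.Sublist.refl (w1 ++ w2))
  | cons y Y ih =>
    intro w1 w2 X ρ hX hρ hnd hXY hcount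
    rw [List.nodup_cons] at hnd
    simp only [List.reverse_cons, List.map_append, List.map_cons, List.map_nil] at hX
    subst hX
    have hxY : ρ y ∉ y :: Y := hXY _ (by simp)
    have hxy : ρ y ≠ y := fun h => hxY (by rw [h]; simp)
    set X' := Y.reverse.map ρ with hX'
    have hyX : y ∉ X' := fun h => hXY y (by simp [h]) (by simp)
    let ρ1 : ι → ι := fun z => if z = y then ρ y else z
    let ρ2 : ι → ι := fun z => if z = y then y else ρ z
    have hmapid : ∀ l : List ι, y ∉ l → l.map ρ1 = l := by
      intro l hl
      conv_rhs => rw [← List.map_id l]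
      refine List.map_congr_left ?_
      intro a ha
      simp only [ρ1]
      rw [if_neg]
      · rfl
      · rintro rfl; exact hl ha
    have step1 : Red 1 ((w1 ++ X') ++ ρ y :: y :: (Y ++ w2))
        (((w1 ++ X') ++ (Y ++ w2)).map ρ1) := by
      refine red_splice hxy ?_
      have h := hcount y (by simp)
      have h1 := List.count_eq_zero_of_not_mem hyX
      have h2 := List.count_eq_zero_of_not_mem hnd.1
      simp only [List.count_append] at h ⊢
      omega
    have e1 : ((w1 ++ X') ++ (Y ++ w2)).map ρ1 = w1.map ρ1 ++ X' ++ Y ++ w2.map ρ1 := by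
      simp [hmapid X' hyX, hmapid Y hnd.1]
    rw [e1] at step1
    have step2 := ih (w1.map ρ1) (w2.map ρ1) X' ρ2 ?_ ?_ hnd.2 ?_ ?_
    · have e2 : ((w1.map ρ1 ++ w2.map ρ1).map ρ2) = (w1 ++ w2).map ρ := by
        rw [← List.map_append, List.map_map]
        refine List.map_congr_left ?_
        intro a _
        simp only [ρ1, ρ2, Function.comp]
        by_cases h : a = y
        · subst h
          simp only [if_true, hxy, if_false]
          exact hρ _ hxY
        · simp [h]
      rw [e2] at step2
      have := step1.trans step2
      rw [show (y :: Y).length = 1 + Y.length by simp; omega]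
      simpa using this
    · rw [hX']
      refine List.map_congr_left ?_
      intro a ha
      have : a ≠ y := by rintro rfl; exact hnd.1 (by simpa using ha)
      simp [ρ2, this]
    · intro z hz
      by_cases h : z = y
      · simp [ρ2, h]
      · simp only [ρ2, h, if_false]
        exact hρ z (by simp [h, hz])
    · intro z hz hzY
      exact hXY z (by simp [hz]) (by simp [hzY])
    · intro z hz
      have h := hcount z (by simp [hz])
      rw [← List.map_append]
      refine le_trans (le_of_eq ?_) h
      have hzy : z ≠ y := by rintro rfl; exact hnd.1 hz
      have hzx : z ≠ ρ y := by rintro rfl; exact hxY (by simp [hz])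
      rw [List.count_eq_countP, List.count_eq_countP, List.countP_map]
      refine List.countP_congr ?_
      intro a _
      simp only [ρ1, Function.comp, beq_iff_eq]
      by_cases h : a = y
      · subst h; simp [hzx.symm, hzy.symm]
      · simp [h]

/-- Expansion of a signed letter to a bundle of `m` parallel columns. -/
def ex {ι : Type*} (m : ℕ) (l : ι × Bool) : List (ι × ℕ) :=
  if l.2 then (List.range m).map (fun i => (l.1, i))
  else ((List.range m).map (fun i => (l.1, i))).reverse

/-- Expansion of a signed word. -/
def exw {ι : Type*} (m : ℕ) (W : List (ι × Bool)) : List (ι × ℕ) := W.flatMap (ex m)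

theorem ex_reverse {ι : Type*} (m : ℕ) (a : ι) (u : Bool) :
    (ex m (a, u)).reverse = ex m (a, !u) := by
  cases u <;> simp [ex]

theorem mem_ex {ι : Type*} (m : ℕ) (l : ι × Bool) (p : ι × ℕ) :
    p ∈ ex m l ↔ p.1 = l.1 ∧ p.2 < m := by
  obtain ⟨a, i⟩ := p
  obtain ⟨b, u⟩ := l
  cases u <;> simp [ex] <;> constructor <;> rintro ⟨h1, h2⟩ <;> simp_all

theorem nodup_ex {ι : Type*} (m : ℕ) (l : ι × Bool) : (ex m l).Nodup := by
  have : ((List.range m).map (fun i => (l.1, i))).Nodup :=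
    List.Nodup.map (fun a b h => by simpa using h) List.nodup_range
  unfold ex
  split_ifs
  · exact this
  · exact List.nodup_reverse.2 this

theorem length_ex {ι : Type*} (m : ℕ) (l : ι × Bool) : (ex m l).length = m := by
  unfold ex
  split_ifs <;> simp

theorem range_reverse_map (m : ℕ) : (List.range m).map (fun i => m - 1 - i) =
    (List.range m).reverse := by
  apply List.ext_getElem
  · simp
  · intro i h1 h2
    simp

theorem count_exw {ι : Type*} [DecidableEq ι] (m : ℕ) (W : List (ι × Bool)) (p : ι × ℕ) :
    (exw m W).count p ≤ (W.map Prod.fst).count p.1 := by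
  induction W with
  | nil => simp [exw]
  | cons l W ih =>
    have : exw m (l :: W) = ex m l ++ exw m W := by simp [exw]
    rw [this, List.count_append, List.map_cons, List.count_cons]
    have h1 : (ex m l).count p ≤ if l.1 == p.1 then 1 else 0 := by
      by_cases h : l.1 = p.1
      · simp only [h, beq_self_eq_true, if_true]
        exact List.nodup_iff_count_le_one.1 (nodup_ex m l) p
      · rw [List.count_eq_zero_of_not_mem]
        · exact Nat.zero_le _
        · rw [mem_ex]; rintro ⟨h1, _⟩; exact h h1.symm
    omega

/-- Renaming performed by a signed splice. -/
def ren {ι : Type*} [DecidableEq ι] (x y : ι) (s t : Bool) (l : ι × Bool) : ι × Bool :=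
  if l.1 = y then (x, if s = t then !l.2 else l.2) else l

theorem red_signed_splice {ι : Type*} [DecidableEq ι] (m : ℕ) {W1 W2 : List (ι × Bool)}
    {x y : ι} {s t : Bool} (hxy : x ≠ y) (hy : ((W1 ++ W2).map Prod.fst).count y ≤ 1) :
    Red m (exw m (W1 ++ (x, s) :: (y, t) :: W2)) (exw m ((W1 ++ W2).map (ren x y s t))) := by
  let ρ : ι × ℕ → ι × ℕ := fun p =>
    if p.1 = y ∧ p.2 < m then (x, if s = t then m - 1 - p.2 else p.2) else p
  have hρ1 : ∀ u, (ex m (y, u)).map ρ = ex m (x, if s = t then !u else u) := by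
    intro u
    have base : ((List.range m).map (fun i => (y, i))).map ρ =
        ex m (x, if s = t then false else true) := by
      rw [List.map_map]
      by_cases hst : s = t
      · simp only [hst, if_true, ex]
        simp only [Bool.false_eq_true, if_false]
        rw [← List.map_reverse, ← range_reverse_map, List.map_map]
        refine List.map_congr_left ?_
        intro i hi
        simp only [List.mem_range] at hi
        simp [ρ, hi, hst]
      · simp only [hst, if_false, ex, if_true]
        refine List.map_congr_left ?_
        intro i hi
        simp only [List.mem_range] at hi
        simp [ρ, hi, hst]
    cases u
    · have : ex m (y, false) = ((List.range m).map (fun i => (y, i))).reverse := by simp [ex]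
      rw [this, List.map_reverse, base, ex_reverse]
      congr 2
      split_ifs <;> rfl
    · have : ex m (y, true) = ((List.range m).map (fun i => (y, i))) := by simp [ex]
      rw [this, base]
      congr 2
  have hρ2 : ∀ l : ι × Bool, (ex m l).map ρ = ex m (ren x y s t l) := by
    rintro ⟨a, u⟩
    by_cases h : a = y
    · subst h
      rw [hρ1]
      simp [ren]
    · simp only [ren, h, if_false]
      conv_rhs => rw [← List.map_id (ex m (a, u))]
      refine List.map_congr_left ?_
      intro p hp
      rw [mem_ex] at hp
      simp [ρ, hp.1, h]
  have hρ3 : ∀ W : List (ι × Bool), (exw m W).map ρ = exw m (W.map (ren x y s t)) := by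
    intro W
    simp only [exw, List.map_flatMap, List.flatMap_map]
    congr 1
    funext l
    exact hρ2 l
  have := red_bundle (ex m (y, t)) (exw m W1) (exw m W2) (ex m (x, s)) ρ ?_ ?_ (nodup_ex m _) ?_ ?_
  · rw [length_ex] at this
    have e1 : exw m (W1 ++ (x, s) :: (y, t) :: W2) =
        exw m W1 ++ ex m (x, s) ++ ex m (y, t) ++ exw m W2 := by
      simp [exw]
    have e2 : exw m W1 ++ exw m W2 = exw m (W1 ++ W2) := by simp [exw]
    rw [e2, hρ3] at this
    rw [e1]
    exact this
  · rw [ex_reverse, hρ1]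
    congr 2
    cases s <;> cases t <;> rfl
  · intro z hz
    rw [mem_ex] at hz
    simp only [ρ]
    rw [if_neg hz]
  · intro z hz hz'
    rw [mem_ex] at hz hz'
    exact hxy (hz.1.symm.trans hz'.1)
  · intro p hp
    rw [mem_ex] at hp
    have e2 : exw m W1 ++ exw m W2 = exw m (W1 ++ W2) := by simp [exw]
    rw [e2]
    have hcnt := count_exw m (W1 ++ W2) p
    rw [hp.1] at hcnt
    have e : (instBEqProd : BEq (ι × ℕ)) = instBEqOfDecidableEq := lawful_beq_subsingleton _ _
    rw [e] at hcnt
    exact hcnt.trans hy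

theorem exw_map {ι κ : Type*} (m : ℕ) (g : ι → κ) (W : List (ι × Bool)) :
    exw m (W.map (Prod.map g id)) = (exw m W).map (Prod.map g id) := by
  simp only [exw, List.map_flatMap, List.flatMap_map]
  congr 1
  funext l
  obtain ⟨a, u⟩ := l
  cases u <;> simp [ex]

theorem mem_exw {ι : Type*} {m : ℕ} {W : List (ι × Bool)} {p : ι × ℕ} (h : p ∈ exw m W) :
    ∃ l ∈ W, l.1 = p.1 ∧ p.2 < m := by
  simp only [exw, List.mem_flatMap] at h
  obtain ⟨l, hl, hp⟩ := h
  rw [mem_ex] at hp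
  exact ⟨l, hl, hp.1.symm, hp.2⟩

theorem red_mapLetters {ι κ : Type*} (m : ℕ) (g : ι → κ) (W : List (ι × Bool))
    (hg : ∀ a ∈ W, ∀ b ∈ W, g a.1 = g b.1 → a.1 = b.1) :
    Red 0 (exw m W) (exw m (W.map (Prod.map g id))) := by
  rw [exw_map]
  refine red_map _ ?_
  rintro ⟨a, i⟩ ha ⟨b, j⟩ hb h
  obtain ⟨l, hl, hl1, _⟩ := mem_exw ha
  obtain ⟨l', hl', hl1', _⟩ := mem_exw hb
  simp only [Prod.map, id, Prod.mk.injEq] at h hl1 hl1' ⊢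
  refine ⟨?_, h.2⟩
  rw [← hl1, ← hl1']
  exact hg l hl l' hl' (by rw [hl1, hl1']; exact h.1)

theorem red_unmapLetters {ι κ : Type*} (m : ℕ) (g : ι → κ) (W : List (ι × Bool)) :
    Red 0 (exw m (W.map (Prod.map g id))) (exw m W) := by
  rw [exw_map]
  exact red_unmap _

theorem exw_sub {ι : Type*} (m : ℕ) {W W' : List (ι × Bool)} (h : W'.Sublist W) :
    (exw m W').Sublist (exw m W) := by
  induction h with
  | slnil => simp [exw]
  | cons a _ ih => exact ih.trans (by simp [exw])
  | cons_cons a _ ih =>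
    simp only [exw, List.flatMap_cons] at ih ⊢
    exact List.Sublist.append (List.Sublist.refl _) ih

/-- Doubling of a letter. -/
def dupl {ι : Type*} (l : ι × Bool) : List ((ι × Bool) × Bool) :=
  if l.2 then [((l.1, false), true), ((l.1, true), true)]
  else [((l.1, true), false), ((l.1, false), false)]

/-- Doubling of a word. -/
def dup {ι : Type*} (W : List (ι × Bool)) : List ((ι × Bool) × Bool) := W.flatMap dupl

theorem red_dup {ι : Type*} (m : ℕ) (W : List (ι × Bool)) :
    Red 0 (exw (2 * m) W) (exw m (dup W)) := by
  let φ : ι × ℕ → (ι × Bool) × ℕ := fun p =>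
    if p.2 < m then ((p.1, false), p.2) else ((p.1, true), p.2 - m)
  have h1 : ∀ l : ι × Bool, (ex (2 * m) l).map φ = exw m (dupl l) := by
    have base : ∀ a : ι, ((List.range (2 * m)).map (fun i => (a, i))).map φ =
        (List.range m).map (fun i => ((a, false), i)) ++
        (List.range m).map (fun i => ((a, true), i)) := by
      intro a
      rw [two_mul, List.range_add, List.map_append, List.map_append, List.map_map, List.map_map,
        List.map_map]
      congr 1
      · refine List.map_congr_left ?_
        intro i hi
        simp only [List.mem_range] at hi
        simp [φ, hi]
      · refine List.map_congr_left ?_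
        intro i hi
        simp [φ]
    rintro ⟨a, u⟩
    cases u
    · simp only [ex, dupl, exw, Bool.false_eq_true, if_false, List.map_reverse, base]
      simp [ex]
    · simp only [ex, dupl, exw, if_true, base]
      simp [ex]
  have h2 : (exw (2 * m) W).map φ = exw m (dup W) := by
    simp only [exw, dup, List.map_flatMap, List.flatMap_assoc]
    congr 1
    funext l
    exact h1 l
  rw [← h2]
  refine red_map _ ?_
  rintro ⟨a, i⟩ _ ⟨b, j⟩ _ h
  simp only [φ] at h
  split_ifs at h with h3 h4 h4
  · simpa using h
  · simp at h
  · simp at h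
  · simp only [Prod.mk.injEq] at h ⊢
    refine ⟨h.1.1, by omega⟩

end DyckMinor

namespace DyckMinor

/-- A local word `L` framed by `U` and `V` on letters disjoint from those of `L`. -/
def fr (U L V : List (ℕ × Bool)) : List ((ℕ ⊕ ℕ) × Bool) :=
  U.map (Prod.map Sum.inl id) ++ L.map (Prod.map Sum.inr id) ++ V.map (Prod.map Sum.inl id)

/-- Local reduction of order `F`. -/
def LS (F : ℕ) (L L' : List (ℕ × Bool)) : Prop :=
  ∀ (U V : List (ℕ × Bool)) (m : ℕ),
    IsMinorOf (wg m (exw m (fr U L' V))) (wg (F * m) (exw (F * m) (fr U L V)))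

theorem LS.trans {F F' : ℕ} {L L' L'' : List (ℕ × Bool)} (h : LS F L L') (h' : LS F' L' L'') :
    LS (F * F') L L'' := by
  intro U V m
  have h1 := h' U V m
  have h2 := h U V (F' * m)
  rw [← mul_assoc] at h2
  exact IsMinorOf.trans h1 h2

/-- Letters of the doubled local word inside the doubled frame. -/
def eR (p : ℕ × Bool) : (ℕ ⊕ ℕ) × Bool := (Sum.inr p.1, p.2)

/-- Letters of the frame inside the doubled frame. -/
def eU (a : ℕ) : (ℕ ⊕ ℕ) × Bool := (Sum.inl a, false)

theorem eR_inj {p q : ℕ × Bool} (h : eR p = eR q) : p = q := by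
  obtain ⟨a, b⟩ := p
  obtain ⟨c, d⟩ := q
  simpa [eR] using h

theorem dup_sub (U : List (ℕ × Bool)) :
    (U.map (Prod.map eU id)).Sublist (dup (U.map (Prod.map Sum.inl id) : List ((ℕ ⊕ ℕ) × Bool))) := by
  induction U with
  | nil => simp [dup]
  | cons l U ih =>
    have : dup ((l :: U).map (Prod.map Sum.inl id) : List ((ℕ ⊕ ℕ) × Bool)) =
        dupl (Prod.map Sum.inl id l) ++ dup (U.map (Prod.map Sum.inl id)) := by simp [dup]
    rw [this, List.map_cons, ← List.singleton_append]
    refine List.Sublist.append ?_ ih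
    obtain ⟨a, u⟩ := l
    cases u <;> simp [dupl, eU]

theorem dup_map (L : List (ℕ × Bool)) :
    dup (L.map (Prod.map Sum.inr id) : List ((ℕ ⊕ ℕ) × Bool)) = (dup L).map (Prod.map eR id) := by
  simp only [dup, List.map_flatMap, List.flatMap_map]
  congr 1
  funext l
  obtain ⟨a, u⟩ := l
  cases u <;> simp [dupl, eR]

theorem count_aux {κ : Type*} [DecidableEq κ] (e : ℕ × Bool → κ) (he : Function.Injective e)
    (e' : ℕ → κ) {y : ℕ × Bool} (hne : ∀ a, e' a ≠ e y) {U V : List (ℕ × Bool)}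
    {D1 D2 : List ((ℕ × Bool) × Bool)} (hy : ((D1 ++ D2).map Prod.fst).count y ≤ 1) :
    (((U.map (Prod.map e' id) ++ D1.map (Prod.map e id)) ++
      (D2.map (Prod.map e id) ++ V.map (Prod.map e' id))).map Prod.fst).count (e y) ≤ 1 := by
  have hUcount : ∀ U : List (ℕ × Bool), e y ∉ (U.map (Prod.map e' id)).map Prod.fst := by
    intro U h
    simp only [List.map_map, List.mem_map] at h
    obtain ⟨a, _, ha⟩ := h
    exact hne _ ha
  have hDcount : ∀ D : List ((ℕ × Bool) × Bool),
      ((D.map (Prod.map e id)).map Prod.fst).count (e y) = (D.map Prod.fst).count y := by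
    intro D
    have : (D.map (Prod.map e id)).map Prod.fst = (D.map Prod.fst).map e := by
      simp [List.map_map, Function.comp_def]
    rw [this]
    exact List.count_map_of_injective _ _ he _
  have h1 := List.count_eq_zero_of_not_mem (hUcount U)
  have h2 := List.count_eq_zero_of_not_mem (hUcount V)
  have h3 := hDcount D1
  have h4 := hDcount D2
  simp only [List.map_append, List.count_append] at hy h1 h2 h3 h4 ⊢
  omega

theorem slide {L L' : List (ℕ × Bool)} (D1 D2 : List ((ℕ × Bool) × Bool)) (x y : ℕ × Bool)
    (s t : Bool) (f : ℕ × Bool → ℕ)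
    (hsub : (D1 ++ (x, s) :: (y, t) :: D2).Sublist (dup L)) (hxy : x ≠ y)
    (hy : ((D1 ++ D2).map Prod.fst).count y ≤ 1)
    (hL' : ((D1 ++ D2).map (ren x y s t)).map (Prod.map f id) = L')
    (hinj : ∀ a ∈ (D1 ++ D2).map (ren x y s t), ∀ b ∈ (D1 ++ D2).map (ren x y s t),
      f a.1 = f b.1 → a.1 = b.1) : LS 2 L L' := by
  intro U V m
  let U' := U.map (Prod.map eU id)
  let V' := V.map (Prod.map eU id)
  have s1 := red_dup m (fr U L V)
  have s2 : Red 0 (exw m (dup (fr U L V)))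
      (exw m ((U' ++ D1.map (Prod.map eR id)) ++ (eR x, s) :: (eR y, t) ::
        (D2.map (Prod.map eR id) ++ V'))) := by
    refine red_sub (exw_sub m ?_)
    have e1 : dup (fr U L V) = dup (U.map (Prod.map Sum.inl id)) ++ (dup L).map (Prod.map eR id) ++
        dup (V.map (Prod.map Sum.inl id)) := by
      rw [← dup_map]
      simp [dup, fr]
    have e2 : ((U' ++ D1.map (Prod.map eR id)) ++ (eR x, s) :: (eR y, t) ::
        (D2.map (Prod.map eR id) ++ V')) =
        U' ++ (D1 ++ (x, s) :: (y, t) :: D2).map (Prod.map eR id) ++ V' := by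
      simp
    rw [e1, e2]
    exact ((dup_sub U).append (hsub.map _)).append (dup_sub V)
  have s3 := red_signed_splice m (W1 := U' ++ D1.map (Prod.map eR id))
    (W2 := D2.map (Prod.map eR id) ++ V') (x := eR x) (y := eR y) (s := s) (t := t)
    (fun h => hxy (eR_inj h)) (count_aux eR (fun _ _ h => eR_inj h) eU (fun a => by simp [eU, eR]) hy)
  have hrenU : ∀ U : List (ℕ × Bool), (U.map (Prod.map eU id)).map (ren (eR x) (eR y) s t) =
      U.map (Prod.map eU id) := by
    intro U
    rw [List.map_map]
    refine List.map_congr_left ?_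
    intro l _
    simp [ren, eU, eR]
  have hrenD : ∀ D : List ((ℕ × Bool) × Bool),
      (D.map (Prod.map eR id)).map (ren (eR x) (eR y) s t) =
      (D.map (ren x y s t)).map (Prod.map eR id) := by
    intro D
    rw [List.map_map, List.map_map]
    refine List.map_congr_left ?_
    rintro ⟨a, u⟩ _
    by_cases h : a = y
    · subst h; simp [ren]
    · have : eR a ≠ eR y := fun h' => h (eR_inj h')
      simp [ren, h, this]
  have e3 : ((U' ++ D1.map (Prod.map eR id)) ++ (D2.map (Prod.map eR id) ++ V')).map
      (ren (eR x) (eR y) s t) =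
      U' ++ ((D1 ++ D2).map (ren x y s t)).map (Prod.map eR id) ++ V' := by
    simp only [List.map_append, hrenD, U', V', hrenU, List.append_assoc]
  rw [e3] at s3
  let g : (ℕ ⊕ ℕ) × Bool → ℕ ⊕ ℕ := fun p => match p with
    | (Sum.inl a, _) => Sum.inl a
    | (Sum.inr a, b) => Sum.inr (f (a, b))
  have s4 := red_mapLetters m g (U' ++ ((D1 ++ D2).map (ren x y s t)).map (Prod.map eR id) ++ V') (by
    have hcases : ∀ a ∈ U' ++ ((D1 ++ D2).map (ren x y s t)).map (Prod.map eR id) ++ V',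
        (∃ n, a.1 = eU n) ∨ ∃ b ∈ (D1 ++ D2).map (ren x y s t), a.1 = eR b.1 := by
      intro a ha
      rw [List.mem_append, List.mem_append] at ha
      rcases ha with (ha | ha) | ha
      · obtain ⟨l, _, rfl⟩ := List.mem_map.1 ha
        exact Or.inl ⟨l.1, rfl⟩
      · obtain ⟨l, hl, rfl⟩ := List.mem_map.1 ha
        exact Or.inr ⟨l, hl, rfl⟩
      · obtain ⟨l, _, rfl⟩ := List.mem_map.1 ha
        exact Or.inl ⟨l.1, rfl⟩
    intro a ha b hb hab
    rcases hcases a ha with ⟨n, hn⟩ | ⟨c, hc, hn⟩ <;> rcases hcases b hb with ⟨n', hn'⟩ | ⟨c', hc', hn'⟩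
    · rw [hn, hn'] at hab ⊢
      simp only [g, eU, Sum.inl.injEq] at hab
      rw [hab]
    · rw [hn, hn'] at hab
      simp [g, eU, eR] at hab
    · rw [hn, hn'] at hab
      simp [g, eU, eR] at hab
    · rw [hn, hn'] at hab ⊢
      simp only [g, eR, Sum.inr.injEq] at hab
      rw [hinj c hc c' hc' hab])
  have e4 : (U' ++ ((D1 ++ D2).map (ren x y s t)).map (Prod.map eR id) ++ V').map (Prod.map g id) =
      fr U L' V := by
    rw [← hL', fr]
    simp only [List.map_append, U', V', List.map_map]
    rfl
  rw [e4] at s4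
  have := ((s1.trans s2).trans s3).trans s4
  have h := this m
  have e5 : m + (0 + 0 + m + 0) = 2 * m := by ring
  rw [e5] at h
  exact h

theorem ccc_hc : LS 32
    [(0, true), (0, true), (1, true), (1, true), (2, true), (2, true)]
    [(0, true), (1, true), (0, false), (1, false), (2, true), (2, true)] := by
  have h0 : LS 2
      [(0, true), (0, true), (1, true), (1, true), (2, true), (2, true)]
      [(0, true), (1, true), (0, true), (1, false), (2, true), (2, true)] :=
    slide [((0, false), true), ((0, true), true), ((0, false), true)]
      [((1, false), true), ((2, false), true), ((2, false), true)] (0, true) (1, false) true true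
      (fun p => [(0, false), (0, true), (2, false)].idxOf p)
      (by decide) (by decide) (by decide) (by decide) (by decide)
  have h1 : LS 2
      [(0, true), (1, true), (0, true), (1, false), (2, true), (2, true)]
      [(0, true), (1, true), (2, true), (0, true), (2, false), (1, true)] :=
    slide [((0, false), true), ((1, false), true), ((1, true), true), ((0, false), true), ((1, true), false)]
      [((2, false), true)] (1, false) (2, false) false true
      (fun p => [(0, false), (1, false), (1, true)].idxOf p)
      (by decide) (by decide) (by decide) (by decide) (by decide)
  have h2 : LS 2
      [(0, true), (1, true), (2, true), (0, true), (2, false), (1, true)]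
      [(0, true), (1, true), (2, true), (1, true), (0, true), (2, true)] :=
    slide [((0, false), true), ((0, true), true), ((1, false), true), ((2, false), true), ((0, false), true)]
      [((1, false), true)] (0, true) (2, false) true false
      (fun p => [(0, false), (0, true), (1, false)].idxOf p)
      (by decide) (by decide) (by decide) (by decide) (by decide)
  have h3 : LS 2
      [(0, true), (1, true), (2, true), (1, true), (0, true), (2, true)]
      [(0, true), (1, true), (0, false), (2, true), (1, true), (2, true)] :=
    slide [((0, false), true), ((1, false), true), ((2, false), true), ((2, true), true), ((1, false), true)]
      [((2, true), true)] (0, false) (2, false) true true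
      (fun p => [(0, false), (1, false), (2, true)].idxOf p)
      (by decide) (by decide) (by decide) (by decide) (by decide)
  have h4 : LS 2
      [(0, true), (1, true), (0, false), (2, true), (1, true), (2, true)]
      [(0, true), (1, true), (0, false), (1, false), (2, true), (2, true)] :=
    slide [((0, false), true), ((1, false), true), ((0, false), false), ((2, false), true), ((2, true), true)]
      [((2, true), true)] (1, false) (2, false) true true
      (fun p => [(0, false), (1, false), (2, true)].idxOf p)
      (by decide) (by decide) (by decide) (by decide) (by decide)
  exact (((h0.trans h1).trans h2).trans h3).trans h4

theorem hc_ccc : LS 32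
    [(0, true), (1, true), (0, false), (1, false), (2, true), (2, true)]
    [(0, true), (0, true), (1, true), (1, true), (2, true), (2, true)] := by
  have h0 : LS 2
      [(0, true), (1, true), (0, false), (1, false), (2, true), (2, true)]
      [(0, true), (1, true), (2, true), (0, false), (2, false), (1, true)] :=
    slide [((0, false), true), ((1, false), true), ((1, true), true), ((0, false), false), ((1, true), false)]
      [((2, false), true)] (1, false) (2, false) false true
      (fun p => [(0, false), (1, false), (1, true)].idxOf p)
      (by decide) (by decide) (by decide) (by decide) (by decide)
  have h1 : LS 2
      [(0, true), (1, true), (2, true), (0, false), (2, false), (1, true)]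
      [(0, true), (1, true), (2, true), (0, false), (1, false), (2, true)] :=
    slide [((0, false), true), ((0, true), true), ((1, false), true)]
      [((0, false), false), ((2, false), false), ((1, false), true)] (2, false) (0, true) true false
      (fun p => [(0, false), (2, false), (1, false)].idxOf p)
      (by decide) (by decide) (by decide) (by decide) (by decide)
  have h2 : LS 2
      [(0, true), (1, true), (2, true), (0, false), (1, false), (2, true)]
      [(0, true), (1, true), (0, false), (2, true), (1, false), (2, true)] :=
    slide [((0, false), true), ((0, true), true), ((1, false), true), ((2, false), true), ((0, true), false)]
      [((2, false), true)] (0, false) (1, false) false false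
      (fun p => [(0, false), (0, true), (2, false)].idxOf p)
      (by decide) (by decide) (by decide) (by decide) (by decide)
  have h3 : LS 2
      [(0, true), (1, true), (0, false), (2, true), (1, false), (2, true)]
      [(0, true), (1, true), (0, false), (1, true), (2, true), (2, true)] :=
    slide [((0, false), true), ((1, false), true), ((0, false), false), ((2, false), true), ((2, true), true)]
      [((2, true), true)] (1, false) (2, false) false true
      (fun p => [(0, false), (1, false), (2, true)].idxOf p)
      (by decide) (by decide) (by decide) (by decide) (by decide)
  have h4 : LS 2
      [(0, true), (1, true), (0, false), (1, true), (2, true), (2, true)]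
      [(0, true), (0, true), (1, true), (1, true), (2, true), (2, true)] :=
    slide [((0, false), true), ((1, false), true), ((1, true), true)]
      [((1, true), true), ((2, false), true), ((2, false), true)] (0, false) (1, false) false true
      (fun p => [(0, false), (1, true), (2, false)].idxOf p)
      (by decide) (by decide) (by decide) (by decide) (by decide)
  exact (((h0.trans h1).trans h2).trans h3).trans h4

theorem ch_ccc : LS 32
    [(0, true), (0, true), (1, true), (2, true), (1, false), (2, false)]
    [(0, true), (0, true), (1, true), (1, true), (2, true), (2, true)] := by
  have h0 : LS 2
      [(0, true), (0, true), (1, true), (2, true), (1, false), (2, false)]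
      [(0, true), (1, true), (0, true), (2, true), (1, true), (2, false)] :=
    slide [((0, false), true), ((0, true), true), ((0, false), true)]
      [((2, false), true), ((1, false), false), ((2, false), false)] (0, true) (1, false) true true
      (fun p => [(0, false), (0, true), (2, false)].idxOf p)
      (by decide) (by decide) (by decide) (by decide) (by decide)
  have h1 : LS 2
      [(0, true), (1, true), (0, true), (2, true), (1, true), (2, false)]
      [(0, true), (1, true), (2, true), (0, true), (2, true), (1, true)] :=
    slide [((0, false), true), ((0, true), true), ((1, false), true), ((0, false), true)]
      [((1, false), true), ((2, false), false)] (0, true) (2, false) true true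
      (fun p => [(0, false), (0, true), (1, false)].idxOf p)
      (by decide) (by decide) (by decide) (by decide) (by decide)
  have h2 : LS 2
      [(0, true), (1, true), (2, true), (0, true), (2, true), (1, true)]
      [(0, true), (1, true), (2, true), (1, false), (0, true), (2, true)] :=
    slide [((0, false), true), ((0, true), true), ((1, false), true), ((2, false), true), ((0, false), true)]
      [((1, false), true)] (0, true) (2, false) true true
      (fun p => [(0, false), (0, true), (1, false)].idxOf p)
      (by decide) (by decide) (by decide) (by decide) (by decide)
  have h3 : LS 2
      [(0, true), (1, true), (2, true), (1, false), (0, true), (2, true)]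
      [(0, true), (0, true), (1, true), (2, true), (1, false), (2, true)] :=
    slide [((0, false), true), ((1, false), true), ((1, true), true), ((2, false), true), ((1, true), false)]
      [((2, false), true)] (1, false) (0, false) false true
      (fun p => [(1, false), (1, true), (2, false)].idxOf p)
      (by decide) (by decide) (by decide) (by decide) (by decide)
  have h4 : LS 2
      [(0, true), (0, true), (1, true), (2, true), (1, false), (2, true)]
      [(0, true), (0, true), (1, true), (1, true), (2, true), (2, true)] :=
    slide [((0, false), true), ((0, false), true), ((1, false), true), ((2, false), true), ((2, true), true)]
      [((2, true), true)] (1, false) (2, false) false true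
      (fun p => [(0, false), (1, false), (2, true)].idxOf p)
      (by decide) (by decide) (by decide) (by decide) (by decide)
  exact (((h0.trans h1).trans h2).trans h3).trans h4

end DyckMinor

namespace DyckMinor

/-- Number of letters of a block. Types: `none` blank, `some true` handle, `some false` crosscap. -/
def wt : Option Bool → ℕ
  | none => 2
  | some true => 2
  | some false => 1

/-- Signed word of a block with letters starting at `o`. -/
def shape (o : ℕ) : Option Bool → List (ℕ × Bool)
  | none => [(o, true), (o + 1, true)]
  | some true => [(o, true), (o + 1, true), (o, false), (o + 1, false)]
  | some false => [(o, true), (o, true)]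

/-- Concatenation of blocks. -/
def cat {α : Type*} (f : ℕ → Option Bool → List α) : ℕ → List (Option Bool) → List α
  | _, [] => []
  | o, t :: T => f o t ++ cat f (o + wt t) T

/-- Total number of letters. -/
def tot (T : List (Option Bool)) : ℕ := (T.map wt).sum

theorem cat_append {α : Type*} (f : ℕ → Option Bool → List α) (T1 T2 : List (Option Bool)) :
    ∀ o, cat f o (T1 ++ T2) = cat f o T1 ++ cat f (o + tot T1) T2 := by
  induction T1 with
  | nil => intro o; simp [cat, tot]
  | cons t T ih =>
    intro o
    simp only [List.cons_append, cat, ih, tot, List.map_cons, List.sum_cons, List.append_assoc,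
      Nat.add_assoc]

theorem cat_shift (n : ℕ) (T : List (Option Bool)) :
    ∀ o, cat shape (n + o) T = (cat shape o T).map (Prod.map (fun a => n + a) id) := by
  induction T with
  | nil => intro o; simp [cat]
  | cons t T ih =>
    intro o
    simp only [cat, List.map_append, Nat.add_assoc, ih]
    congr 1
    rcases t with _ | _ | _ <;> simp [shape, Nat.add_assoc]

theorem mem_shape {o : ℕ} {t : Option Bool} {l : ℕ × Bool} (h : l ∈ shape o t) :
    o ≤ l.1 ∧ l.1 < o + wt t := by
  rcases t with _ | _ | _ <;> simp [shape] at h <;> simp only [wt] <;> grind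

theorem mem_cat {T : List (Option Bool)} {l : ℕ × Bool} :
    ∀ {o}, l ∈ cat shape o T → o ≤ l.1 ∧ l.1 < o + tot T := by
  induction T with
  | nil => intro o h; simp [cat] at h
  | cons t T ih =>
    intro o h
    simp only [cat, List.mem_append] at h
    simp only [tot, List.map_cons, List.sum_cons]
    rcases h with h | h
    · have := mem_shape h
      omega
    · have := ih h
      simp only [tot] at this
      omega

/-- Reduction of block sequences of order `F`. -/
def TS (F : ℕ) (T T' : List (Option Bool)) : Prop :=
  ∀ m, IsMinorOf (wg m (exw m (cat shape 0 T'))) (wg (F * m) (exw (F * m) (cat shape 0 T)))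

theorem TS.trans {F F' : ℕ} {T T' T'' : List (Option Bool)} (h : TS F T T') (h' : TS F' T' T'') :
    TS (F * F') T T'' := by
  intro m
  have h1 := h' m
  have h2 := h (F' * m)
  rw [← mul_assoc] at h2
  exact IsMinorOf.trans h1 h2

/-- Placing frame and local letters into the naturals. -/
def place (n : ℕ) : ℕ ⊕ ℕ → ℕ
  | Sum.inl a => a
  | Sum.inr a => n + a

theorem cat_frame (T1 A T2 : List (Option Bool)) :
    cat shape 0 (T1 ++ A ++ T2) =
      (fr (cat shape 0 T1) (cat shape 0 A) (cat shape (tot T1 + tot A) T2)).map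
        (Prod.map (place (tot T1)) id) := by
  rw [List.append_assoc, cat_append, cat_append]
  simp only [fr, List.map_append, List.map_map, zero_add, List.append_assoc]
  congr 1
  · conv_lhs => rw [← List.map_id (cat shape 0 T1)]
    rfl
  congr 1
  · have := cat_shift (tot T1) A 0
    rw [add_zero] at this
    rw [this]
    rfl
  · conv_lhs => rw [← List.map_id (cat shape _ T2)]
    rfl

theorem LS.toTS {F : ℕ} {A B : List (Option Bool)} (hAB : tot A = tot B)
    (h : LS F (cat shape 0 A) (cat shape 0 B)) (T1 T2 : List (Option Bool)) :
    TS F (T1 ++ A ++ T2) (T1 ++ B ++ T2) := by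
  intro m
  rw [cat_frame, cat_frame, ← hAB]
  set U := cat shape 0 T1 with hU
  set V := cat shape (tot T1 + tot A) T2 with hV
  have h1 := h U V m
  have h2 := red_unmapLetters (F * m) (place (tot T1)) (fr U (cat shape 0 A) V) (F * m)
  have h3 := red_mapLetters m (place (tot T1)) (fr U (cat shape 0 B) V) (by
    have hc : ∀ a ∈ fr U (cat shape 0 B) V,
        (∃ x, a.1 = Sum.inl x ∧ (x < tot T1 ∨ tot T1 + tot A ≤ x)) ∨
        ∃ x, a.1 = Sum.inr x ∧ x < tot A := by
      intro a ha
      simp only [fr, List.mem_append] at ha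
      rcases ha with (ha | ha) | ha
      · obtain ⟨l, hl, rfl⟩ := List.mem_map.1 ha
        have := mem_cat hl
        exact Or.inl ⟨l.1, rfl, Or.inl (by omega)⟩
      · obtain ⟨l, hl, rfl⟩ := List.mem_map.1 ha
        have := mem_cat hl
        exact Or.inr ⟨l.1, rfl, by omega⟩
      · obtain ⟨l, hl, rfl⟩ := List.mem_map.1 ha
        have := mem_cat hl
        exact Or.inl ⟨l.1, rfl, Or.inr (by omega)⟩
    intro a ha b hb hab
    rcases hc a ha with ⟨x, hx, hx'⟩ | ⟨x, hx, hx'⟩ <;>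
      rcases hc b hb with ⟨y, hy, hy'⟩ | ⟨y, hy, hy'⟩ <;>
      rw [hx, hy] at hab ⊢ <;> simp only [place] at hab
    · rw [hab]
    · omega
    · omega
    · rw [Nat.add_left_cancel hab]) m
  exact IsMinorOf.trans h3 (IsMinorOf.trans h1 h2)

theorem ts_ccc_hc (T1 T2 : List (Option Bool)) :
    TS 32 (T1 ++ [some false, some false, some false] ++ T2) (T1 ++ [some true, some false] ++ T2) :=
  LS.toTS (A := [some false, some false, some false])
    (B := [some true, some false]) (by decide) ccc_hc T1 T2

theorem ts_hc_ccc (T1 T2 : List (Option Bool)) :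
    TS 32 (T1 ++ [some true, some false] ++ T2) (T1 ++ [some false, some false, some false] ++ T2) :=
  LS.toTS (A := [some true, some false])
    (B := [some false, some false, some false]) (by decide) hc_ccc T1 T2

theorem ts_ch_ccc (T1 T2 : List (Option Bool)) :
    TS 32 (T1 ++ [some false, some true] ++ T2) (T1 ++ [some false, some false, some false] ++ T2) :=
  LS.toTS (A := [some false, some true])
    (B := [some false, some false, some false]) (by decide) ch_ccc T1 T2

theorem TS.refl (T : List (Option Bool)) : TS 1 T T := by
  intro m
  rw [one_mul]
  exact red_sub (List.Sublist.refl _) m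

theorem exists_adjacent : ∀ bs : List Bool, true ∈ bs → false ∈ bs →
    ∃ p q, bs = p ++ [true, false] ++ q ∨ bs = p ++ [false, true] ++ q := by
  intro bs
  induction bs with
  | nil => intro h; simp at h
  | cons b bs ih =>
    intro ht hf
    cases bs with
    | nil => cases b <;> simp at ht hf
    | cons b' bs =>
      by_cases h : b = b'
      · subst h
        obtain ⟨p, q, hpq⟩ := ih (by simpa using ht) (by simpa using hf)
        refine ⟨b :: p, q, ?_⟩
        rcases hpq with hpq | hpq
        · left; rw [hpq]; simp
        · right; rw [hpq]; simp
      · refine ⟨[], bs, ?_⟩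
        cases b <;> cases b' <;> simp at h ⊢

theorem claimA : ∀ (h c : ℕ) (bs : List Bool), bs.count true = h → bs.count false = c → 0 < c →
    TS (32 ^ h) (none :: bs.map some) (none :: List.replicate (2 * h + c) (some false)) := by
  intro h
  induction h with
  | zero =>
    intro c bs ht hf _
    have h1 : bs = List.replicate c false := by
      rw [List.eq_replicate_iff]
      have hall : ∀ b ∈ bs, b = false := by
        intro b hb
        cases b
        · rfl
        · exact absurd hb (List.count_eq_zero.1 ht)
      refine ⟨?_, hall⟩
      rw [← hf]
      exact (List.count_eq_length.2 (fun b hb => (hall b hb).symm)).symm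
    rw [h1]
    simpa using TS.refl _
  | succ h ih =>
    intro c bs ht hf hc
    obtain ⟨p, q, hpq⟩ := exists_adjacent bs (List.count_pos_iff.1 (by omega))
      (List.count_pos_iff.1 (by omega))
    have hstep : TS 32 (none :: bs.map some)
        (none :: (p ++ [false, false, false] ++ q).map some) := by
      rcases hpq with rfl | rfl
      · simpa using ts_hc_ccc (none :: p.map some) (q.map some)
      · simpa using ts_ch_ccc (none :: p.map some) (q.map some)
    have hc1 : (p ++ [false, false, false] ++ q).count true = h := by
      rcases hpq with rfl | rfl <;> simp at ht ⊢ <;> omega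
    have hc2 : (p ++ [false, false, false] ++ q).count false = c + 2 := by
      rcases hpq with rfl | rfl <;> simp at hf ⊢ <;> omega
    have := hstep.trans (ih (c + 2) _ hc1 hc2 (by omega))
    rw [show 2 * (h + 1) + c = 2 * h + (c + 2) by ring, pow_succ']
    exact this

theorem claimB : ∀ (j i c : ℕ), 0 < c →
    TS (32 ^ j) (none :: (List.replicate i (some true) ++ List.replicate (2 * j + c) (some false)))
      (none :: (List.replicate (i + j) (some true) ++ List.replicate c (some false))) := by
  intro j
  induction j with
  | zero => intro i c _; simpa using TS.refl _
  | succ j ih =>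
    intro i c hc
    have h1 := ts_ccc_hc (none :: List.replicate i (some true))
      (List.replicate (2 * j + c - 1) (some false))
    have e1 : none :: List.replicate i (some true) ++ [some false, some false, some false] ++
        List.replicate (2 * j + c - 1) (some false) =
        none :: (List.replicate i (some true) ++ List.replicate (2 * (j + 1) + c) (some false)) := by
      rw [show 2 * (j + 1) + c = (2 * j + c - 1) + 1 + 1 + 1 by omega]
      simp [List.replicate_succ]
    have e2 : none :: List.replicate i (some true) ++ [some true, some false] ++
        List.replicate (2 * j + c - 1) (some false) =
        none :: (List.replicate (i + 1) (some true) ++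
          List.replicate (2 * j + c) (some false)) := by
      rw [show 2 * j + c = (2 * j + c - 1) + 1 by omega, List.replicate_succ' (n := i)]
      simp [List.replicate_succ]
    rw [e1, e2] at h1
    have := h1.trans (ih (i + 1) c hc)
    rw [show i + (j + 1) = i + 1 + j by ring, pow_succ']
    exact this

/-- Column labels of a block of the mixed surface grid of order `K`. -/
def blk (K o : ℕ) : Option Bool → List (ℕ × ℕ)
  | none => exw (2 * K) (shape o none)
  | some true => exw K (shape o (some true))
  | some false => exw (2 * K) (shape o (some false))

theorem ex_mono {ι : Type*} {m m' : ℕ} (h : m ≤ m') (l : ι × Bool) :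
    (ex m l).Sublist (ex m' l) := by
  have : ((List.range m).map (fun i => (l.1, i))).Sublist
      ((List.range m').map (fun i => (l.1, i))) := (List.range_sublist.2 h).map _
  unfold ex
  split_ifs
  · exact this
  · exact this.reverse

theorem exw_mono {ι : Type*} {m m' : ℕ} (h : m ≤ m') (W : List (ι × Bool)) :
    (exw m W).Sublist (exw m' W) := by
  induction W with
  | nil => simp [exw]
  | cons l W ih =>
    simp only [exw, List.flatMap_cons] at ih ⊢
    exact (ex_mono h l).append ih

theorem exw_append {ι : Type*} (m : ℕ) (W W' : List (ι × Bool)) :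
    exw m (W ++ W') = exw m W ++ exw m W' := by simp [exw]

theorem sub_blk (K : ℕ) (T : List (Option Bool)) :
    ∀ o, (exw K (cat shape o T)).Sublist (cat (blk K) o T) := by
  induction T with
  | nil => intro o; simp [cat, exw]
  | cons t T ih =>
    intro o
    simp only [cat, exw_append]
    refine List.Sublist.append ?_ (ih _)
    rcases t with _ | _ | _
    · exact exw_mono (by omega) _
    · exact exw_mono (by omega) _
    · exact exw_mono (by omega) _

theorem blk_sub (k : ℕ) (T : List (Option Bool)) :
    ∀ o, (cat (blk k) o T).Sublist (exw (2 * k) (cat shape o T)) := by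
  induction T with
  | nil => intro o; simp [cat]
  | cons t T ih =>
    intro o
    simp only [cat, exw_append]
    refine List.Sublist.append ?_ (ih _)
    rcases t with _ | _ | _
    · exact exw_mono (by omega) _
    · exact exw_mono (by omega) _
    · exact exw_mono (by omega) _

theorem length_exw {ι : Type*} (m : ℕ) (W : List (ι × Bool)) :
    (exw m W).length = W.length * m := by
  induction W with
  | nil => simp [exw]
  | cons l W ih =>
    simp only [exw, List.flatMap_cons, List.length_append, length_ex, List.length_cons] at ih ⊢
    rw [ih]; ring

theorem length_blk (K o : ℕ) (t : Option Bool) : (blk K o t).length = 4 * K := by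
  rcases t with _ | _ | _ <;> simp only [blk, length_exw, shape, List.length_cons, List.length_nil] <;>
    ring

theorem length_cat_blk (K : ℕ) (T : List (Option Bool)) :
    ∀ o, (cat (blk K) o T).length = 4 * T.length * K := by
  induction T with
  | nil => intro o; simp [cat]
  | cons t T ih =>
    intro o
    simp only [cat, List.length_append, length_blk, ih, List.length_cons]
    ring

theorem getElem?_cat_blk (K : ℕ) (T : List (Option Bool)) : ∀ (o q j : ℕ) (t : Option Bool),
    T[q]? = some t → j < 4 * K →
    (cat (blk K) o T)[4 * K * q + j]? = (blk K (o + tot (T.take q)) t)[j]? := by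
  induction T with
  | nil => intro o q j t h; simp at h
  | cons t0 T ih =>
    intro o q j t h hj
    cases q with
    | zero =>
      simp only [List.getElem?_cons_zero, Option.some.injEq] at h
      subst h
      simp only [cat, List.take_zero, tot, List.map_nil, List.sum_nil, mul_zero, zero_add, add_zero]
      rw [List.getElem?_append_left]
      rw [length_blk]; exact hj
    | succ q =>
      simp only [List.getElem?_cons_succ] at h
      simp only [cat]
      rw [List.getElem?_append_right (by rw [length_blk]; nlinarith), length_blk]
      have : 4 * K * (q + 1) + j - 4 * K = 4 * K * q + j := by
        rw [Nat.mul_add, mul_one]; omega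
      rw [this, ih _ _ _ _ h hj]
      simp [tot, Nat.add_assoc]

/-- Label of column `j` of a block. -/
def blkL (K o : ℕ) (t : Option Bool) (j : ℕ) : ℕ × ℕ :=
  match t with
  | none => if j < 2 * K then (o, j) else (o + 1, j - 2 * K)
  | some true => if j < K then (o, j) else if j < 2 * K then (o + 1, j - K) else
      if j < 3 * K then (o, 3 * K - 1 - j) else (o + 1, 4 * K - 1 - j)
  | some false => if j < 2 * K then (o, j) else (o, j - 2 * K)

theorem ex_true_get {m a j : ℕ} (h : j < m) : (ex m (a, true))[j]? = some (a, j) := by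
  simp [ex, h]

theorem ex_false_get {m a j : ℕ} (h : j < m) : (ex m (a, false))[j]? = some (a, m - 1 - j) := by
  simp only [ex, Bool.false_eq_true, if_false]
  rw [List.getElem?_reverse (by simpa using h)]
  rw [List.getElem?_map, List.length_map, List.length_range, List.getElem?_range (by omega)]
  rfl

theorem blk_get (K o : ℕ) (t : Option Bool) (j : ℕ) (hj : j < 4 * K) :
    (blk K o t)[j]? = some (blkL K o t j) := by
  rcases t with _ | _ | _
  · simp only [blk, shape, exw, List.flatMap_cons, List.flatMap_nil, List.append_nil, blkL]
    split_ifs with h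
    · rw [List.getElem?_append_left (by rw [length_ex]; omega), ex_true_get h]
    · rw [List.getElem?_append_right (by rw [length_ex]; omega), length_ex,
        ex_true_get (by omega)]
  · simp only [blk, shape, exw, List.flatMap_cons, List.flatMap_nil, List.append_nil, blkL]
    split_ifs with h
    · rw [List.getElem?_append_left (by rw [length_ex]; omega), ex_true_get h]
    · rw [List.getElem?_append_right (by rw [length_ex]; omega), length_ex,
        ex_true_get (by omega)]
  · simp only [blk, shape, exw, List.flatMap_cons, List.flatMap_nil, List.append_nil, blkL]
    split_ifs with h h2 h3
    · rw [List.getElem?_append_left (by rw [length_ex]; omega), ex_true_get h]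
    · rw [List.getElem?_append_right (by rw [length_ex]; omega), length_ex,
        List.getElem?_append_left (by rw [length_ex]; omega), ex_true_get (by omega)]
    · rw [List.getElem?_append_right (by rw [length_ex]; omega), length_ex,
        List.getElem?_append_right (by rw [length_ex]; omega), length_ex,
        List.getElem?_append_left (by rw [length_ex]; omega), ex_false_get (by omega)]
      congr 2; omega
    · rw [List.getElem?_append_right (by rw [length_ex]; omega), length_ex,
        List.getElem?_append_right (by rw [length_ex]; omega), length_ex,
        List.getElem?_append_right (by rw [length_ex]; omega), length_ex,
        ex_false_get (by omega)]
      congr 2; omega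

theorem cat_get (K : ℕ) (T : List (Option Bool)) (q j : ℕ) (t : Option Bool) (h : T[q]? = some t)
    (hj : j < 4 * K) :
    (cat (blk K) 0 T)[4 * K * q + j]? = some (blkL K (tot (T.take q)) t j) := by
  rw [getElem?_cat_blk K T 0 q j t h hj, blk_get _ _ _ _ hj, zero_add]

theorem blkL_bound (K o : ℕ) (t : Option Bool) (j : ℕ) :
    o ≤ (blkL K o t j).1 ∧ (blkL K o t j).1 < o + wt t := by
  rcases t with _ | _ | _ <;> simp only [blkL, wt] <;> split_ifs <;> simp

theorem tot_take_succ {T : List (Option Bool)} {q : ℕ} {t : Option Bool} (h : T[q]? = some t) :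
    tot (T.take (q + 1)) = tot (T.take q) + wt t := by
  rw [List.take_add_one, h]
  simp [tot]

theorem tot_take_mono (T : List (Option Bool)) {q q' : ℕ} (h : q ≤ q') :
    tot (T.take q) ≤ tot (T.take q') := by
  obtain ⟨d, rfl⟩ := Nat.exists_eq_add_of_le h
  rw [List.take_add]
  simp [tot]

theorem block_unique {K : ℕ} {T : List (Option Bool)} {q q' j j' : ℕ} {t t' : Option Bool}
    (h : T[q]? = some t) (h' : T[q']? = some t')
    (e : blkL K (tot (T.take q)) t j = blkL K (tot (T.take q')) t' j') : q = q' := by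
  have b := blkL_bound K (tot (T.take q)) t j
  have b' := blkL_bound K (tot (T.take q')) t' j'
  rw [← e] at b'
  have s := tot_take_succ h
  have s' := tot_take_succ h'
  rcases lt_trichotomy q q' with hlt | heq | hlt
  · have := tot_take_mono T (show q + 1 ≤ q' from hlt)
    omega
  · exact heq
  · have := tot_take_mono T (show q' + 1 ≤ q from hlt)
    omega

end DyckMinor

namespace DyckMinor

/-- The chord relation of the mixed grid on one-based natural indices. -/
def CR (K : ℕ) (Ih Ic : Finset ℕ) (a b : ℕ) : Prop :=
  (∃ i ∈ Ih, ∃ j ∈ Finset.Icc 1 K,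
    ((a = 4 * K * (i - 1) + j ∧ b = 4 * K * (i - 1) + 3 * K - j + 1) ∨
      (a = 4 * K * (i - 1) + K + j ∧ b = 4 * K * (i - 1) + 4 * K - j + 1))) ∨
  (∃ i ∈ Ic, ∃ j ∈ Finset.Icc 1 (2 * K),
    (a = 4 * K * (i - 1) + j ∧ b = 4 * K * (i - 1) + 2 * K + j))

theorem chord_host_aux {K o q j j' : ℕ} {t : Option Bool} {Ih Ic : Finset ℕ} (hlt : j < j')
    (hj' : j' < 4 * K)
    (e : blkL K o t j = blkL K o t j') (h1 : t = some true → q + 1 ∈ Ih)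
    (h2 : t = some false → q + 1 ∈ Ic) :
    CR K Ih Ic (4 * K * q + j + 1) (4 * K * q + j' + 1) := by
  rcases t with _ | _ | _
  · simp only [blkL] at e
    split_ifs at e <;> simp only [Prod.mk.injEq] at e <;> omega
  · simp only [blkL] at e
    right
    refine ⟨q + 1, h2 rfl, j + 1, ?_, ?_⟩
    · rw [Finset.mem_Icc]
      split_ifs at e <;> simp only [Prod.mk.injEq] at e <;> omega
    · rw [Nat.add_sub_cancel]
      split_ifs at e <;> simp only [Prod.mk.injEq] at e <;> omega
  · simp only [blkL] at e
    left
    by_cases hjK : j < K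
    · refine ⟨q + 1, h1 rfl, j + 1, ?_, Or.inl ?_⟩
      · rw [Finset.mem_Icc]; omega
      · rw [Nat.add_sub_cancel]
        split_ifs at e <;> simp only [Prod.mk.injEq] at e <;> omega
    · refine ⟨q + 1, h1 rfl, j + 1 - K, ?_, Or.inr ?_⟩
      · rw [Finset.mem_Icc]
        split_ifs at e <;> simp only [Prod.mk.injEq] at e <;> omega
      · rw [Nat.add_sub_cancel]
        split_ifs at e <;> simp only [Prod.mk.injEq] at e <;> omega

theorem get_label {K : ℕ} (hK : 0 < K) {T : List (Option Bool)} {c : ℕ}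
    (hc : c < 4 * T.length * K) :
    ∃ q j t, j < 4 * K ∧ c = 4 * K * q + j ∧ T[q]? = some t := by
  have h4 : 0 < 4 * K := by omega
  have hq : c / (4 * K) < T.length := by
    rw [Nat.div_lt_iff_lt_mul h4]
    calc c < 4 * T.length * K := hc
      _ = T.length * (4 * K) := by ring
  exact ⟨c / (4 * K), c % (4 * K), T[c / (4 * K)], Nat.mod_lt _ h4,
    (Nat.div_add_mod _ _).symm, List.getElem?_eq_getElem hq⟩

theorem chord_host {K : ℕ} (hK : 0 < K) {T : List (Option Bool)} {Ih Ic : Finset ℕ}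
    (h1 : ∀ q : ℕ, T[q]? = some (some true) → q + 1 ∈ Ih)
    (h2 : ∀ q : ℕ, T[q]? = some (some false) → q + 1 ∈ Ic)
    {c c' : ℕ} (hc : c < 4 * T.length * K) (hc' : c' < 4 * T.length * K) (hne : c ≠ c')
    (e : (cat (blk K) 0 T)[c]? = (cat (blk K) 0 T)[c']?) :
    CR K Ih Ic (c + 1) (c' + 1) ∨ CR K Ih Ic (c' + 1) (c + 1) := by
  obtain ⟨q, j, t, hj, rfl, hq⟩ := get_label hK hc
  obtain ⟨q', j', t', hj', rfl, hq'⟩ := get_label hK hc'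
  rw [cat_get K T q j t hq hj, cat_get K T q' j' t' hq' hj', Option.some.injEq] at e
  obtain rfl := block_unique hq hq' e
  rw [hq, Option.some.injEq] at hq'
  subst hq'
  rcases Nat.lt_or_gt_of_ne (fun h : j = j' => hne (by rw [h])) with hlt | hlt
  · exact Or.inl (chord_host_aux hlt hj' e (fun h => h1 q (h ▸ hq)) (fun h => h2 q (h ▸ hq)))
  · exact Or.inr (chord_host_aux hlt hj e.symm (fun h => h1 q (h ▸ hq)) (fun h => h2 q (h ▸ hq)))

theorem chord_target {K : ℕ} {T : List (Option Bool)} {Ih Ic : Finset ℕ}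
    (h1 : ∀ i ∈ Ih, 1 ≤ i ∧ T[i - 1]? = some (some true))
    (h2 : ∀ i ∈ Ic, 1 ≤ i ∧ T[i - 1]? = some (some false))
    {a b : ℕ} (h : CR K Ih Ic a b) :
    ∃ c c', a = c + 1 ∧ b = c' + 1 ∧ c < 4 * T.length * K ∧ c' < 4 * T.length * K ∧
      (cat (blk K) 0 T)[c]? = (cat (blk K) 0 T)[c']? := by
  have key : ∀ (q j j' : ℕ) (t : Option Bool), T[q]? = some t → j < 4 * K → j' < 4 * K →
      (∀ o, blkL K o t j = blkL K o t j') →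
      4 * K * q + j < 4 * T.length * K ∧ 4 * K * q + j' < 4 * T.length * K ∧
      (cat (blk K) 0 T)[4 * K * q + j]? = (cat (blk K) 0 T)[4 * K * q + j']? := by
    intro q j j' t hq hj hj' e
    have hb : ∀ j, j < 4 * K → 4 * K * q + j < 4 * T.length * K := by
      intro j hj
      have hl : q + 1 ≤ T.length := (List.getElem?_eq_some_iff.1 hq).1
      have := Nat.mul_le_mul_left (4 * K) hl
      have e2 : 4 * K * T.length = 4 * T.length * K := by ring
      rw [mul_add] at this
      omega
    exact ⟨hb j hj, hb j' hj', by rw [cat_get K T q j t hq hj, cat_get K T q j' t hq hj', e]⟩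
  rcases h with ⟨i, hi, j, hj, h⟩ | ⟨i, hi, j, hj, ha, hb⟩
  · rw [Finset.mem_Icc] at hj
    obtain ⟨-, hq⟩ := h1 i hi
    rcases h with ⟨ha, hb⟩ | ⟨ha, hb⟩
    · refine ⟨4 * K * (i - 1) + (j - 1), 4 * K * (i - 1) + (3 * K - j), by omega, by omega,
        key _ _ _ _ hq (by omega) (by omega) ?_⟩
      intro o
      simp only [blkL]
      split_ifs <;> first | omega | (simp only [Prod.mk.injEq, true_and]; omega)
    · refine ⟨4 * K * (i - 1) + (K + j - 1), 4 * K * (i - 1) + (4 * K - j), by omega, by omega,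
        key _ _ _ _ hq (by omega) (by omega) ?_⟩
      intro o
      simp only [blkL]
      split_ifs <;> first | omega | (simp only [Prod.mk.injEq, true_and]; omega)
  · rw [Finset.mem_Icc] at hj
    obtain ⟨-, hq⟩ := h2 i hi
    refine ⟨4 * K * (i - 1) + (j - 1), 4 * K * (i - 1) + (2 * K + j - 1), by omega, by omega,
      key _ _ _ _ hq (by omega) (by omega) ?_⟩
    intro o
    simp only [blkL]
    split_ifs <;> first | omega | (simp only [Prod.mk.injEq, true_and]; omega)

theorem CR.cast {K n : ℕ} {Ih Ic : Finset ℕ} {a b : ℕ} (h : CR K Ih Ic a b) (r s : Fin K)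
    (hr : r.val = 0) (hs : s.val = 0) :
    ((r : ℕ) = 0 ∧ (s : ℕ) = 0 ∧ ∃ i ∈ Ih, ∃ j ∈ Finset.Icc 1 K,
      (((a : ZMod (4 * n * K)) = ((4 * K * (i - 1) + j : ℕ) : ZMod (4 * n * K)) ∧
        (b : ZMod (4 * n * K)) = ((4 * K * (i - 1) + 3 * K - j + 1 : ℕ) : ZMod (4 * n * K))) ∨
       ((a : ZMod (4 * n * K)) = ((4 * K * (i - 1) + K + j : ℕ) : ZMod (4 * n * K)) ∧
        (b : ZMod (4 * n * K)) = ((4 * K * (i - 1) + 4 * K - j + 1 : ℕ) : ZMod (4 * n * K))))) ∨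
    ((r : ℕ) = 0 ∧ (s : ℕ) = 0 ∧ ∃ i ∈ Ic, ∃ j ∈ Finset.Icc 1 (2 * K),
      (a : ZMod (4 * n * K)) = ((4 * K * (i - 1) + j : ℕ) : ZMod (4 * n * K)) ∧
      (b : ZMod (4 * n * K)) = ((4 * K * (i - 1) + 2 * K + j : ℕ) : ZMod (4 * n * K))) := by
  rcases h with ⟨i, hi, j, hj, h⟩ | ⟨i, hi, j, hj, ha, hb⟩
  · left
    refine ⟨hr, hs, i, hi, j, hj, ?_⟩
    rcases h with ⟨ha, hb⟩ | ⟨ha, hb⟩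
    · exact Or.inl ⟨congrArg _ ha, congrArg _ hb⟩
    · exact Or.inr ⟨congrArg _ ha, congrArg _ hb⟩
  · right
    exact ⟨hr, hs, i, hi, j, hj, congrArg _ ha, congrArg _ hb⟩

theorem cast_inj_lt {N a b : ℕ} (ha : a < N) (hb : b < N)
    (h : ((a + 1 : ℕ) : ZMod N) = ((b + 1 : ℕ) : ZMod N)) : a = b := by
  push_cast at h
  have h2 : (a : ZMod N) = b := add_right_cancel h
  rw [ZMod.natCast_eq_natCast_iff'] at h2
  rwa [Nat.mod_eq_of_lt ha, Nat.mod_eq_of_lt hb] at h2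

theorem host_minor {K n : ℕ} (hK : 0 < K) {T : List (Option Bool)} (hT : T.length = n)
    {Ih Ic : Finset ℕ}
    (h1 : ∀ q : ℕ, T[q]? = some (some true) → q + 1 ∈ Ih)
    (h2 : ∀ q : ℕ, T[q]? = some (some false) → q + 1 ∈ Ic) :
    IsMinorOf (wg K (cat (blk K) 0 T)) (mixedGrid K n Ih Ic) := by
  have hlen : (cat (blk K) 0 T).length = 4 * n * K := by rw [length_cat_blk, hT]
  have hlt : ∀ c : Fin (cat (blk K) 0 T).length, c.val < 4 * n * K := fun c => hlen ▸ c.2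
  refine minor_of_inj _ _ (fun p => (p.1, ((p.2.val + 1 : ℕ) : ZMod (4 * n * K)))) ?_ ?_
  · rintro ⟨r, c⟩ ⟨r', c'⟩ h
    simp only [Prod.mk.injEq] at h
    obtain ⟨rfl, h⟩ := h
    rw [Fin.ext (cast_inj_lt (hlt c) (hlt c') h)]
  · rintro ⟨r, c⟩ ⟨r', c'⟩ hne h
    rcases h with ⟨hr, h | ⟨h, h'⟩⟩ | ⟨h, h'⟩ | ⟨hr, hr', h⟩
    · left; left
      refine ⟨hr, ?_⟩
      simp only at h ⊢
      rw [h]; push_cast; ring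
    · left; left
      refine ⟨hr, ?_⟩
      simp only at h h' ⊢
      rw [h, h', hlen]
      simp
    · left; right; left
      simp only at h h' ⊢
      exact ⟨by rw [h], h'⟩
    · simp only at hr hr' h
      have hrr : r = r' := Fin.ext (by omega)
      have hcc : c.val ≠ c'.val := fun hh => hne (by rw [hrr, Fin.ext hh])
      have e : (cat (blk K) 0 T)[c.val]? = (cat (blk K) 0 T)[c'.val]? := by
        rw [List.getElem?_eq_getElem c.2, List.getElem?_eq_getElem c'.2]
        exact congrArg some h
      rcases chord_host hK h1 h2 (hT ▸ hlt c) (hT ▸ hlt c') hcc e with h | h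
      · left; right; right
        exact h.cast r r' hr hr'
      · right; right; right
        exact h.cast r' r hr' hr

theorem CR.of_cast {k n : ℕ} {Ih Ic : Finset ℕ} {x y : ZMod (4 * n * k)}
    (h : (∃ i ∈ Ih, ∃ j ∈ Finset.Icc 1 k,
      ((x = ((4 * k * (i - 1) + j : ℕ) : ZMod (4 * n * k)) ∧
        y = ((4 * k * (i - 1) + 3 * k - j + 1 : ℕ) : ZMod (4 * n * k))) ∨
       (x = ((4 * k * (i - 1) + k + j : ℕ) : ZMod (4 * n * k)) ∧
        y = ((4 * k * (i - 1) + 4 * k - j + 1 : ℕ) : ZMod (4 * n * k))))) ∨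
    (∃ i ∈ Ic, ∃ j ∈ Finset.Icc 1 (2 * k),
      x = ((4 * k * (i - 1) + j : ℕ) : ZMod (4 * n * k)) ∧
      y = ((4 * k * (i - 1) + 2 * k + j : ℕ) : ZMod (4 * n * k)))) :
    ∃ a b : ℕ, x = (a : ZMod (4 * n * k)) ∧ y = (b : ZMod (4 * n * k)) ∧ CR k Ih Ic a b := by
  rcases h with ⟨i, hi, j, hj, ⟨ha, hb⟩ | ⟨ha, hb⟩⟩ | ⟨i, hi, j, hj, ha, hb⟩
  · exact ⟨_, _, ha, hb, Or.inl ⟨i, hi, j, hj, Or.inl ⟨rfl, rfl⟩⟩⟩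
  · exact ⟨_, _, ha, hb, Or.inl ⟨i, hi, j, hj, Or.inr ⟨rfl, rfl⟩⟩⟩
  · exact ⟨_, _, ha, hb, Or.inr ⟨i, hi, j, hj, rfl, rfl⟩⟩

theorem target_minor {k n : ℕ} (hk : 0 < k) (hn : 0 < n) {T : List (Option Bool)}
    (hT : T.length = n) {Ih Ic : Finset ℕ}
    (h1 : ∀ i ∈ Ih, 1 ≤ i ∧ T[i - 1]? = some (some true))
    (h2 : ∀ i ∈ Ic, 1 ≤ i ∧ T[i - 1]? = some (some false)) :
    IsMinorOf (mixedGrid k n Ih Ic) (wg k (cat (blk k) 0 T)) := by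
  have hlen : (cat (blk k) 0 T).length = 4 * n * k := by rw [length_cat_blk, hT]
  have hN : 0 < 4 * n * k := by positivity
  have hNZ : NeZero (4 * n * k) := ⟨hN.ne'⟩
  have hval : ∀ z : ZMod (4 * n * k), z.val < (cat (blk k) 0 T).length :=
    fun z => by rw [hlen]; exact ZMod.val_lt z
  have hsub : ∀ c : ℕ, c < 4 * n * k → (((c + 1 : ℕ) : ZMod (4 * n * k)) - 1).val = c := by
    intro c hc
    push_cast
    rw [add_sub_cancel_right, ZMod.val_natCast, Nat.mod_eq_of_lt hc]
  refine minor_of_inj _ _ (fun p => (p.1, (⟨(p.2 - 1).val, hval _⟩ : Fin _))) ?_ ?_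
  · rintro ⟨r, z⟩ ⟨r', z'⟩ h
    simp only [Prod.mk.injEq, Fin.mk.injEq] at h
    obtain ⟨rfl, h⟩ := h
    have := ZMod.val_injective _ h
    rw [sub_left_inj.1 this]
  · rintro ⟨r, z⟩ ⟨r', z'⟩ hne h
    left
    rcases h with ⟨hr, h⟩ | ⟨h, h'⟩ | h
    · left
      refine ⟨hr, ?_⟩
      simp only at h ⊢
      subst h
      have hz : z + 1 - 1 = (z - 1) + 1 := by ring
      rw [hz]
      generalize z - 1 = y
      have hy := ZMod.val_lt y
      rcases Nat.lt_or_ge (y.val + 1) (4 * n * k) with hl | hl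
      · left
        have : (y + 1) = ((y.val + 1 : ℕ) : ZMod (4 * n * k)) := by simp
        rw [this, ZMod.val_natCast, Nat.mod_eq_of_lt hl]
      · right
        have he : y.val + 1 = 4 * n * k := by omega
        have : (y + 1) = ((y.val + 1 : ℕ) : ZMod (4 * n * k)) := by simp
        rw [this, he, hlen]
        simp
    · right; left
      simp only at h h' ⊢
      subst h
      exact ⟨rfl, h'⟩
    · right; right
      have h0 : r.val = 0 ∧ r'.val = 0 := by
        rcases h with ⟨a, b, -⟩ | ⟨a, b, -⟩ <;> exact ⟨a, b⟩
      refine ⟨h0.1, h0.2, ?_⟩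
      obtain ⟨a, b, ha, hb, hab⟩ := CR.of_cast (h.imp (fun h => h.2.2) (fun h => h.2.2))
      obtain ⟨c, c', rfl, rfl, hc, hc', e⟩ := chord_target h1 h2 hab
      rw [hT] at hc hc'
      simp only at ha hb
      subst ha hb
      have hc1 : c < (cat (blk k) 0 T).length := hlen ▸ hc
      have hc2 : c' < (cat (blk k) 0 T).length := hlen ▸ hc'
      rw [List.getElem?_eq_getElem hc1, List.getElem?_eq_getElem hc2, Option.some.injEq] at e
      simp only [List.get_eq_getElem, hsub c hc, hsub c' hc']
      exact e

theorem wg_sub {α : Type*} {w w' : List α} (R : ℕ) (h : w'.Sublist w) :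
    IsMinorOf (wg R w') (wg R w) := red_sub h R

theorem wg_rows {α : Type*} (w : List α) {R R' : ℕ} (h : R' ≤ R) :
    IsMinorOf (wg R' w) (wg R w) := chordGrid_rows h (fun _ _ _ e => e)

theorem TS.minor {F K k : ℕ} {T T' : List (Option Bool)} (h : TS F T T')
    (hF : F * (2 * k) ≤ K) :
    IsMinorOf (wg k (cat (blk k) 0 T')) (wg K (cat (blk K) 0 T)) := by
  have a1 := wg_sub k (blk_sub k T' 0)
  have a2 := wg_rows (exw (2 * k) (cat shape 0 T')) (show k ≤ 2 * k by omega)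
  have a3 := h (2 * k)
  have a4 := wg_rows (exw (F * (2 * k)) (cat shape 0 T)) hF
  have a5 := wg_sub K ((exw_mono hF (cat shape 0 T)).trans (sub_blk K T 0))
  exact IsMinorOf.trans a1 (IsMinorOf.trans a2 (IsMinorOf.trans a3 (IsMinorOf.trans a4 a5)))

theorem count_range {h c : ℕ} {Ih : Finset ℕ} (hs : Ih ⊆ Finset.Icc 2 (h + c + 1))
    (hIh : Ih.card = h) :
    ((List.range (h + c)).map (fun q => decide (q + 2 ∈ Ih))).count true = h ∧
    ((List.range (h + c)).map (fun q => decide (q + 2 ∈ Ih))).count false = c := by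
  have h1 : ((List.range (h + c)).map (fun q => decide (q + 2 ∈ Ih))).count true = h := by
    have e : ((Finset.range (h + c)).filter (fun q => q + 2 ∈ Ih)).card = Ih.card := by
      refine Finset.card_bij (fun q _ => q + 2) ?_ ?_ ?_
      · intro a ha; exact (Finset.mem_filter.1 ha).2
      · intro a _ b _ hab; exact Nat.add_right_cancel hab
      · intro b hb
        have := Finset.mem_Icc.1 (hs hb)
        refine ⟨b - 2, ?_, by omega⟩
        rw [Finset.mem_filter, Finset.mem_range, show b - 2 + 2 = b by omega]
        exact ⟨by omega, hb⟩
    rw [hIh] at e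
    rw [List.count, List.countP_map, List.countP_eq_length_filter]
    refine Eq.trans ?_ e
    rw [Finset.card_def, Finset.filter_val, Finset.range_val, Multiset.range,
      Multiset.filter_coe, Multiset.coe_card]
    congr 2
    funext q
    simp
  refine ⟨h1, ?_⟩
  have := List.count_true_add_count_false
    ((List.range (h + c)).map (fun q => decide (q + 2 ∈ Ih)))
  rw [List.length_map, List.length_range, h1] at this
  omega

theorem bound {h h₀ c g k : ℕ} (hc : 0 < c) (hg : g = 2 * h + c) (hh : h₀ ≤ c) :
    32 ^ h * 32 ^ (h + h₀) * (2 * k) ≤ 162 ^ (2 * g) * k := by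
  have e1 : 32 ^ h * 32 ^ (h + h₀) * 2 ≤ 162 ^ (2 * g) := by
    calc 32 ^ h * 32 ^ (h + h₀) * 2 = 32 ^ (2 * h + h₀) * 2 := by rw [← pow_add]; congr 2; ring
      _ ≤ 162 ^ (2 * h + h₀) * 162 := Nat.mul_le_mul (Nat.pow_le_pow_left (by norm_num) _)
          (by norm_num)
      _ = 162 ^ (2 * h + h₀ + 1) := (pow_succ _ _).symm
      _ ≤ 162 ^ (2 * g) := Nat.pow_le_pow_right (by norm_num) (by omega)
  calc 32 ^ h * 32 ^ (h + h₀) * (2 * k) = 32 ^ h * 32 ^ (h + h₀) * 2 * k := by ring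
    _ ≤ _ := Nat.mul_le_mul_right k e1

theorem main (g h c h₀ c₀ k : ℕ)
    (hc : 0 < c) (hg : g = 2 * h + c)
    (hh₀ : h₀ = (c + 1) / 2 - 1) (hc₀ : c₀ = c - 2 * h₀)
    (hk : 0 < k)
    (Ih Ic : Finset ℕ)
    (hpart : Ih ∪ Ic = Finset.Icc 2 (h + c + 1)) (hIh : Ih.card = h) :
    IsMinorOf (dyckGrid k (h + h₀) c₀) (mixedGrid (162 ^ (2 * g) * k) (h + c + 1) Ih Ic) := by
  set bs := (List.range (h + c)).map (fun q => decide (q + 2 ∈ Ih)) with hbs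
  obtain ⟨ct, cf⟩ := count_range (hpart ▸ Finset.subset_union_left) hIh
  have tA := claimA h c bs ct cf hc
  have tB := claimB (h + h₀) 0 c₀ (by omega)
  rw [show 2 * (h + h₀) + c₀ = 2 * h + c by omega, List.replicate_zero, List.nil_append,
    zero_add] at tB
  have mid := (tA.trans tB).minor (bound (k := k) hc hg (show h₀ ≤ c by omega))
  refine IsMinorOf.trans ?_ (IsMinorOf.trans mid ?_)
  · refine target_minor hk (by omega) (by simp) ?_ ?_
    · intro i hi
      rw [Finset.mem_Icc] at hi
      refine ⟨by omega, ?_⟩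
      obtain ⟨d, rfl⟩ := Nat.exists_eq_add_of_le hi.1
      rw [show 2 + d - 1 = d + 1 by omega, List.getElem?_cons_succ,
        List.getElem?_append_left (by simp; omega), List.getElem?_replicate, if_pos (by omega)]
    · intro i hi
      rw [Finset.mem_Icc] at hi
      refine ⟨by omega, ?_⟩
      obtain ⟨d, rfl⟩ := Nat.exists_eq_add_of_le hi.1
      rw [show h + h₀ + 2 + d - 1 = (h + h₀ + d) + 1 by omega, List.getElem?_cons_succ,
        List.getElem?_append_right (by simp), List.getElem?_replicate,
        if_pos (by simp; omega)]
  · have key : ∀ (q : ℕ) (b : Bool), (none :: bs.map some)[q]? = some (some b) →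
        1 ≤ q ∧ q < h + c + 1 ∧ b = decide (q + 1 ∈ Ih) := by
      intro q b hq
      rcases q with _ | q
      · simp at hq
      · rw [List.getElem?_cons_succ, hbs, List.map_map, List.getElem?_map,
          Option.map_eq_some_iff] at hq
        obtain ⟨a, ha, hab⟩ := hq
        obtain ⟨hl, rfl⟩ := List.getElem?_eq_some_iff.1 ha
        simp at hab hl
        exact ⟨by omega, by omega, hab.symm⟩
    refine host_minor (by positivity) (by simp [hbs]) ?_ ?_
    · intro q hq
      have := (key q true hq).2.2
      simpa using this
    · intro q hq
      obtain ⟨a1, a2, a3⟩ := key q false hq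
      have hm : q + 1 ∈ Ih ∪ Ic := by rw [hpart, Finset.mem_Icc]; omega
      rcases Finset.mem_union.1 hm with h | h
      · simp [h] at a3
      · exact h

end DyckMinor

/-- Let `g, h, c` be integers with `c > 0` and `g = 2h + c > 0`, and set
`h₀ := ⌈c/2⌉ − 1` and `c₀ := c − 2h₀`.  Then for every integer `k > 0` and every partition
`{I_hdl, I_crscp}` of `[2, h+c+1]` with `|I_hdl| = h` and `|I_crscp| = c`, the mixed surface
grid of order `162^(2g)·k` with `h` handles and `c` crosscaps contains the Dyck grid
`D_k^{(h+h₀, c₀)}` as a minor. -/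
theorem mixedGrid_contains_dyckGrid (g h c h₀ c₀ k : ℕ)
    (hc : 0 < c) (hg : g = 2 * h + c)
    (hh₀ : h₀ = (c + 1) / 2 - 1) (hc₀ : c₀ = c - 2 * h₀)
    (hk : 0 < k)
    (Ih Ic : Finset ℕ)
    (hpart : Ih ∪ Ic = Finset.Icc 2 (h + c + 1)) (hdisj : Disjoint Ih Ic)
    (hIh : Ih.card = h) (hIc : Ic.card = c) :
    IsMinorOf (dyckGrid k (h + h₀) c₀) (mixedGrid (162 ^ (2 * g) * k) (h + c + 1) Ih Ic) := by
  exact DyckMinor.main g h c h₀ c₀ k hc hg hh₀ hc₀ hk Ih Ic hpart hIh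
end

section
/- Let g, h, c be integers with c > 0 and g = 2h + c > 0, and set h₀ := ⌈c/2⌉ − 1 and c₀ := c − 2h₀. Then for every integer k > 0 and every partition {I_hdl, I_crscp} of [2, h+c+1] with |I_hdl| = h and |I_crscp| = c, the Dyck-grid D^{(h+h₀, c₀)}_{162^{2g}·k} contains the mixed surface grid H^k_{I_hdl,I_crscp} of order k with h handles and c crosscaps as a minor. -/
open SimpleGraph

/-! ### Minor machinery -/

lemma minor_crit {α β : Type*} {H : SimpleGraph α} {G : SimpleGraph β}
    (F : β → α → Prop) (root : α → β) (rank : α → β → ℕ)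
    (huniq : ∀ b a a', F b a → F b a' → a = a')
    (hroot : ∀ a, F (root a) a)
    (hstep : ∀ a b, F b a → b = root a ∨ ∃ b', F b' a ∧ G.Adj b b' ∧ rank a b' < rank a b)
    (hadj : ∀ a a', H.Adj a a' → ∃ b b', F b a ∧ F b' a' ∧ G.Adj b b') :
    IsMinorOf H G := by
  refine ⟨fun a => {b | F b a}, ?_, ?_, ?_⟩
  · intro a a' hne
    rw [Set.disjoint_left]
    intro b hb hbt
    exact hne (huniq b a a' hb hbt)
  · intro a
    have key : ∀ n : ℕ, ∀ b (hb : F b a), rank a b ≤ n →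
        (G.induce {b | F b a}).Reachable ⟨b, hb⟩ ⟨root a, hroot a⟩ := by
      intro n
      induction n with
      | zero =>
        intro b hb hr
        rcases hstep a b hb with h | ⟨b', _, _, h3⟩
        · subst h; exact SimpleGraph.Reachable.refl _
        · omega
      | succ n ih =>
        intro b hb hr
        rcases hstep a b hb with h | ⟨b', h1, h2, h3⟩
        · subst h; exact SimpleGraph.Reachable.refl _
        · refine SimpleGraph.Reachable.trans ?_ (ih b' h1 (by omega))
          apply SimpleGraph.Adj.reachable
          simpa using h2
    have : Nonempty ({b | F b a} : Set β) := ⟨⟨root a, hroot a⟩⟩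
    refine SimpleGraph.Connected.mk ?_
    rintro ⟨b, hb⟩ ⟨b', hbt⟩
    exact (key _ b hb le_rfl).trans (key _ b' hbt le_rfl).symm
  · intro a a' h
    obtain ⟨b, b', h1, h2, h3⟩ := hadj a a' h
    exact ⟨b, h1, b', h2, h3⟩

lemma minor_of_inj {α β : Type*} {H : SimpleGraph α} {G : SimpleGraph β} (f : α → β)
    (hf : Function.Injective f) (h : ∀ a a', H.Adj a a' → G.Adj (f a) (f a')) :
    IsMinorOf H G :=
  minor_crit (fun b a => b = f a) f (fun _ _ => 0) (fun _ _ _ h1 h2 => hf (h1.symm.trans h2))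
    (fun _ => rfl) (fun _ _ h => Or.inl h) (fun a a' hh => ⟨_, _, rfl, rfl, h a a' hh⟩)

lemma minor_trans {α β γ : Type*} {H : SimpleGraph α} {G : SimpleGraph β} {K : SimpleGraph γ}
    (h1 : IsMinorOf H G) (h2 : IsMinorOf G K) : IsMinorOf H K := by
  obtain ⟨X, hX1, hX2, hX3⟩ := h1
  obtain ⟨Y, hY1, hY2, hY3⟩ := h2
  refine ⟨fun v => {c | ∃ a ∈ X v, c ∈ Y a}, ?_, ?_, ?_⟩
  · intro u v huv
    rw [Set.disjoint_left]
    rintro c ⟨a, ha, hc⟩ ⟨a', ha', hc'⟩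
    have hne : a ≠ a' := by
      rintro rfl
      exact Set.disjoint_left.1 (hX1 u v huv) ha ha'
    exact Set.disjoint_left.1 (hY1 a a' hne) hc hc'
  · intro v
    have hin : ∀ a (ha : a ∈ X v) c c' (hc : c ∈ Y a) (hc' : c' ∈ Y a),
        (K.induce {c | ∃ a ∈ X v, c ∈ Y a}).Reachable ⟨c, a, ha, hc⟩ ⟨c', a, ha, hc'⟩ := by
      intro a ha c c' hc hc'
      have h := (hY2 a).preconnected ⟨c, hc⟩ ⟨c', hc'⟩
      have hsub : Y a ⊆ {c | ∃ a ∈ X v, c ∈ Y a} := fun c hc => ⟨a, ha, hc⟩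
      exact h.map (SimpleGraph.induceHomOfLE K hsub).toHom
    have hwalk : ∀ (a a' : X v), (G.induce (X v)).Walk a a' → ∀ c c' (hc : c ∈ Y a.1)
        (hc' : c' ∈ Y a'.1),
        (K.induce {c | ∃ a ∈ X v, c ∈ Y a}).Reachable ⟨c, a.1, a.2, hc⟩ ⟨c', a'.1, a'.2, hc'⟩ := by
      intro a a' w
      induction w with
      | nil => intro c c' hc hc'; exact hin _ (Subtype.property _) _ _ hc hc'
      | cons hadj p ih =>
        rename_i x y z
        intro c c' hc hc'
        obtain ⟨d, hd, e, he, hde⟩ := hY3 x.1 y.1 (by simpa using hadj)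
        refine (hin _ x.2 c d hc hd).trans (SimpleGraph.Reachable.trans ?_ (ih e c' he hc'))
        apply SimpleGraph.Adj.reachable
        simpa using hde
    obtain ⟨⟨a0, ha0⟩⟩ := (hX2 v).nonempty
    obtain ⟨⟨c0, hc0⟩⟩ := (hY2 a0).nonempty
    have : Nonempty ({c | ∃ a ∈ X v, c ∈ Y a} : Set γ) := ⟨⟨c0, a0, ha0, hc0⟩⟩
    refine SimpleGraph.Connected.mk ?_
    rintro ⟨c, a, ha, hc⟩ ⟨c', a', ha', hc'⟩
    obtain ⟨w⟩ := (hX2 v).preconnected ⟨a, ha⟩ ⟨a', ha'⟩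
    exact hwalk _ _ w c c' hc hc'
  · intro u v huv
    obtain ⟨a, ha, b, hb, hab⟩ := hX3 u v huv
    obtain ⟨c, hc, d, hd, hcd⟩ := hY3 a b hab
    exact ⟨c, ⟨a, ha, hc⟩, d, ⟨b, hb, hd⟩, hcd⟩

/-! ### Grids with a labelled top row -/

/-- One-directional adjacency of the labelled cylindrical grid, in natural coordinates. -/
def grel (N : ℕ) (l : ℕ → Option ℕ) (i j i' j' : ℕ) : Prop :=
  (i = i' ∧ (j' = j + 1 ∨ (j + 1 = N ∧ j' = 0))) ∨ (j = j' ∧ i' = i + 1) ∨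
    (i = 0 ∧ i' = 0 ∧ l j = l j')

/-- Cylindrical grid with `R` rows and `N` columns; top row vertices with equal labels are joined. -/
def Gr (R N : ℕ) (l : ℕ → Option ℕ) : SimpleGraph (Fin R × Fin N) :=
  SimpleGraph.fromRel (fun p q => grel N l p.1 p.2 q.1 q.2)

lemma gr_adj {R N : ℕ} {l : ℕ → Option ℕ} {p q : Fin R × Fin N} :
    (Gr R N l).Adj p q ↔ p ≠ q ∧ (grel N l p.1 p.2 q.1 q.2 ∨ grel N l q.1 q.2 p.1 p.2) := by
  simp [Gr, SimpleGraph.fromRel_adj]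

lemma gr_adj' {R N : ℕ} {l : ℕ → Option ℕ} {i i' j j' : ℕ} (hi : i < R) (hi' : i' < R)
    (hj : j < N) (hj' : j' < N) (hne : i ≠ i' ∨ j ≠ j')
    (h : grel N l i j i' j' ∨ grel N l i' j' i j) :
    (Gr R N l).Adj (⟨i, hi⟩, ⟨j, hj⟩) (⟨i', hi'⟩, ⟨j', hj'⟩) := by
  rw [gr_adj]
  refine ⟨?_, h⟩
  simp only [ne_eq, Prod.mk.injEq, Fin.mk.injEq]
  omega

/-- A criterion for minors between labelled grids, in natural coordinates. -/
lemma gr_crit {R N R' N' : ℕ} {l l' : ℕ → Option ℕ}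
    (F : ℕ → ℕ → ℕ → ℕ → Prop) (rr rc : ℕ → ℕ → ℕ) (rank : ℕ → ℕ → ℕ → ℕ → ℕ)
    (huniq : ∀ i' j' i j i₂ j₂, i < R → j < N → i₂ < R → j₂ < N → i' < R' → j' < N' →
      F i' j' i j → F i' j' i₂ j₂ → i = i₂ ∧ j = j₂)
    (hroot : ∀ i j, i < R → j < N → rr i j < R' ∧ rc i j < N' ∧ F (rr i j) (rc i j) i j)
    (hstep : ∀ i j i' j', i < R → j < N → i' < R' → j' < N' → F i' j' i j →
      (i' = rr i j ∧ j' = rc i j) ∨ ∃ i₂ j₂, i₂ < R' ∧ j₂ < N' ∧ F i₂ j₂ i j ∧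
        (i' ≠ i₂ ∨ j' ≠ j₂) ∧ (grel N' l' i' j' i₂ j₂ ∨ grel N' l' i₂ j₂ i' j') ∧
        rank i j i₂ j₂ < rank i j i' j')
    (hadj : ∀ i j i₂ j₂, i < R → j < N → i₂ < R → j₂ < N → (i ≠ i₂ ∨ j ≠ j₂) →
      grel N l i j i₂ j₂ → ∃ x y x' y', x < R' ∧ y < N' ∧ x' < R' ∧ y' < N' ∧
        F x y i j ∧ F x' y' i₂ j₂ ∧ (grel N' l' x y x' y' ∨ grel N' l' x' y' x y)) :
    IsMinorOf (Gr R N l) (Gr R' N' l') := by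
  have hroot' : ∀ a : Fin R × Fin N, _ := fun a => hroot a.1 a.2 a.1.2 a.2.2
  refine minor_crit (fun b a => F b.1 b.2 a.1 a.2)
    (fun a => (⟨rr a.1 a.2, (hroot' a).1⟩, ⟨rc a.1 a.2, (hroot' a).2.1⟩))
    (fun a b => rank a.1 a.2 b.1 b.2) ?_ ?_ ?_ ?_
  · rintro ⟨b1, b2⟩ ⟨a1, a2⟩ ⟨c1, c2⟩ h1 h2
    have := huniq b1 b2 a1 a2 c1 c2 a1.2 a2.2 c1.2 c2.2 b1.2 b2.2 h1 h2
    ext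
    · exact this.1
    · exact this.2
  · intro a
    exact (hroot' a).2.2
  · rintro ⟨a1, a2⟩ ⟨b1, b2⟩ h
    rcases hstep a1 a2 b1 b2 a1.2 a2.2 b1.2 b2.2 h with ⟨h1, h2⟩ | ⟨i₂, j₂, h1, h2, h3, h4, h5, h6⟩
    · left
      ext
      · exact h1
      · exact h2
    · right
      exact ⟨(⟨i₂, h1⟩, ⟨j₂, h2⟩), h3, gr_adj' b1.2 h1 b2.2 h2 h4 h5, h6⟩
  · have main : ∀ a a' : Fin R × Fin N, a ≠ a' → grel N l a.1 a.2 a'.1 a'.2 →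
        ∃ b b' : Fin R' × Fin N', F b.1 b.2 a.1 a.2 ∧ F b'.1 b'.2 a'.1 a'.2 ∧
          (Gr R' N' l').Adj b b' := by
      rintro ⟨a1, a2⟩ ⟨c1, c2⟩ hne h
      have hne' : (a1 : ℕ) ≠ c1 ∨ (a2 : ℕ) ≠ c2 := by
        by_contra hcon
        push Not at hcon
        apply hne
        ext
        · exact hcon.1
        · exact hcon.2
      obtain ⟨x, y, x', y', hx, hy, hx', hy', hF, hF', hg⟩ :=
        hadj a1 a2 c1 c2 a1.2 a2.2 c1.2 c2.2 hne' h
      refine ⟨(⟨x, hx⟩, ⟨y, hy⟩), (⟨x', hx'⟩, ⟨y', hy'⟩), hF, hF', gr_adj' _ _ _ _ ?_ hg⟩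
      by_contra hcon
      push Not at hcon
      obtain ⟨rfl, rfl⟩ := hcon
      have := huniq x y a1 a2 c1 c2 a1.2 a2.2 c1.2 c2.2 hx hy hF hF'
      omega
    intro a a' h
    rw [gr_adj] at h
    rcases h with ⟨hne, h | h⟩
    · exact main a a' hne h
    · obtain ⟨b, b', h1, h2, h3⟩ := main a' a hne.symm h
      exact ⟨b', b, h2, h1, h3.symm⟩

/-- More rows. -/
lemma gr_rows (R d N : ℕ) (l : ℕ → Option ℕ) : IsMinorOf (Gr R N l) (Gr (R + d) N l) := by
  refine gr_crit (fun i' j' i j => i' = i ∧ j' = j) (fun i _ => i) (fun _ j => j)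
    (fun _ _ _ _ => 0) ?_ ?_ ?_ ?_
  · intros; omega
  · intros; omega
  · intros; left; assumption
  · intro i j i₂ j₂ h1 h2 h3 h4 _ hg
    exact ⟨i, j, i₂, j₂, by omega, h2, by omega, h4, ⟨rfl, rfl⟩, ⟨rfl, rfl⟩, Or.inl hg⟩

/-- Deleting one column. -/
lemma gr_del {R N p : ℕ} {l l' : ℕ → Option ℕ} (hp : p ≤ N) (hN : 0 < N)
    (h1 : ∀ j, j < p → l j = l' j) (h2 : ∀ j, p ≤ j → l j = l' (j + 1)) :
    IsMinorOf (Gr R N l) (Gr R (N + 1) l') := by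
  refine gr_crit (fun i' j' i j => i' = i ∧
      ((j' < p ∧ j = j') ∨ (j' = p ∧ j = p - 1) ∨ (p < j' ∧ j' = j + 1))) (fun i _ => i)
    (fun _ j => if j < p then j else j + 1)
    (fun _ j _ j' => (j' - (if j < p then j else j + 1)) + ((if j < p then j else j + 1) - j')) ?_ ?_ ?_ ?_
  · intros; omega
  · intro i j hi hj
    split_ifs <;> omega
  · intro i j i' j' hi hj hi' hj' hF
    simp only [grel]
    by_cases hj2 : j' = p
    · right
      rcases Nat.eq_zero_or_pos p with h0 | h0
      · refine ⟨i', 1, hi', by omega, by omega, by omega, by omega, ?_⟩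
        split_ifs <;> omega
      · refine ⟨i', p - 1, hi', by omega, by omega, by omega, by omega, ?_⟩
        split_ifs <;> omega
    · left
      split_ifs <;> omega
  · intro i j i₂ j₂ hi hj hi2 hj2 hne hg
    simp only [grel] at hg ⊢
    rcases hg with ⟨he, hg⟩ | ⟨he, hg⟩ | ⟨he1, he2, he3⟩
    · rcases hg with hg | ⟨hg, hg'⟩
      · by_cases hc : j₂ < p
        · exact ⟨i, j, i, j₂, by omega, by omega, by omega, by omega, by omega, by omega, by omega⟩
        · by_cases hc2 : j < p
          · exact ⟨i, p, i, p + 1, by omega, by omega, by omega, by omega, by omega, by omega, by omega⟩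
          · exact ⟨i, j + 1, i, j₂ + 1, by omega, by omega, by omega, by omega, by omega, by omega, by omega⟩
      · exact ⟨i, N, i, 0, by omega, by omega, by omega, by omega, by omega, by omega, by omega⟩
    · by_cases hc : j < p
      · exact ⟨i, j, i₂, j, by omega, by omega, by omega, by omega, by omega, by omega, by omega⟩
      · exact ⟨i, j + 1, i₂, j + 1, by omega, by omega, by omega, by omega, by omega, by omega, by omega⟩
    · refine ⟨i, if j < p then j else j + 1, i₂, if j₂ < p then j₂ else j₂ + 1, by omega,
        by split_ifs <;> omega, by omega, by split_ifs <;> omega, by split_ifs <;> omega,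
        by split_ifs <;> omega, Or.inl (Or.inr (Or.inr ⟨he1, he2, ?_⟩))⟩
      have a1 := h1 j
      have a2 := h2 j
      have a3 := h1 j₂
      have a4 := h2 j₂
      split_ifs with c1 c2 c2
      · rw [← a1 c1, ← a3 c2, he3]
      · rw [← a1 c1, ← a4 (by omega), he3]
      · rw [← a2 (by omega), ← a3 c2, he3]
      · rw [← a2 (by omega), ← a4 (by omega), he3]

/-- Contracting two adjacent columns: the paths arriving there are glued. -/
lemma gr_contract {R N p : ℕ} {l l' : ℕ → Option ℕ} (hp : p ≤ N) (hN : 0 < N)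
    (lift : ℕ → ℕ) (hlift : ∀ j, (j < p ∧ lift j = j) ∨ (p ≤ j ∧ lift j = j + 2))
    (hl : ∀ j j', j < N → j' < N → j ≠ j' → l j = l j' →
      l' (lift j) = l' (lift j') ∨ (l' (lift j) = l' p ∧ l' (lift j') = l' (p + 1)) ∨
        (l' (lift j') = l' p ∧ l' (lift j) = l' (p + 1)))
    (hu : ∀ j j', j < N → j' < N → l' (lift j) = l' p → l' (lift j') = l' p → j = j')
    (hu' : ∀ j j', j < N → j' < N → l' (lift j) = l' (p + 1) → l' (lift j') = l' (p + 1) → j = j') :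
    IsMinorOf (Gr R N l) (Gr (R + 1) (N + 2) l') := by
  refine gr_crit (fun i' j' i j => (i' = i + 1 ∧ ((j' < p ∧ j = j') ∨
        (p ≤ j' ∧ j' < p + 2 ∧ j = p - 1) ∨ (p + 2 ≤ j' ∧ j' = j + 2))) ∨
      (i' = 0 ∧ i = 0 ∧ (j' = lift j ∨ (j' = p ∧ l' (lift j) = l' p) ∨
        (j' = p + 1 ∧ l' (lift j) = l' (p + 1))))) (fun i _ => i + 1)
    (fun _ j => lift j)
    (fun _ j i' j' => if i' = 0 then (if j' = lift j then 1 else 2) else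
      (j' - lift j) + (lift j - j')) ?_ ?_ ?_ ?_
  · intro i' j' i j i₂ j₂ hi hj hi2 hj2 hi' hj' hF hF'
    have a1 := hlift j
    have a2 := hlift j₂
    have a3 := hu j j₂ hj hj2
    have a4 := hu' j j₂ hj hj2
    rcases hF with hF | ⟨b1, b2, hF⟩
    · omega
    · rcases hF' with hF' | ⟨c1, c2, hF'⟩
      · omega
      · refine ⟨by omega, ?_⟩
        rcases hF with hF | ⟨hF, hF2⟩ | ⟨hF, hF2⟩ <;>
        rcases hF' with hF' | ⟨hF', hF2'⟩ | ⟨hF', hF2'⟩ <;> first | omega | exact a3 hF2 hF2' | exact a4 hF2 hF2'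
  · intro i j hi hj
    have a1 := hlift j
    refine ⟨by omega, by omega, Or.inl ⟨rfl, ?_⟩⟩
    omega
  · intro i j i' j' hi hj hi' hj' hF
    have a1 := hlift j
    rcases hF with ⟨hF1, hF2⟩ | ⟨hF1, hF2, hF3⟩
    · by_cases hj2 : j' = lift j
      · left; exact ⟨hF1, hj2⟩
      · right
        simp only [grel]
        have hi0 : i' ≠ 0 := by omega
        simp only [hi0, if_false]
        by_cases h0 : p = 0
        · refine ⟨i', j' + 1, hi', by omega, Or.inl (by omega), by omega, by omega, ?_⟩
          simp only [hi0, if_false]; omega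
        · refine ⟨i', j' - 1, hi', by omega, Or.inl (by omega), by omega, by omega, ?_⟩
          simp only [hi0, if_false]; omega
    · right
      subst hF1 hF2
      by_cases hj2 : j' = lift j
      · refine ⟨1, lift j, by omega, by omega, Or.inl (by omega), by omega, ?_, ?_⟩
        · left; right; left; exact ⟨hj2, rfl⟩
        · simp [hj2]
      · refine ⟨0, lift j, by omega, by omega, Or.inr ⟨rfl, rfl, Or.inl rfl⟩, by omega, ?_, ?_⟩
        · left; right; right
          refine ⟨rfl, rfl, ?_⟩
          rcases hF3 with h | ⟨h, h'⟩ | ⟨h, h'⟩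
          · omega
          · rw [h, h']
          · rw [h, h']
        · simp [hj2]
  · intro i j i₂ j₂ hi hj hi2 hj2 hne hg
    have b1 := hlift j
    have b2 := hlift j₂
    rcases hg with ⟨he, hg⟩ | ⟨he, hg⟩ | ⟨he1, he2, he3⟩
    · rcases hg with hg | ⟨hg, hg'⟩
      · by_cases hc : j₂ < p
        · exact ⟨i + 1, j, i + 1, j₂, by omega, by omega, by omega, by omega, Or.inl (by omega),
            Or.inl (by omega), Or.inl (Or.inl (by omega))⟩
        · by_cases hc2 : j < p
          · exact ⟨i + 1, p + 1, i + 1, p + 2, by omega, by omega, by omega, by omega, Or.inl (by omega),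
              Or.inl (by omega), Or.inl (Or.inl (by omega))⟩
          · exact ⟨i + 1, j + 2, i + 1, j₂ + 2, by omega, by omega, by omega, by omega, Or.inl (by omega),
              Or.inl (by omega), Or.inl (Or.inl (by omega))⟩
      · exact ⟨i + 1, N + 1, i + 1, 0, by omega, by omega, by omega, by omega, Or.inl (by omega),
              Or.inl (by omega), Or.inl (Or.inl (by omega))⟩
    · exact ⟨i + 1, lift j, i₂ + 1, lift j, by omega, by omega, by omega, by omega, Or.inl (by omega),
              Or.inl (by omega), Or.inl (Or.inr (Or.inl (by omega)))⟩
    · have hjj : j ≠ j₂ := by omega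
      subst he1 he2
      rcases hl j j₂ hj hj2 hjj he3 with h | ⟨h, h'⟩ | ⟨h, h'⟩
      · exact ⟨0, lift j, 0, lift j₂, by omega, by omega, by omega, by omega,
          Or.inr ⟨rfl, rfl, Or.inl rfl⟩, Or.inr ⟨rfl, rfl, Or.inl rfl⟩, Or.inl (Or.inr (Or.inr ⟨rfl, rfl, h⟩))⟩
      · exact ⟨0, p, 0, p + 1, by omega, by omega, by omega, by omega,
          Or.inr ⟨rfl, rfl, Or.inr (Or.inl ⟨rfl, h⟩)⟩, Or.inr ⟨rfl, rfl, Or.inr (Or.inr ⟨rfl, h'⟩)⟩,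
          Or.inl (Or.inl (by omega))⟩
      · exact ⟨0, p + 1, 0, p, by omega, by omega, by omega, by omega,
          Or.inr ⟨rfl, rfl, Or.inr (Or.inr ⟨rfl, h'⟩)⟩, Or.inr ⟨rfl, rfl, Or.inr (Or.inl ⟨rfl, h⟩)⟩,
          Or.inr (Or.inl (by omega))⟩


/-! ### Words -/

/-- `Le d w w'`: the grid with top row word `w` is a minor of the grid with word `w'` and
`d` more rows. -/
def Le (d : ℕ) (w w' : List ℕ) : Prop :=
  ∀ R, IsMinorOf (Gr R w.length (fun j => w[j]?)) (Gr (R + d) w'.length (fun j => w'[j]?))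

/-- Every letter occurs at most twice. -/
def Good (w : List ℕ) : Prop := ∀ x, w.count x ≤ 2

lemma Le.trans {d e : ℕ} {w w' w'' : List ℕ} (h : Le d w w') (h' : Le e w' w'') :
    Le (d + e) w w'' := by
  intro R
  have := minor_trans (h R) (h' (R + d))
  rwa [add_assoc] at this

lemma Le.mono {d e : ℕ} {w w' : List ℕ} (h : Le d w w') (hde : d ≤ e) : Le e w w' := by
  intro R
  obtain ⟨f, rfl⟩ := Nat.exists_eq_add_of_le hde
  have := minor_trans (h R) (gr_rows (R + d) f _ _)
  rwa [add_assoc] at this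

lemma Le.refl (w : List ℕ) : Le 0 w w := fun R => gr_rows R 0 _ _

lemma le_del (u v : List ℕ) (x : ℕ) (h : u ++ v ≠ []) : Le 0 (u ++ v) (u ++ x :: v) := by
  intro R
  have hlen : (u ++ x :: v).length = (u ++ v).length + 1 := by simp; omega
  rw [hlen]
  refine gr_del (p := u.length) (by simp) (List.length_pos_iff.2 h) ?_ ?_
  · intro j hj
    simp [List.getElem?_append_left hj]
  · intro j hj
    rw [List.getElem?_append_right hj, List.getElem?_append_right (by omega)]
    rw [show j + 1 - u.length = (j - u.length) + 1 by omega]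
    simp

lemma le_sublist_aux {w w' : List ℕ} (h : w.Sublist w') :
    ∀ u : List ℕ, u ++ w ≠ [] → Le 0 (u ++ w) (u ++ w') := by
  induction h with
  | slnil => intro u _; exact Le.refl _
  | cons a _ ih =>
    intro u hu
    refine (ih u hu).trans (le_del _ _ a ?_)
    rename_i l₁ l₂ hs
    intro hcon
    apply hu
    simp only [List.append_eq_nil_iff] at hcon ⊢
    obtain ⟨h1, h2⟩ := hcon
    subst h2
    exact ⟨h1, List.sublist_nil.1 hs⟩
  | cons_cons a _ ih =>
    intro u hu
    have := ih (u ++ [a]) (by simp)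
    simpa using this

lemma le_sublist {w w' : List ℕ} (h : w.Sublist w') (hw : w ≠ []) : Le 0 w w' := by
  simpa using le_sublist_aux h [] (by simpa using hw)

lemma count_one_idx {x : ℕ} {w : List ℕ} (h : w.count x ≤ 1) {i j : ℕ}
    (hi : w[i]? = some x) (hj : w[j]? = some x) : i = j := by
  induction w generalizing i j with
  | nil => simp at hi
  | cons a w ih =>
    have hmem : ∀ n : ℕ, w[n]? = some x → 1 ≤ w.count x := fun n hn =>
      List.one_le_count_iff.2 (List.mem_of_getElem? hn)
    cases i with
    | zero =>
      cases j with
      | zero => rfl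
      | succ j =>
        simp at hi hj
        subst hi
        have := hmem _ hj
        simp at h
        omega
    | succ i =>
      cases j with
      | zero =>
        simp at hi hj
        subst hj
        have := hmem _ hi
        simp at h
        omega
      | succ j =>
        simp at hi hj
        have h' : w.count x ≤ 1 := le_trans (List.count_le_count_cons) h
        rw [ih h' hi hj]

lemma count_two_idx {x : ℕ} {w : List ℕ} (h : w.count x ≤ 2) {i j k : ℕ}
    (hi : w[i]? = some x) (hj : w[j]? = some x) (hk : w[k]? = some x) : i = j ∨ j = k ∨ i = k := by
  induction w generalizing i j k with
  | nil => simp at hi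
  | cons a w ih =>
    by_cases hax : a = x
    · subst hax
      have h1 : w.count a ≤ 1 := by simpa using h
      cases i <;> cases j <;> cases k <;> simp at hi hj hk ⊢
      · exact count_one_idx h1 hj hk
      · exact count_one_idx h1 hi hk
      · exact count_one_idx h1 hi hj
      · left; exact count_one_idx h1 hi hj
    · cases i <;> cases j <;> cases k <;> simp [hax] at hi hj hk ⊢
      have h' : w.count x ≤ 2 := le_trans (List.count_le_count_cons) h
      exact ih h' hi hj hk

lemma le_contract (u v : List ℕ) (a b : ℕ) (f : ℕ → ℕ) (hne : u ++ v ≠ []) (hab : a ≠ b)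
    (hgood : Good (u ++ a :: b :: v))
    (hf : ∀ x y, f x = f y → x = y ∨ (x = a ∧ y = b) ∨ (y = a ∧ x = b)) :
    Le 1 ((u ++ v).map f) (u ++ a :: b :: v) := by
  intro R
  have hlen : (u ++ a :: b :: v).length = ((u ++ v).map f).length + 2 := by simp; omega
  rw [hlen]
  have hca : (u ++ v).count a ≤ 1 := by
    have := hgood a
    simp [List.count_append, List.count_cons] at this ⊢
    omega
  have hcb : (u ++ v).count b ≤ 1 := by
    have := hgood b
    simp [List.count_append, List.count_cons] at this ⊢
    omega
  have hp : (u ++ a :: b :: v)[u.length]? = some a := by simp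
  have hp1 : (u ++ a :: b :: v)[u.length + 1]? = some b := by
    rw [List.getElem?_append_right (by omega)]; simp
  have hl : ∀ j, (u ++ a :: b :: v)[if j < u.length then j else j + 2]? = (u ++ v)[j]? := by
    intro j
    split_ifs with hj
    · rw [List.getElem?_append_left hj, List.getElem?_append_left hj]
    · rw [List.getElem?_append_right (by omega), List.getElem?_append_right (by omega)]
      rw [show j + 2 - u.length = (j - u.length) + 1 + 1 by omega]
      simp
  refine gr_contract (p := u.length) (by simp) (by rw [List.length_map]; exact List.length_pos_iff.2 hne)
    (fun j => if j < u.length then j else j + 2) ?_ ?_ ?_ ?_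
  · intro j
    split_ifs <;> omega
  · intro j j' hj hj' _ he
    simp only [hl, hp, hp1]
    simp only [List.length_map] at hj hj'
    simp only [List.getElem?_map, List.getElem?_eq_getElem hj, List.getElem?_eq_getElem hj',
      Option.map_some, Option.some.injEq] at he ⊢
    exact hf _ _ he
  · intro j j' hj hj' h1 h2
    simp only [hl, hp] at h1 h2
    exact count_one_idx hca h1 h2
  · intro j j' hj hj' h1 h2
    simp only [hl, hp1] at h1 h2
    exact count_one_idx hcb h1 h2

/-- substitution `z := s`. -/
def sub1 (z s x : ℕ) : ℕ := if x = z then s else x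

lemma map_sub1 {z s : ℕ} {u : List ℕ} (h : z ∉ u) : u.map (sub1 z s) = u := by
  conv_rhs => rw [← List.map_id u]
  apply List.map_congr_left
  intro x hx
  have : x ≠ z := by rintro rfl; exact h hx
  simp [sub1, this]

lemma sub1_inj (z s x y : ℕ) (h : sub1 z s x = sub1 z s y) :
    x = y ∨ (x = z ∧ y = s) ∨ (y = z ∧ x = s) := by
  unfold sub1 at h
  split_ifs at h <;> omega

lemma le_e1 (u v v' : List ℕ) (z s : ℕ) (hz : z ∉ u) (hz1 : z ∉ v) (hz2 : z ∉ v') (hs : z ≠ s)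
    (hg : Good (u ++ z :: s :: (v ++ z :: v'))) :
    Le 1 (u ++ v ++ s :: v') (u ++ z :: s :: (v ++ z :: v')) := by
  have := le_contract u (v ++ z :: v') z s (sub1 z s) (by simp) hs hg (sub1_inj z s)
  simp only [List.map_append, List.map_cons, map_sub1 hz, map_sub1 hz1, map_sub1 hz2] at this
  simpa [sub1] using this

lemma le_e2 (u v v' : List ℕ) (z s : ℕ) (hz : z ∉ u) (hz1 : z ∉ v) (hz2 : z ∉ v') (hs : z ≠ s)
    (hg : Good (u ++ s :: z :: (v ++ z :: v'))) :
    Le 1 (u ++ v ++ s :: v') (u ++ s :: z :: (v ++ z :: v')) := by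
  have := le_contract u (v ++ z :: v') s z (sub1 z s) (by simp) hs.symm hg
    (fun x y h => by have := sub1_inj z s x y h; tauto)
  simp only [List.map_append, List.map_cons, map_sub1 hz, map_sub1 hz1, map_sub1 hz2] at this
  simpa [sub1] using this

lemma le_e3 (u u' v : List ℕ) (z s : ℕ) (hz : z ∉ u) (hz1 : z ∉ u') (hz2 : z ∉ v) (hs : z ≠ s)
    (hg : Good (u ++ z :: u' ++ z :: s :: v)) :
    Le 1 (u ++ s :: u' ++ v) (u ++ z :: u' ++ z :: s :: v) := by
  have := le_contract (u ++ z :: u') v z s (sub1 z s) (by simp) hs hg (sub1_inj z s)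
  simp only [List.map_append, List.map_cons, map_sub1 hz, map_sub1 hz1, map_sub1 hz2] at this
  simpa [sub1] using this

/-- `Z` consists of distinct letters, none of them in `w`. -/
def Fresh (Z w : List ℕ) : Prop := ∀ x, Z.count x ≤ 1 ∧ (x ∈ Z → x ∉ w)

lemma exists_fresh (n : ℕ) (w : List ℕ) : ∃ Z : List ℕ, Z.length = n ∧ Fresh Z w := by
  refine ⟨(List.range n).map (fun i => i + (w.sum + 1)), by simp, ?_⟩
  intro x
  constructor
  · apply List.nodup_iff_count_le_one.1
    apply List.Nodup.map _ List.nodup_range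
    intro a b h
    simpa using h
  · intro hx hw
    simp only [List.mem_map] at hx
    obtain ⟨i, _, rfl⟩ := hx
    have := List.single_le_sum (by simp) _ hw
    omega

lemma le_m1 (S : List ℕ) : ∀ (Z p q₁ q₂ : List ℕ), Z.length = S.length →
    Fresh Z (p ++ q₁ ++ q₂ ++ S) → Good (p ++ Z ++ S.reverse ++ q₁ ++ Z ++ q₂) →
    Le S.length (p ++ q₁ ++ S ++ q₂) (p ++ Z ++ S.reverse ++ q₁ ++ Z ++ q₂) := by
  induction S using List.reverseRecOn with
  | nil =>
    intro Z p q₁ q₂ hl _ _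
    have : Z = [] := by simpa using hl
    subst this
    simpa using Le.refl _
  | append_singleton S s ih =>
    intro Z p q₁ q₂ hl hf hg
    obtain ⟨Z, z, rfl⟩ := List.eq_nil_or_concat' Z |>.resolve_left (by rintro rfl; simp at hl)
    have hfz := hf z
    have hzc : z ∉ Z := by
      intro hz
      have h1 := hfz.1
      have := List.one_le_count_iff.2 hz
      simp at h1
      omega
    have hzm := hfz.2 (by simp)
    simp only [List.mem_append, not_or, List.mem_singleton] at hzm
    have hzs : z ≠ s := fun h => hzm.2.2 h
    have hE := le_e1 (p ++ Z) (S.reverse ++ q₁ ++ Z) q₂ z s (by simp [hzm, hzc])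
      (by simp [hzm, hzc]) hzm.1.2 hzs (by simpa using hg)
    have hI := ih Z p q₁ (s :: q₂) (by simpa using hl) ?_ ?_
    · have := hI.trans (by simpa using hE)
      simpa using this
    · intro x
      have h1 := (hf x).1
      have h2 := (hf x).2
      simp only [List.count_append] at h1
      refine ⟨by omega, fun hx => ?_⟩
      have h3 := h2 (by simp [hx])
      simpa [or_assoc, and_assoc, and_comm, and_left_comm] using h3
    · intro x
      have h1 := hg x
      simp [List.count_append, List.count_cons, List.count_reverse] at h1 ⊢
      split_ifs at h1 ⊢ <;> omega

lemma le_m2 (S : List ℕ) : ∀ (Z p q₁ q₂ : List ℕ), Z.length = S.length →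
    Fresh Z (p ++ q₁ ++ q₂ ++ S) → Good (p ++ S.reverse ++ Z ++ q₁ ++ Z ++ q₂) →
    Le S.length (p ++ q₁ ++ S ++ q₂) (p ++ S.reverse ++ Z ++ q₁ ++ Z ++ q₂) := by
  induction S with
  | nil =>
    intro Z p q₁ q₂ hl _ _
    have : Z = [] := by simpa using hl
    subst this
    simpa using Le.refl _
  | cons s S ih =>
    intro Z p q₁ q₂ hl hf hg
    obtain ⟨z, Z, rfl⟩ := List.exists_cons_of_ne_nil (show Z ≠ [] by rintro rfl; simp at hl)
    have hfz := hf z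
    have hzc : z ∉ Z := by
      intro hz
      have h1 := hfz.1
      have := List.one_le_count_iff.2 hz
      simp at h1
      omega
    have hzm := hfz.2 (by simp)
    simp only [List.mem_append, not_or, List.mem_cons] at hzm
    have hzs : z ≠ s := fun h => hzm.2.1 h
    have hE := le_e2 (p ++ S.reverse) (Z ++ q₁) (Z ++ q₂) z s (by simp [hzm])
      (by simp [hzm, hzc]) (by simp [hzm, hzc]) hzs (by simpa using hg)
    have hI := ih Z p (q₁ ++ [s]) q₂ (by simpa using hl) ?_ ?_
    · have := hI.trans (by simpa using hE)
      simpa using this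
    · intro x
      have h1 := (hf x).1
      have h2 := (hf x).2
      simp only [List.count_cons] at h1
      refine ⟨by omega, fun hx => ?_⟩
      have h3 := h2 (by simp [hx])
      simpa [or_assoc, and_assoc, and_comm, and_left_comm] using h3
    · intro x
      have h1 := hg x
      simp [List.count_append, List.count_cons, List.count_reverse] at h1 ⊢
      split_ifs at h1 ⊢ <;> omega

lemma le_m3 (S : List ℕ) : ∀ (Z p₁ p₂ q : List ℕ), Z.length = S.length →
    Fresh Z (p₁ ++ p₂ ++ q ++ S) → Good (p₁ ++ Z ++ p₂ ++ Z.reverse ++ S ++ q) →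
    Le S.length (p₁ ++ S ++ p₂ ++ q) (p₁ ++ Z ++ p₂ ++ Z.reverse ++ S ++ q) := by
  induction S with
  | nil =>
    intro Z p q₁ q₂ hl _ _
    have : Z = [] := by simpa using hl
    subst this
    simpa using Le.refl _
  | cons s S ih =>
    intro Z p₁ p₂ q hl hf hg
    obtain ⟨z, Z, rfl⟩ := List.exists_cons_of_ne_nil (show Z ≠ [] by rintro rfl; simp at hl)
    have hfz := hf z
    have hzc : z ∉ Z := by
      intro hz
      have h1 := hfz.1
      have := List.one_le_count_iff.2 hz
      simp at h1
      omega
    have hzm := hfz.2 (by simp)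
    simp only [List.mem_append, not_or, List.mem_cons] at hzm
    have hzs : z ≠ s := fun h => hzm.2.1 h
    have hE := le_e3 p₁ (Z ++ p₂ ++ Z.reverse) (S ++ q) z s (by simp [hzm])
      (by simp [hzm, hzc]) (by simp [hzm]) hzs (by simpa using hg)
    have hI := ih Z (p₁ ++ [s]) p₂ q (by simpa using hl) ?_ ?_
    · have := hI.trans (by simpa using hE)
      simpa using this
    · intro x
      have h1 := (hf x).1
      have h2 := (hf x).2
      simp only [List.count_cons] at h1
      refine ⟨by omega, fun hx => ?_⟩
      have h3 := h2 (by simp [hx])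
      simpa [or_assoc, and_assoc, and_comm, and_left_comm] using h3
    · intro x
      have h1 := hg x
      simp [List.count_append, List.count_cons, List.count_reverse] at h1 ⊢
      split_ifs at h1 ⊢ <;> omega


/-! ### Slides -/

lemma Good.of_append {g w : List ℕ} (h : Good (g ++ w)) : Good w := by
  intro x
  have := h x
  rw [List.count_append] at this
  omega

lemma slide_tr (g u v A S : List ℕ) (hg : Good (g ++ (u ++ A ++ A ++ S ++ v))) :
    ∃ Z : List ℕ, Z.length = S.length ∧
      Good (g ++ (u ++ (A ++ Z) ++ S.reverse ++ (A ++ Z) ++ v)) ∧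
      Le S.length (u ++ A ++ A ++ S ++ v) (u ++ (A ++ Z) ++ S.reverse ++ (A ++ Z) ++ v) := by
  obtain ⟨Z, hZ, hf⟩ := exists_fresh S.length (g ++ (u ++ A ++ A ++ S ++ v))
  have hgood : Good (g ++ (u ++ (A ++ Z) ++ S.reverse ++ (A ++ Z) ++ v)) := by
    intro x
    have h1 := hg x
    have h2 := (hf x).1
    by_cases hx : x ∈ Z
    · have h3 := List.count_eq_zero.2 ((hf x).2 hx)
      simp only [List.count_append, List.count_reverse] at h1 h3 ⊢
      omega
    · have h3 := List.count_eq_zero.2 hx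
      simp only [List.count_append, List.count_reverse] at h1 ⊢
      omega
  refine ⟨Z, hZ, hgood, ?_⟩
  have := le_m1 S Z (u ++ A) A v hZ ?_ ?_
  · simpa using this
  · intro x
    refine ⟨(hf x).1, fun hx => ?_⟩
    have := (hf x).2 hx
    simp only [List.mem_append, not_or] at this ⊢
    tauto
  · simpa using hgood.of_append

lemma slide_tl (g u v A S : List ℕ) (hg : Good (g ++ (u ++ A ++ S ++ A ++ v))) :
    ∃ Z : List ℕ, Z.length = S.length ∧
      Good (g ++ (u ++ S.reverse ++ (Z ++ A) ++ (Z ++ A) ++ v)) ∧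
      Le S.length (u ++ A ++ S ++ A ++ v) (u ++ S.reverse ++ (Z ++ A) ++ (Z ++ A) ++ v) := by
  obtain ⟨Z, hZ, hf⟩ := exists_fresh S.length (g ++ (u ++ A ++ S ++ A ++ v))
  have hgood : Good (g ++ (u ++ S.reverse ++ (Z ++ A) ++ (Z ++ A) ++ v)) := by
    intro x
    have h1 := hg x
    have h2 := (hf x).1
    by_cases hx : x ∈ Z
    · have h3 := List.count_eq_zero.2 ((hf x).2 hx)
      simp only [List.count_append, List.count_reverse] at h1 h3 ⊢
      omega
    · have h3 := List.count_eq_zero.2 hx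
      simp only [List.count_append, List.count_reverse] at h1 ⊢
      omega
  refine ⟨Z, hZ, hgood, ?_⟩
  have := le_m2 S Z u A (A ++ v) hZ ?_ ?_
  · simpa using this
  · intro x
    refine ⟨(hf x).1, fun hx => ?_⟩
    have := (hf x).2 hx
    simp only [List.mem_append, not_or] at this ⊢
    tauto
  · simpa using hgood.of_append

lemma slide_fl (g u v B C S : List ℕ) (hg : Good (g ++ (u ++ S ++ C.reverse ++ B ++ C ++ v))) :
    ∃ Z : List ℕ, Z.length = S.length ∧
      Good (g ++ (u ++ (Z ++ C.reverse) ++ B ++ (C ++ Z.reverse) ++ S ++ v)) ∧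
      Le S.length (u ++ S ++ C.reverse ++ B ++ C ++ v)
        (u ++ (Z ++ C.reverse) ++ B ++ (C ++ Z.reverse) ++ S ++ v) := by
  obtain ⟨Z, hZ, hf⟩ := exists_fresh S.length (g ++ (u ++ S ++ C.reverse ++ B ++ C ++ v))
  have hgood : Good (g ++ (u ++ (Z ++ C.reverse) ++ B ++ (C ++ Z.reverse) ++ S ++ v)) := by
    intro x
    have h1 := hg x
    have h2 := (hf x).1
    by_cases hx : x ∈ Z
    · have h3 := List.count_eq_zero.2 ((hf x).2 hx)
      simp only [List.count_append, List.count_reverse] at h1 h3 ⊢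
      omega
    · have h3 := List.count_eq_zero.2 hx
      simp only [List.count_append, List.count_reverse] at h1 ⊢
      omega
  refine ⟨Z, hZ, hgood, ?_⟩
  have := le_m3 S Z u (C.reverse ++ B ++ C) v hZ ?_ ?_
  · simpa using this
  · intro x
    refine ⟨(hf x).1, fun hx => ?_⟩
    have := (hf x).2 hx
    simp only [List.mem_append, not_or] at this ⊢
    tauto
  · simpa using hgood.of_append

/-! ### Blocks -/

/-- A handle with bands `A`, `B` or a crosscap with band `A`. -/
inductive Blk where
  | H (A B : List ℕ) : Blk
  | X (A : List ℕ) : Blk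

/-- The word of a block. -/
def Blk.wd : Blk → List ℕ
  | .H A B => A ++ B ++ A.reverse ++ B.reverse
  | .X A => A ++ A

/-- The word of a list of blocks. -/
def wds (L : List Blk) : List ℕ := L.flatMap Blk.wd

lemma wds_append (L L' : List Blk) : wds (L ++ L') = wds L ++ wds L' := by simp [wds]
lemma wds_cons (b : Blk) (L : List Blk) : wds (b :: L) = b.wd ++ wds L := by simp [wds]
lemma wds_nil : wds [] = [] := rfl

/-- Gap `g`, then blocks; gap letters occur once and other letters at most twice. -/
def GG (g : List ℕ) (L : List Blk) : Prop := Good (g ++ (g ++ wds L))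

/-- Reduction between block lists. -/
def Red (g : List ℕ) (d : ℕ) (L L' : List Blk) : Prop :=
  GG g L' ∧ Le d (g ++ wds L) (g ++ wds L')

lemma Red.trans {g : List ℕ} {d e : ℕ} {L L' L'' : List Blk} (h : Red g d L L')
    (h' : Red g e L' L'') : Red g (d + e) L L'' := ⟨h'.1, h.2.trans h'.2⟩

lemma Red.mono {g : List ℕ} {d e : ℕ} {L L' : List Blk} (h : Red g d L L') (hde : d ≤ e) :
    Red g e L L' := ⟨h.1, h.2.mono hde⟩

lemma red_swap (g : List ℕ) (L₁ L₂ : List Blk) (A B C : List ℕ)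
    (hg : GG g (L₁ ++ Blk.X A :: Blk.H B C :: L₂)) :
    ∃ A' : List ℕ, A'.length = A.length + 4 * (B.length + C.length) ∧
      Red g (4 * (B.length + C.length)) (L₁ ++ Blk.X A :: Blk.H B C :: L₂)
        (L₁ ++ Blk.H B C :: Blk.X A' :: L₂) := by
  set S := B ++ C ++ B.reverse ++ C.reverse with hS
  have hSl : S.length = 2 * (B.length + C.length) := by simp [hS]; omega
  obtain ⟨Z, hZ, hg1, hl1⟩ := slide_tr g (g ++ wds L₁) (wds L₂) A S
    (by simpa [GG, wds_append, wds_cons, Blk.wd, hS] using hg)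
  obtain ⟨Z', hZ', hg2, hl2⟩ := slide_tl g (g ++ wds L₁) (wds L₂) (A ++ Z) S.reverse hg1
  simp only [List.length_reverse] at hZ' hl2
  refine ⟨Z' ++ (A ++ Z), by simp; omega, ?_, ?_⟩
  · simpa [GG, wds_append, wds_cons, Blk.wd, hS] using hg2
  · have := (hl1.trans hl2).mono (show _ ≤ 4 * (B.length + C.length) by omega)
    simpa [GG, wds_append, wds_cons, Blk.wd, hS] using this

lemma red_triple (g : List ℕ) (L₁ L₂ : List Blk) (A B C : List ℕ)
    (hg : GG g (L₁ ++ Blk.X A :: Blk.X B :: Blk.X C :: L₂)) :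
    ∃ P Q A' : List ℕ, P.length = A.length + B.length + 2 * C.length ∧
      Q.length = B.length + C.length ∧
      A'.length = 3 * A.length + 5 * B.length + 7 * C.length ∧
      Red g (3 * (A.length + 2 * B.length + 3 * C.length))
        (L₁ ++ Blk.X A :: Blk.X B :: Blk.X C :: L₂)
        (L₁ ++ Blk.H P Q :: Blk.X A' :: L₂) := by
  obtain ⟨Z1, hZ1, hg1, hl1⟩ := slide_tr g (g ++ wds L₁ ++ A ++ A) (C ++ wds L₂) B C
    (by simpa [GG, wds_append, wds_cons, Blk.wd] using hg)
  set B1 := B ++ Z1 with hB1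
  have hB1l : B1.length = B.length + C.length := by simp [hB1, hZ1]
  obtain ⟨Z2, hZ2, hg2, hl2⟩ := slide_tr g (g ++ wds L₁) (C.reverse ++ B1 ++ C ++ wds L₂) A B1
    (by simpa using hg1)
  set A1 := A ++ Z2 with hA1
  have hA1l : A1.length = A.length + B1.length := by simp [hA1, hZ2]
  obtain ⟨Z3, hZ3, hg3, hl3⟩ := slide_fl g (g ++ wds L₁ ++ A1 ++ B1.reverse) (wds L₂) B1 C A1
    (by simpa using hg2)
  set C1 := C ++ Z3.reverse with hC1
  have hC1l : C1.length = C.length + A1.length := by simp [hC1, hZ3]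
  have hC1r : Z3 ++ C.reverse = C1.reverse := by simp [hC1]
  rw [hC1r] at hg3 hl3
  obtain ⟨Z4, hZ4, hg4, hl4⟩ := slide_tl g (g ++ wds L₁) (wds L₂) A1
    (B1.reverse ++ C1.reverse ++ B1 ++ C1) (by simpa using hg3)
  refine ⟨C1.reverse, B1.reverse, Z4 ++ A1, ?_, ?_, ?_, ?_, ?_⟩
  · simp; omega
  · simp; omega
  · simp [hZ4]; omega
  · simpa [GG, wds_append, wds_cons, Blk.wd] using hg4
  · have e1 : Le C.length (g ++ wds L₁ ++ A ++ A ++ B ++ B ++ C ++ (C ++ wds L₂))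
      (g ++ wds L₁ ++ A ++ A ++ B1 ++ C.reverse ++ B1 ++ (C ++ wds L₂)) := hl1
    have e2 : Le B1.length (g ++ wds L₁ ++ A ++ A ++ B1 ++ C.reverse ++ B1 ++ (C ++ wds L₂))
        (g ++ wds L₁ ++ A1 ++ B1.reverse ++ A1 ++ (C.reverse ++ B1 ++ C ++ wds L₂)) := by
      simpa using hl2
    have e3 : Le A1.length (g ++ wds L₁ ++ A1 ++ B1.reverse ++ A1 ++ (C.reverse ++ B1 ++ C ++ wds L₂))
        (g ++ wds L₁ ++ A1 ++ B1.reverse ++ C1.reverse ++ B1 ++ C1 ++ A1 ++ wds L₂) := by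
      simpa using hl3
    have e4 := (e1.trans e2).trans e3
    have e5 := e4.trans (by simpa using hl4)
    have e6 := e5.mono (show _ ≤ 3 * (A.length + 2 * B.length + 3 * C.length) by omega)
    simpa [GG, wds_append, wds_cons, Blk.wd] using e6

/-- A handle of width at most `m`. -/
def HW (m : ℕ) (b : Blk) : Prop := ∃ A B, b = Blk.H A B ∧ A.length ≤ m ∧ B.length ≤ m
/-- A crosscap with at most `m` letters. -/
def XW (m : ℕ) (b : Blk) : Prop := ∃ A, b = Blk.X A ∧ A.length ≤ m

lemma HW.mono {m n : ℕ} {b : Blk} (h : HW m b) (hmn : m ≤ n) : HW n b := by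
  obtain ⟨A, B, h, h1, h2⟩ := h
  exact ⟨A, B, h, by omega, by omega⟩

lemma XW.mono {m n : ℕ} {b : Blk} (h : XW m b) (hmn : m ≤ n) : XW n b := by
  obtain ⟨A, h, h1⟩ := h
  exact ⟨A, h, by omega⟩

lemma red_move (g : List ℕ) (k : ℕ) (Hs : List Blk) (hH : ∀ b ∈ Hs, HW k b) :
    ∀ (L₁ L₂ : List Blk) (A : List ℕ), GG g (L₁ ++ Blk.X A :: (Hs ++ L₂)) →
    ∃ A' : List ℕ, A'.length ≤ A.length + 8 * k * Hs.length ∧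
      Red g (8 * k * Hs.length) (L₁ ++ Blk.X A :: (Hs ++ L₂)) (L₁ ++ (Hs ++ Blk.X A' :: L₂)) := by
  induction Hs with
  | nil =>
    intro L₁ L₂ A hg
    exact ⟨A, by simp, by simpa using hg, by simpa using Le.refl _⟩
  | cons b Hs ih =>
    intro L₁ L₂ A hg
    obtain ⟨B, C, rfl, hB, hC⟩ := hH b (by simp)
    obtain ⟨A₁, hA₁, h1⟩ := red_swap g L₁ (Hs ++ L₂) A B C (by simpa using hg)
    obtain ⟨A₂, hA₂, h2⟩ := ih (fun b hb => hH b (by simp [hb])) (L₁ ++ [Blk.H B C]) L₂ A₁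
      (by simpa using h1.1)
    have hb : 8 * k * (Hs.length + 1) = 8 * k * Hs.length + 8 * k := by ring
    refine ⟨A₂, by simp only [List.length_cons, hb]; omega, ?_⟩
    have h3 := h1.trans (by simpa using h2)
    simpa using h3.mono (show _ ≤ 8 * k * (Hs.length + 1) by rw [hb]; omega)

/-- Is the block a handle? -/
def Blk.isH : Blk → Bool
  | .H _ _ => true
  | .X _ => false

lemma red_sort (g : List ℕ) (k : ℕ) (L : List Blk) (hL : ∀ b ∈ L, HW k b ∨ XW (2 * k) b) :
    ∀ (L₁ : List Blk), GG g (L₁ ++ L) →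
    ∃ Hs Xs : List Blk, (∀ b ∈ Hs, HW k b) ∧ (∀ b ∈ Xs, XW (2 * k + 8 * k * Hs.length) b) ∧
      Hs.length = L.countP Blk.isH ∧ Hs.length + Xs.length = L.length ∧
      Red g (8 * k * Hs.length * Xs.length) (L₁ ++ L) (L₁ ++ (Hs ++ Xs)) := by
  induction L with
  | nil =>
    intro L₁ hg
    exact ⟨[], [], by simp, by simp, by simp, by simp, by simpa using hg, by simpa using Le.refl _⟩
  | cons b L ih =>
    intro L₁ hg
    obtain ⟨Hs, Xs, h1, h2, h3, h4, h5⟩ := ih (fun b hb => hL b (by simp [hb])) (L₁ ++ [b])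
      (by simpa using hg)
    rcases hL b (by simp) with hb | hb
    · refine ⟨b :: Hs, Xs, ?_, ?_, ?_, ?_, ?_⟩
      · intro c hc
        rcases List.mem_cons.1 hc with rfl | hc
        · exact hb
        · exact h1 c hc
      · intro c hc
        apply (h2 c hc).mono
        gcongr
        simp
      · obtain ⟨A, B, rfl, -⟩ := hb
        simp [List.countP_cons, Blk.isH, h3]
      · simp; omega
      · have := h5.mono (show _ ≤ 8 * k * (b :: Hs).length * Xs.length by gcongr; simp)
        simpa using this
    · obtain ⟨A, rfl, hA⟩ := hb
      obtain ⟨A', hA', hr⟩ := red_move g k Hs h1 L₁ Xs A (by simpa using h5.1)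
      refine ⟨Hs, Blk.X A' :: Xs, h1, ?_, ?_, ?_, ?_⟩
      · intro c hc
        rcases List.mem_cons.1 hc with rfl | hc
        · exact ⟨A', rfl, by omega⟩
        · exact h2 c hc
      · simp [List.countP_cons, Blk.isH, h3]
      · simp; omega
      · have h6 : Red g (8 * k * Hs.length * Xs.length) (L₁ ++ Blk.X A :: L) (L₁ ++ Blk.X A :: (Hs ++ Xs)) := by simpa using h5
        refine (h6.trans hr).mono (le_of_eq ?_)
        simp only [List.length_cons]; ring

lemma red_collapse (g : List ℕ) (q n : ℕ) : ∀ (L₁ Xs : List Blk) (A : List ℕ) (a : ℕ),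
    A.length ≤ a → (∀ b ∈ Xs, XW q b) → 2 * n ≤ Xs.length → GG g (L₁ ++ Blk.X A :: Xs) →
    ∃ (Hs Xs' : List Blk) (d : ℕ), Hs.length = n ∧ Xs'.length + 2 * n = Xs.length + 1 ∧
      (∀ b ∈ Hs, HW (3 ^ n * (a + 6 * q)) b) ∧ (∀ b ∈ Xs', XW (3 ^ n * (a + 6 * q)) b) ∧
      d + 2 * (a + 6 * q) ≤ 2 * (3 ^ n * (a + 6 * q)) ∧
      Red g d (L₁ ++ Blk.X A :: Xs) (L₁ ++ (Hs ++ Xs')) := by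
  induction n with
  | zero =>
    intro L₁ Xs A a hA hX _ hg
    refine ⟨[], Blk.X A :: Xs, 0, rfl, by simp, by simp, ?_, by simp, by simpa using hg,
      by simpa using Le.refl _⟩
    intro c hc
    rcases List.mem_cons.1 hc with rfl | hc
    · exact ⟨A, rfl, by omega⟩
    · exact (hX c hc).mono (by omega)
  | succ n ih =>
    intro L₁ Xs A a hA hX hn hg
    match Xs, hX, hn, hg with
    | [], _, hn, _ => simp at hn
    | [_], _, hn, _ => simp at hn; omega
    | b :: c :: Xs, hX, hn, hg =>
      obtain ⟨B, rfl, hB⟩ := hX b (by simp)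
      obtain ⟨C, rfl, hC⟩ := hX c (by simp)
      obtain ⟨P, Q, A', hP, hQ, hA', hr⟩ := red_triple g L₁ Xs A B C hg
      obtain ⟨Hs, Xs', d, i1, i2, i3, i4, i5, i6⟩ := ih (L₁ ++ [Blk.H P Q]) Xs A' (3 * a + 12 * q)
        (by omega) (fun b hb => hX b (by simp [hb])) (by simp at hn; omega) (by simpa using hr.1)
      have hE : 3 ^ n * (3 * a + 12 * q + 6 * q) = 3 ^ (n + 1) * (a + 6 * q) := by ring
      rw [hE] at i3 i4 i5
      have hbig : 3 * (a + 6 * q) ≤ 3 ^ (n + 1) * (a + 6 * q) := by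
        apply Nat.mul_le_mul_right
        calc 3 = 3 ^ 1 := by norm_num
          _ ≤ _ := Nat.pow_le_pow_right (by norm_num) (by omega)
      refine ⟨Blk.H P Q :: Hs, Xs', 3 * (A.length + 2 * B.length + 3 * C.length) + d, by simp [i1], by simp; omega, ?_, i4,
        by omega, ?_⟩
      · intro c hc
        rcases List.mem_cons.1 hc with rfl | hc
        · exact ⟨P, Q, rfl, by omega, by omega⟩
        · exact i3 c hc
      · exact hr.trans (by simpa using i6)


/-! ### Exact widths -/

/-- Exact width `m`. -/
def Blk.EX (m : ℕ) : Blk → Prop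
  | .H A B => A.length = m ∧ B.length = m
  | .X A => A.length = 2 * m

lemma pad_blocks (K : ℕ) (L : List Blk) (hL : ∀ b ∈ L, HW K b ∨ XW (2 * K) b) :
    ∀ ctx : List ℕ, Good (ctx ++ wds L) →
    ∃ L' : List Blk, L'.map Blk.isH = L.map Blk.isH ∧ (∀ b ∈ L', b.EX K) ∧
      (wds L).Sublist (wds L') ∧ Good (ctx ++ wds L') := by
  induction L with
  | nil =>
    intro ctx hg
    exact ⟨[], rfl, by simp, List.Sublist.refl _, hg⟩
  | cons b L ih =>
    intro ctx hg
    obtain ⟨L', i1, i2, i3, i4⟩ := ih (fun b hb => hL b (by simp [hb])) (ctx ++ b.wd)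
      (by simpa [wds_cons] using hg)
    rcases hL b (by simp) with ⟨A, B, rfl, hA, hB⟩ | ⟨A, rfl, hA⟩
    · obtain ⟨Z, hZ, hf⟩ := exists_fresh (K - A.length) (ctx ++ (A ++ B ++ wds L'))
      obtain ⟨Y, hY, hf'⟩ := exists_fresh (K - B.length) (ctx ++ (A ++ B ++ wds L' ++ Z))
      refine ⟨Blk.H (A ++ Z) (B ++ Y) :: L', by simp [i1, Blk.isH], ?_, ?_, ?_⟩
      · intro c hc
        rcases List.mem_cons.1 hc with rfl | hc
        · simp only [Blk.EX, List.length_append]; omega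
        · exact i2 c hc
      · simp only [wds_cons, Blk.wd]
        refine List.Sublist.append ?_ i3
        refine List.Sublist.append (List.Sublist.append (List.Sublist.append ?_ ?_) ?_) ?_ <;> simp
      · intro x
        have h1 := i4 x
        have h2 := (hf x).1
        have h3 := (hf' x).1
        have h4 : x ∈ Z → _ := fun hx => List.count_eq_zero.2 ((hf x).2 hx)
        have h5 : x ∈ Y → _ := fun hx => List.count_eq_zero.2 ((hf' x).2 hx)
        have h6 : x ∉ Z → _ := fun hx => List.count_eq_zero.2 hx
        have h7 : x ∉ Y → _ := fun hx => List.count_eq_zero.2 hx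
        simp only [wds_cons, Blk.wd, List.count_append, List.count_reverse] at h1 h2 h3 h4 h5 ⊢
        by_cases hx : x ∈ Z <;> by_cases hy : x ∈ Y <;> simp only [hx, hy, not_true_eq_false,
          not_false_eq_true, forall_true_left] at h4 h5 h6 h7 <;> omega
    · obtain ⟨Z, hZ, hf⟩ := exists_fresh (2 * K - A.length) (ctx ++ (A ++ wds L'))
      refine ⟨Blk.X (A ++ Z) :: L', by simp [i1, Blk.isH], ?_, ?_, ?_⟩
      · intro c hc
        rcases List.mem_cons.1 hc with rfl | hc
        · simp only [Blk.EX, List.length_append]; omega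
        · exact i2 c hc
      · simp only [wds_cons, Blk.wd]
        refine List.Sublist.append ?_ i3
        refine List.Sublist.append ?_ ?_ <;> simp
      · intro x
        have h1 := i4 x
        have h2 := (hf x).1
        have h4 : x ∈ Z → _ := fun hx => List.count_eq_zero.2 ((hf x).2 hx)
        have h6 : x ∉ Z → _ := fun hx => List.count_eq_zero.2 hx
        simp only [wds_cons, Blk.wd, List.count_append] at h1 h2 h4 ⊢
        by_cases hx : x ∈ Z <;> simp only [hx, not_true_eq_false,
          not_false_eq_true, forall_true_left] at h4 h6 <;> omega

lemma pad_gap (m : ℕ) (g : List ℕ) (L : List Blk) (hg : GG g L) (hm : g.length ≤ m) :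
    ∃ g' : List ℕ, g'.length = m ∧ g.Sublist g' ∧ GG g' L := by
  obtain ⟨Z, hZ, hf⟩ := exists_fresh (m - g.length) (g ++ wds L)
  refine ⟨g ++ Z, by simp; omega, by simp, ?_⟩
  intro x
  have h1 := hg x
  have h2 := (hf x).1
  have h4 : x ∈ Z → _ := fun hx => List.count_eq_zero.2 ((hf x).2 hx)
  have h6 : x ∉ Z → _ := fun hx => List.count_eq_zero.2 hx
  simp only [List.count_append] at h1 h2 h4 ⊢
  by_cases hx : x ∈ Z <;> simp only [hx, not_true_eq_false,
    not_false_eq_true, forall_true_left] at h4 h6 <;> omega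

lemma exists_word (k : ℕ) (t : List Bool) : ∃ (g : List ℕ) (L : List Blk), g.length = 4 * k ∧
    L.map Blk.isH = t ∧ (∀ b ∈ L, b.EX k) ∧ GG g L := by
  have h1 : ∃ L : List Blk, L.map Blk.isH = t ∧ (∀ b ∈ L, HW k b ∨ XW (2 * k) b) ∧ wds L = [] := by
    refine ⟨t.map (fun b => if b then Blk.H [] [] else Blk.X []), ?_, ?_, ?_⟩
    · rw [List.map_map]
      conv_rhs => rw [← List.map_id t]
      apply List.map_congr_left
      intro b _
      cases b <;> simp [Blk.isH]
    · intro b hb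
      simp only [List.mem_map] at hb
      obtain ⟨c, _, rfl⟩ := hb
      cases c
      · right; exact ⟨[], by simp, by simp⟩
      · left; exact ⟨[], [], by simp, by simp, by simp⟩
    · induction t with
      | nil => rfl
      | cons b t ih => cases b <;> simpa [wds_cons, Blk.wd] using ih
  obtain ⟨L, h1, h2, h3⟩ := h1
  have h0 : GG [] L := by intro x; simp [h3]
  obtain ⟨g, i1, _, i2⟩ := pad_gap (4 * k) [] L h0 (by simp)
  obtain ⟨L', j1, j2, _, j3⟩ := pad_blocks k L h2 (g ++ g) (by simpa [GG] using i2)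
  exact ⟨g, L', i1, j1.trans h1, j2, by simpa [GG] using j3⟩

lemma EX_length {k : ℕ} {b : Blk} (h : b.EX k) : b.wd.length = 4 * k := by
  cases b with
  | H A B => simp only [Blk.EX] at h; simp [Blk.wd, h]; omega
  | X A => simp only [Blk.EX] at h; simp [Blk.wd, h]; omega

lemma wds_length {k : ℕ} {L : List Blk} (h : ∀ b ∈ L, b.EX k) :
    (wds L).length = 4 * k * L.length := by
  induction L with
  | nil => rfl
  | cons b L ih =>
    rw [wds_cons, List.length_append, EX_length (h b (by simp)),
      ih (fun b hb => h b (by simp [hb])), List.length_cons]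
    ring

lemma wds_get {k : ℕ} {L : List Blk} (h : ∀ b ∈ L, b.EX k) :
    ∀ (i : ℕ) (b : Blk), L[i]? = some b → ∀ j < 4 * k, (wds L)[4 * k * i + j]? = b.wd[j]? := by
  induction L with
  | nil => intro i b hi; simp at hi
  | cons c L ih =>
    intro i b hi j hj
    have hc := EX_length (h c (by simp))
    rw [wds_cons]
    cases i with
    | zero =>
      simp at hi
      subst hi
      rw [List.getElem?_append_left (by omega)]
      simp
    | succ i =>
      have : 4 * k * (i + 1) + j = 4 * k * i + j + c.wd.length := by rw [hc]; ring
      rw [this, List.getElem?_append_right (by omega)]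
      simp at hi
      rw [← ih (fun b hb => h b (by simp [hb])) i b hi j hj]
      congr 1
      omega

lemma wd_H1 {k j : ℕ} {A B : List ℕ} (h : (Blk.H A B).EX k) (hj : j < k) :
    (Blk.H A B).wd[j]? = (Blk.H A B).wd[3 * k - 1 - j]? := by
  simp only [Blk.EX] at h
  simp only [Blk.wd, List.append_assoc]
  rw [List.getElem?_append_left (by omega), List.getElem?_append_right (by omega),
    List.getElem?_append_right (by omega), List.getElem?_append_left (by simp; omega),
    List.getElem?_reverse (by omega)]
  congr 1
  omega

lemma wd_H2 {k j : ℕ} {A B : List ℕ} (h : (Blk.H A B).EX k) (hj : j < k) :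
    (Blk.H A B).wd[k + j]? = (Blk.H A B).wd[4 * k - 1 - j]? := by
  simp only [Blk.EX] at h
  simp only [Blk.wd, List.append_assoc]
  rw [List.getElem?_append_right (by omega), List.getElem?_append_left (by omega),
    List.getElem?_append_right (by omega),
    List.getElem?_append_right (by omega), List.getElem?_append_right (by simp; omega),
    List.getElem?_reverse (by simp; omega)]
  congr 1
  simp
  omega

lemma wd_X {k j : ℕ} {A : List ℕ} (h : (Blk.X A).EX k) (hj : j < 2 * k) :
    (Blk.X A).wd[j]? = (Blk.X A).wd[2 * k + j]? := by
  simp only [Blk.EX] at h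
  simp only [Blk.wd]
  rw [List.getElem?_append_left (by omega), List.getElem?_append_right (by omega)]
  congr 1
  omega

lemma gap_get {k : ℕ} {g : List ℕ} {L : List Blk} (hgl : g.length = 4 * k) (h : ∀ b ∈ L, b.EX k)
    {i : ℕ} {b : Blk} (hi : L[i]? = some b) {j : ℕ} (hj : j < 4 * k) :
    (g ++ wds L)[4 * k * (i + 1) + j]? = b.wd[j]? := by
  rw [← wds_get h i b hi j hj, show 4 * k * (i + 1) + j = 4 * k + (4 * k * i + j) by ring,
    List.getElem?_append_right (by omega)]
  congr 1
  omega

lemma word_H1 {k : ℕ} {g : List ℕ} {L : List Blk} (hgl : g.length = 4 * k) (h : ∀ b ∈ L, b.EX k)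
    {i : ℕ} (hi : (L.map Blk.isH)[i]? = some true) {j : ℕ} (hj : j < k) :
    (g ++ wds L)[4 * k * (i + 1) + j]? = (g ++ wds L)[4 * k * (i + 1) + (3 * k - 1 - j)]? := by
  simp only [List.getElem?_map, Option.map_eq_some_iff] at hi
  obtain ⟨b, hb, hbt⟩ := hi
  have hbE := h b (List.mem_of_getElem? hb)
  rw [gap_get hgl h hb (by omega), gap_get hgl h hb (by omega)]
  cases b with
  | H A B => exact wd_H1 hbE hj
  | X A => simp [Blk.isH] at hbt

lemma word_H2 {k : ℕ} {g : List ℕ} {L : List Blk} (hgl : g.length = 4 * k) (h : ∀ b ∈ L, b.EX k)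
    {i : ℕ} (hi : (L.map Blk.isH)[i]? = some true) {j : ℕ} (hj : j < k) :
    (g ++ wds L)[4 * k * (i + 1) + (k + j)]? = (g ++ wds L)[4 * k * (i + 1) + (4 * k - 1 - j)]? := by
  simp only [List.getElem?_map, Option.map_eq_some_iff] at hi
  obtain ⟨b, hb, hbt⟩ := hi
  have hbE := h b (List.mem_of_getElem? hb)
  rw [gap_get hgl h hb (by omega), gap_get hgl h hb (by omega)]
  cases b with
  | H A B => exact wd_H2 hbE hj
  | X A => simp [Blk.isH] at hbt

lemma word_X {k : ℕ} {g : List ℕ} {L : List Blk} (hgl : g.length = 4 * k) (h : ∀ b ∈ L, b.EX k)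
    {i : ℕ} (hi : (L.map Blk.isH)[i]? = some false) {j : ℕ} (hj : j < 2 * k) :
    (g ++ wds L)[4 * k * (i + 1) + j]? = (g ++ wds L)[4 * k * (i + 1) + (2 * k + j)]? := by
  simp only [List.getElem?_map, Option.map_eq_some_iff] at hi
  obtain ⟨b, hb, hbt⟩ := hi
  have hbE := h b (List.mem_of_getElem? hb)
  rw [gap_get hgl h hb (by omega), gap_get hgl h hb (by omega)]
  cases b with
  | X A => exact wd_X hbE hj
  | H A B => simp [Blk.isH] at hbt

/-- The columns: index `t` corresponds to column `t + 1` modulo `M`. -/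
lemma exists_col {N M : ℕ} (h : N = M) (h0 : 0 < N) :
    ∃ e : Fin N ≃ ZMod M, ∀ t, e t = (((t : ℕ) + 1 : ℕ) : ZMod M) := by
  subst h
  have : NeZero N := ⟨by omega⟩
  have hinj : Function.Injective (fun t : Fin N => (((t : ℕ) + 1 : ℕ) : ZMod N)) := by
    intro a b hab
    simp only at hab
    rw [ZMod.natCast_eq_natCast_iff] at hab
    have := Nat.ModEq.add_right_cancel' 1 hab
    have := Nat.ModEq.eq_of_lt_of_lt this a.2 b.2
    exact Fin.ext this
  have hbij := (Fintype.bijective_iff_injective_and_card _).2 ⟨hinj, by simp [ZMod.card]⟩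
  exact ⟨Equiv.ofBijective _ hbij, fun t => rfl⟩

lemma target_minor {k n : ℕ} {g : List ℕ} {L : List Blk} {Ih Ic : Finset ℕ} (hk : 0 < k)
    (hgl : g.length = 4 * k) (h : ∀ b ∈ L, b.EX k) (hn : n = L.length + 1)
    (hIh : ∀ i ∈ Ih, 2 ≤ i ∧ (L.map Blk.isH)[i - 2]? = some true)
    (hIc : ∀ i ∈ Ic, 2 ≤ i ∧ (L.map Blk.isH)[i - 2]? = some false) :
    IsMinorOf (mixedGrid k n Ih Ic) (Gr k (g ++ wds L).length (fun j => (g ++ wds L)[j]?)) := by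
  have hlen : (g ++ wds L).length = 4 * n * k := by
    rw [List.length_append, hgl, wds_length h, hn]; ring
  have hpos : 0 < (g ++ wds L).length := by rw [List.length_append]; omega
  obtain ⟨e, he⟩ := exists_col hlen hpos
  have hs : ∀ (t : ℕ) (z : ZMod (4 * n * k)), t < (g ++ wds L).length →
      z = ((t + 1 : ℕ) : ZMod (4 * n * k)) → (e.symm z : ℕ) = t := by
    intro t z ht hz
    have : e.symm z = ⟨t, ht⟩ := by rw [Equiv.symm_apply_eq, he, hz]
    rw [this]
  have hbd : ∀ i (b : Bool), (L.map Blk.isH)[i]? = some b → 4 * k * (i + 1) + 4 * k ≤ (g ++ wds L).length := by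
    intro i b hi
    have h1 := (List.getElem?_eq_some_iff.1 hi).1
    rw [List.length_map] at h1
    rw [List.length_append, hgl, wds_length h]
    have := Nat.mul_le_mul_left (4 * k) h1
    have h3 : 4 * k * (i + 1) = 4 * k * i.succ := rfl
    omega
  refine minor_of_inj (fun p => (p.1, e.symm p.2)) ?_ ?_
  · rintro ⟨a, b⟩ ⟨a', b'⟩ hab
    simpa using hab
  · have main : ∀ p q : Fin k × ZMod (4 * n * k), (
        (p.1 = q.1 ∧ q.2 = p.2 + 1) ∨
        (p.2 = q.2 ∧ (q.1 : ℕ) = (p.1 : ℕ) + 1) ∨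
        ((p.1 : ℕ) = 0 ∧ (q.1 : ℕ) = 0 ∧ ∃ i ∈ Ih, ∃ j ∈ Finset.Icc 1 k,
          ((p.2 = ((4 * k * (i - 1) + j : ℕ) : ZMod (4 * n * k)) ∧
            q.2 = ((4 * k * (i - 1) + 3 * k - j + 1 : ℕ) : ZMod (4 * n * k))) ∨
           (p.2 = ((4 * k * (i - 1) + k + j : ℕ) : ZMod (4 * n * k)) ∧
            q.2 = ((4 * k * (i - 1) + 4 * k - j + 1 : ℕ) : ZMod (4 * n * k))))) ∨
        ((p.1 : ℕ) = 0 ∧ (q.1 : ℕ) = 0 ∧ ∃ i ∈ Ic, ∃ j ∈ Finset.Icc 1 (2 * k),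
          p.2 = ((4 * k * (i - 1) + j : ℕ) : ZMod (4 * n * k)) ∧
          q.2 = ((4 * k * (i - 1) + 2 * k + j : ℕ) : ZMod (4 * n * k)))) →
        grel (g ++ wds L).length (fun j => (g ++ wds L)[j]?) p.1 (e.symm p.2) q.1 (e.symm q.2) := by
      rintro ⟨a, z⟩ ⟨a', z'⟩ hr
      simp only at hr ⊢
      rcases hr with ⟨h1, h2⟩ | ⟨h1, h2⟩ | ⟨h1, h2, i, hi, j, hj, hr⟩ | ⟨h1, h2, i, hi, j, hj, h3, h4⟩
      · left
        refine ⟨by rw [h1], ?_⟩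
        obtain ⟨t, rfl⟩ := e.surjective z
        rw [he] at h2
        rw [Equiv.symm_apply_apply]
        by_cases hc : (t : ℕ) + 1 < (g ++ wds L).length
        · left
          exact hs _ _ hc (by rw [h2]; push_cast; ring)
        · right
          have ht := t.2
          have : (t : ℕ) + 1 = 4 * n * k := by omega
          refine ⟨by omega, hs _ _ hpos ?_⟩
          rw [h2, this]
          simp
      · right; left
        exact ⟨by rw [h1], h2⟩
      · right; right
        refine ⟨h1, h2, ?_⟩
        obtain ⟨hi2, hit⟩ := hIh i hi
        have hb := hbd _ _ hit
        simp only [Finset.mem_Icc] at hj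
        obtain ⟨i, rfl⟩ := Nat.exists_eq_add_of_le hi2
        simp only [show 2 + i - 2 = i by omega, show 2 + i - 1 = i + 1 by omega] at *
        rcases hr with ⟨h3, h4⟩ | ⟨h3, h4⟩
        · have e1 := hs (4 * k * (i + 1) + (j - 1)) z (by omega) (by rw [h3]; congr 1; omega)
          have e2 := hs (4 * k * (i + 1) + (3 * k - 1 - (j - 1))) z' (by omega)
            (by rw [h4]; congr 1; omega)
          rw [e1, e2]
          exact word_H1 hgl h hit (by omega)
        · have e1 := hs (4 * k * (i + 1) + (k + (j - 1))) z (by omega) (by rw [h3]; congr 1; omega)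
          have e2 := hs (4 * k * (i + 1) + (4 * k - 1 - (j - 1))) z' (by omega)
            (by rw [h4]; congr 1; omega)
          rw [e1, e2]
          exact word_H2 hgl h hit (by omega)
      · right; right
        refine ⟨h1, h2, ?_⟩
        obtain ⟨hi2, hit⟩ := hIc i hi
        have hb := hbd _ _ hit
        simp only [Finset.mem_Icc] at hj
        obtain ⟨i, rfl⟩ := Nat.exists_eq_add_of_le hi2
        simp only [show 2 + i - 2 = i by omega, show 2 + i - 1 = i + 1 by omega] at *
        have e1 := hs (4 * k * (i + 1) + (j - 1)) z (by omega) (by rw [h3]; congr 1; omega)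
        have e2 := hs (4 * k * (i + 1) + (2 * k + (j - 1))) z' (by omega)
          (by rw [h4]; congr 1; omega)
        rw [e1, e2]
        exact word_X hgl h hit (by omega)
    intro p q hpq
    rw [mixedGrid, SimpleGraph.fromRel_adj] at hpq
    rw [gr_adj]
    refine ⟨?_, ?_⟩
    · intro hcon
      apply hpq.1
      have h1 := congrArg Prod.fst hcon
      have h2 := congrArg Prod.snd hcon
      simp only [EmbeddingLike.apply_eq_iff_eq] at h1 h2
      exact Prod.ext h1 h2
    · rcases hpq.2 with hr | hr
      · left; exact main p q hr
      · right; exact main q p hr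

/-- The partner of a matched position. -/
lemma exists_partner {k : ℕ} {g : List ℕ} {L : List Blk} (hgl : g.length = 4 * k)
    (h : ∀ b ∈ L, b.EX k) {t : ℕ} (ht : t < (g ++ wds L).length) (ht' : 4 * k ≤ t) (hk : 0 < k) :
    ∃ i j s : ℕ, i < L.length ∧ s ≠ t ∧ s < (g ++ wds L).length ∧
      (g ++ wds L)[t]? = (g ++ wds L)[s]? ∧
      (((L.map Blk.isH)[i]? = some true ∧ j < k ∧
        ((t = 4 * k * (i + 1) + j ∧ s = 4 * k * (i + 1) + (3 * k - 1 - j)) ∨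
         (s = 4 * k * (i + 1) + j ∧ t = 4 * k * (i + 1) + (3 * k - 1 - j)) ∨
         (t = 4 * k * (i + 1) + (k + j) ∧ s = 4 * k * (i + 1) + (4 * k - 1 - j)) ∨
         (s = 4 * k * (i + 1) + (k + j) ∧ t = 4 * k * (i + 1) + (4 * k - 1 - j)))) ∨
       ((L.map Blk.isH)[i]? = some false ∧ j < 2 * k ∧
        ((t = 4 * k * (i + 1) + j ∧ s = 4 * k * (i + 1) + (2 * k + j)) ∨
         (s = 4 * k * (i + 1) + j ∧ t = 4 * k * (i + 1) + (2 * k + j))))) := by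
  have hlen : (g ++ wds L).length = 4 * k + 4 * k * L.length := by
    rw [List.length_append, hgl, wds_length h]
  obtain ⟨i, r, hr, hti⟩ : ∃ i r, r < 4 * k ∧ t = 4 * k * (i + 1) + r := by
    refine ⟨t / (4 * k) - 1, t % (4 * k), Nat.mod_lt _ (by omega), ?_⟩
    have h1 : 1 ≤ t / (4 * k) := (Nat.one_le_div_iff (by omega)).2 ht'
    rw [Nat.sub_add_cancel h1]
    exact (Nat.div_add_mod t (4 * k)).symm
  have hiL : i < L.length := by
    by_contra hcon
    have := Nat.mul_le_mul_left (4 * k) (show L.length + 1 ≤ i + 1 by omega)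
    have h3 : 4 * k * (L.length + 1) = 4 * k + 4 * k * L.length := by ring
    omega
  have hib : 4 * k * (i + 1) + 4 * k ≤ (g ++ wds L).length := by
    have := Nat.mul_le_mul_left (4 * k) (show i + 1 ≤ L.length by omega)
    omega
  have hty : ∃ b, (L.map Blk.isH)[i]? = some b := by
    refine ⟨(L.map Blk.isH)[i]'(by simpa using hiL), ?_⟩
    exact List.getElem?_eq_getElem _
  obtain ⟨b, hb⟩ := hty
  cases b with
  | true =>
    by_cases c1 : r < k
    · refine ⟨i, r, 4 * k * (i + 1) + (3 * k - 1 - r), hiL, by omega, by omega, ?_,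
        Or.inl ⟨hb, c1, by omega⟩⟩
      rw [hti]; exact word_H1 hgl h hb c1
    by_cases c2 : r < 2 * k
    · refine ⟨i, r - k, 4 * k * (i + 1) + (4 * k - 1 - (r - k)), hiL, by omega, by omega, ?_,
        Or.inl ⟨hb, by omega, by omega⟩⟩
      rw [hti, ← word_H2 hgl h hb (show r - k < k by omega)]
      congr 1; omega
    by_cases c3 : r < 3 * k
    · refine ⟨i, 3 * k - 1 - r, 4 * k * (i + 1) + (3 * k - 1 - r), hiL, by omega, by omega, ?_,
        Or.inl ⟨hb, by omega, by omega⟩⟩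
      rw [hti, word_H1 hgl h hb (show 3 * k - 1 - r < k by omega)]
      congr 1; omega
    · refine ⟨i, 4 * k - 1 - r, 4 * k * (i + 1) + (k + (4 * k - 1 - r)), hiL, by omega, by omega, ?_,
        Or.inl ⟨hb, by omega, by omega⟩⟩
      rw [hti, word_H2 hgl h hb (show 4 * k - 1 - r < k by omega)]
      congr 1; omega
  | false =>
    by_cases c1 : r < 2 * k
    · refine ⟨i, r, 4 * k * (i + 1) + (2 * k + r), hiL, by omega, by omega, ?_,
        Or.inr ⟨hb, c1, by omega⟩⟩
      rw [hti]; exact word_X hgl h hb c1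
    · refine ⟨i, r - 2 * k, 4 * k * (i + 1) + (r - 2 * k), hiL, by omega, by omega, ?_,
        Or.inr ⟨hb, by omega, by omega⟩⟩
      rw [hti, word_X hgl h hb (show r - 2 * k < 2 * k by omega)]
      congr 1; omega

lemma gap_unique {g : List ℕ} {L : List Blk} (hG : GG g L) {t s : ℕ} (ht : t < g.length)
    (hs : s < (g ++ wds L).length) (he : (g ++ wds L)[t]? = (g ++ wds L)[s]?) : t = s := by
  have h1 : (g ++ wds L)[t]? = some g[t] := by
    rw [List.getElem?_append_left ht, List.getElem?_eq_getElem ht]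
  have h2 := hG g[t]
  have h3 : 1 ≤ g.count g[t] := List.one_le_count_iff.2 (List.getElem_mem ht)
  rw [List.count_append] at h2
  exact count_one_idx (x := g[t]) (by omega) h1 (he.symm.trans h1)

lemma source_minor {k n : ℕ} {g : List ℕ} {L : List Blk} {Ih Ic : Finset ℕ} (hk : 0 < k)
    (hgl : g.length = 4 * k) (h : ∀ b ∈ L, b.EX k) (hn : n = L.length + 1) (hG : GG g L)
    (hIh : ∀ i, (L.map Blk.isH)[i]? = some true → i + 2 ∈ Ih)
    (hIc : ∀ i, (L.map Blk.isH)[i]? = some false → i + 2 ∈ Ic) :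
    IsMinorOf (Gr k (g ++ wds L).length (fun j => (g ++ wds L)[j]?)) (mixedGrid k n Ih Ic) := by
  have hlen : (g ++ wds L).length = 4 * n * k := by
    rw [List.length_append, hgl, wds_length h, hn]; ring
  have hpos : 0 < (g ++ wds L).length := by rw [List.length_append]; omega
  obtain ⟨e, he⟩ := exists_col hlen hpos
  refine minor_of_inj (fun p => (p.1, e p.2)) ?_ ?_
  · rintro ⟨a, b⟩ ⟨a', b'⟩ hab
    simpa using hab
  have main : ∀ p q : Fin k × Fin (g ++ wds L).length, p ≠ q →
      grel (g ++ wds L).length (fun j => (g ++ wds L)[j]?) p.1 p.2 q.1 q.2 →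
      (mixedGrid k n Ih Ic).Adj (p.1, e p.2) (q.1, e q.2) := by
    rintro ⟨a, t⟩ ⟨a', t'⟩ hne hr
    simp only at hr ⊢
    rw [mixedGrid, SimpleGraph.fromRel_adj]
    refine ⟨?_, ?_⟩
    · intro hcon
      apply hne
      simpa using hcon
    simp only [he]
    rcases hr with ⟨h1, h2⟩ | ⟨h1, h2⟩ | ⟨h1, h2, h3⟩
    · left; left
      refine ⟨Fin.ext h1, ?_⟩
      rcases h2 with h2 | ⟨h2, h3⟩
      · rw [h2]; push_cast; ring
      · rw [h3, h2, hlen]; simp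
    · left; right; left
      exact ⟨by rw [h1], h2⟩
    · have htt : (t : ℕ) ≠ t' := by
        intro hcon
        apply hne
        ext
        · simp only; omega
        · exact hcon
      by_cases hgap : (t : ℕ) < g.length
      · exact absurd (gap_unique hG hgap t'.2 h3) htt
      obtain ⟨i, j, s, hi, hst, hsl, hse, hcase⟩ := exists_partner hgl h t.2 (by omega) hk
      have hs : s = t' := by
        have e1 : (g ++ wds L)[(t : ℕ)]? = some (g ++ wds L)[(t : ℕ)] := List.getElem?_eq_getElem t.2
        have hgood := hG.of_append (g ++ wds L)[(t : ℕ)]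
        rcases count_two_idx hgood e1 (hse.symm.trans e1) (h3.symm.trans e1) with hh | hh | hh
        · exact absurd hh.symm hst
        · exact hh
        · exact absurd hh htt
      rw [hs] at hcase
      rcases hcase with ⟨hty, hj, hcase⟩ | ⟨hty, hj, hcase⟩
      · have hmem := hIh i hty
        rcases hcase with ⟨c1, c2⟩ | ⟨c1, c2⟩ | ⟨c1, c2⟩ | ⟨c1, c2⟩
        · left; right; right; left
          refine ⟨h1, h2, i + 2, hmem, j + 1, by simp; omega, Or.inl ⟨?_, ?_⟩⟩ <;>
            congr 1 <;> rw [show i + 2 - 1 = i + 1 by omega] <;> omega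
        · right; right; right; left
          refine ⟨h2, h1, i + 2, hmem, j + 1, by simp; omega, Or.inl ⟨?_, ?_⟩⟩ <;>
            congr 1 <;> rw [show i + 2 - 1 = i + 1 by omega] <;> omega
        · left; right; right; left
          refine ⟨h1, h2, i + 2, hmem, j + 1, by simp; omega, Or.inr ⟨?_, ?_⟩⟩ <;>
            congr 1 <;> rw [show i + 2 - 1 = i + 1 by omega] <;> omega
        · right; right; right; left
          refine ⟨h2, h1, i + 2, hmem, j + 1, by simp; omega, Or.inr ⟨?_, ?_⟩⟩ <;>
            congr 1 <;> rw [show i + 2 - 1 = i + 1 by omega] <;> omega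
      · have hmem := hIc i hty
        rcases hcase with ⟨c1, c2⟩ | ⟨c1, c2⟩
        · left; right; right; right
          refine ⟨h1, h2, i + 2, hmem, j + 1, by simp; omega, ?_, ?_⟩ <;>
            congr 1 <;> rw [show i + 2 - 1 = i + 1 by omega] <;> omega
        · right; right; right; right
          refine ⟨h2, h1, i + 2, hmem, j + 1, by simp; omega, ?_, ?_⟩ <;>
            congr 1 <;> rw [show i + 2 - 1 = i + 1 by omega] <;> omega
  intro p q hpq
  rw [gr_adj] at hpq
  rcases hpq with ⟨hne, hr | hr⟩
  · exact main p q hne hr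
  · exact (main q p hne.symm hr).symm


/-! ### The main theorem -/

lemma EX_width {k : ℕ} {b : Blk} (h : b.EX k) : HW k b ∨ XW (2 * k) b := by
  cases b with
  | H A B => exact Or.inl ⟨A, B, rfl, h.1.le, h.2.le⟩
  | X A => exact Or.inr ⟨A, rfl, le_of_eq h⟩

lemma map_isH_H {m : ℕ} {L : List Blk} (h : ∀ b ∈ L, HW m b) :
    L.map Blk.isH = List.replicate L.length true := by
  rw [List.eq_replicate_iff]
  refine ⟨by simp, ?_⟩
  intro b hb
  obtain ⟨c, hc, rfl⟩ := List.mem_map.1 hb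
  obtain ⟨A, B, rfl, -⟩ := h c hc
  rfl

lemma map_isH_X {m : ℕ} {L : List Blk} (h : ∀ b ∈ L, XW m b) :
    L.map Blk.isH = List.replicate L.length false := by
  rw [List.eq_replicate_iff]
  refine ⟨by simp, ?_⟩
  intro b hb
  obtain ⟨c, hc, rfl⟩ := List.mem_map.1 hb
  obtain ⟨A, rfl, -⟩ := h c hc
  rfl

lemma count_types {m : ℕ} {Ih : Finset ℕ} (hsub : ∀ i ∈ Ih, 2 ≤ i ∧ i < m + 2) :
    ((List.range m).map (fun i => decide (i + 2 ∈ Ih))).countP id = Ih.card := by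
  have h1 : ((Finset.range m).filter (fun i => i + 2 ∈ Ih)).card = Ih.card := by
    apply Finset.card_bij (fun i _ => i + 2)
    · intro i hi
      exact (Finset.mem_filter.1 hi).2
    · intro i _ j _ hij
      simpa using hij
    · intro b hb
      obtain ⟨h2, h3⟩ := hsub b hb
      refine ⟨b - 2, ?_, by omega⟩
      rw [Finset.mem_filter, Finset.mem_range]
      refine ⟨by omega, ?_⟩
      rwa [Nat.sub_add_cancel h2]
  rw [← h1, List.countP_map, List.countP_eq_length_filter]
  rfl

lemma final_bound (h c h₀ k : ℕ) (hh : h₀ ≤ c) (hc : 0 < c) :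
    k + (8 * k * h * c + 2 * (3 ^ h₀ * (2 * k + 8 * k * h + 6 * (2 * k + 8 * k * h)))) ≤
      162 ^ (2 * (2 * h + c)) * k := by
  have e1 : 1 + 4 * h ≤ 5 ^ h := by
    clear hh hc
    induction h with
    | zero => simp
    | succ n ih => rw [pow_succ]; omega
  have e2 : 3 ^ h₀ ≤ 3 ^ c := Nat.pow_le_pow_right (by norm_num) hh
  have e3 : c ≤ 3 ^ c := (Nat.lt_pow_self (by norm_num)).le
  have e4 : h ≤ 5 ^ h := (Nat.lt_pow_self (by norm_num)).le
  have p1 : 1 ≤ 5 ^ h * 3 ^ c := Nat.one_le_iff_ne_zero.2 (by positivity)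
  have p2 : h * c ≤ 5 ^ h * 3 ^ c := Nat.mul_le_mul e4 e3
  have p3 : (1 + 4 * h) * 3 ^ h₀ ≤ 5 ^ h * 3 ^ c := Nat.mul_le_mul e1 e2
  have p4 : 37 * (5 ^ h * 3 ^ c) ≤ 162 ^ (2 * (2 * h + c)) := by
    have q1 : 162 ^ (2 * (2 * h + c)) = (162 ^ 4) ^ h * (162 ^ 2) ^ c := by
      rw [← pow_mul, ← pow_mul, ← pow_add]; congr 1; ring
    have q2 : 5 ^ h ≤ (162 ^ 4) ^ h := Nat.pow_le_pow_left (by norm_num) h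
    have q3 : 37 * 3 ^ c ≤ (162 ^ 2) ^ c := by
      calc 37 * 3 ^ c ≤ 37 ^ c * 3 ^ c :=
            Nat.mul_le_mul_right _ (Nat.le_self_pow (by omega) 37)
        _ = (37 * 3) ^ c := (mul_pow _ _ _).symm
        _ ≤ _ := Nat.pow_le_pow_left (by norm_num) c
    rw [q1]
    calc 37 * (5 ^ h * 3 ^ c) = 5 ^ h * (37 * 3 ^ c) := by ring
      _ ≤ _ := Nat.mul_le_mul q2 q3
  calc _ = (1 + 8 * (h * c) + 28 * ((1 + 4 * h) * 3 ^ h₀)) * k := by ring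
    _ ≤ _ := Nat.mul_le_mul_right _ (by omega)

/-- Abstract version of the main result. -/
lemma main_aux (h c h₀ k K : ℕ) (hc : 0 < c) (hh₀ : 2 * h₀ + 1 ≤ c) (hk : 0 < k)
    (hK : k + (8 * k * h * c + 2 * (3 ^ h₀ * (2 * k + 8 * k * h + 6 * (2 * k + 8 * k * h)))) ≤ K)
    (g : List ℕ) (L : List Blk) (hgl : g.length = 4 * k) (hE : ∀ b ∈ L, b.EX k) (hG : GG g L)
    (hcount : L.countP Blk.isH = h) (hlen : L.length = h + c) :
    IsMinorOf (Gr k (g ++ wds L).length (fun j => (g ++ wds L)[j]?))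
      (dyckGrid K (h + h₀) (c - 2 * h₀)) := by
  obtain ⟨Hs, Xs, s1, s2, s3, s4, s5⟩ := red_sort g k L (fun b hb => EX_width (hE b hb)) []
    (by simpa using hG)
  have hHs : Hs.length = h := s3.trans hcount
  have hXs : Xs.length = c := by omega
  rw [hHs] at s2 s5
  rw [hXs] at s5
  simp only [List.nil_append] at s5
  set q := 2 * k + 8 * k * h with hq
  match Xs, hXs, s2, s5 with
  | [], hXs, _, _ => simp at hXs; omega
  | b :: Xs, hXs, s2, s5 =>
    obtain ⟨A, rfl, hA⟩ := s2 b (by simp)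
    simp only [List.length_cons] at hXs
    obtain ⟨Hs', Xs', d, r1, r2, r3, r4, r5, r6⟩ := red_collapse g q h₀ Hs Xs A q hA
      (fun b hb => s2 b (by simp [hb])) (by omega) s5.1
    have hr := s5.trans r6
    set W := 3 ^ h₀ * (q + 6 * q) with hW
    have hkq : k ≤ K := by omega
    have hkW : k ≤ W := by
      have : 1 ≤ 3 ^ h₀ := Nat.one_le_pow _ _ (by norm_num)
      calc k ≤ q + 6 * q := by rw [hq]; omega
        _ = 1 * (q + 6 * q) := by ring
        _ ≤ _ := Nat.mul_le_mul_right _ this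
    have hwid : ∀ b ∈ Hs ++ (Hs' ++ Xs'), HW K b ∨ XW (2 * K) b := by
      intro b hb
      simp only [List.mem_append] at hb
      rcases hb with hb | hb | hb
      · exact Or.inl ((s1 b hb).mono hkq)
      · exact Or.inl ((r3 b hb).mono (by omega))
      · exact Or.inr ((r4 b hb).mono (by omega))
    have hty : (Hs ++ (Hs' ++ Xs')).map Blk.isH =
        List.replicate (h + h₀) true ++ List.replicate (c - 2 * h₀) false := by
      rw [List.map_append, List.map_append, map_isH_H s1, map_isH_H r3, map_isH_X r4, hHs, r1,
        ← List.append_assoc, List.replicate_append_replicate]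
      congr 2
      omega
    obtain ⟨L', j1, j2, j3, j4⟩ := pad_blocks K _ hwid (g ++ g) (by simpa [GG] using hr.1)
    obtain ⟨g', i1, i2, i3⟩ := pad_gap (4 * K) g L' (by simpa [GG] using j4) (by omega)
    rw [hty] at j1
    have hL' : L'.length = h + h₀ + (c - 2 * h₀) := by
      have := congrArg List.length j1
      simpa using this
    have hne : g ++ wds (Hs ++ (Hs' ++ Xs')) ≠ [] := by
      intro hcon
      have := congrArg List.length hcon
      simp [hgl] at this
      omega
    have hsub : (g ++ wds (Hs ++ (Hs' ++ Xs'))).Sublist (g' ++ wds L') := List.Sublist.append i2 j3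
    have hle : Le (K - k) (g ++ wds L) (g' ++ wds L') :=
      (hr.2.trans (le_sublist hsub hne)).mono (by omega)
    have h1 := hle k
    rw [show k + (K - k) = K by omega] at h1
    refine minor_trans h1 ?_
    refine source_minor (by omega) i1 j2 (by omega) i3 ?_ ?_
    · intro i hi
      rw [j1] at hi
      rw [Finset.mem_Icc]
      by_cases hi' : i < h + h₀
      · omega
      · rw [List.getElem?_append_right (by simpa using hi'), List.getElem?_replicate] at hi
        split_ifs at hi
        simp at hi
    · intro i hi
      rw [j1] at hi
      rw [Finset.mem_Icc]
      by_cases hi' : i < h + h₀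
      · rw [List.getElem?_append_left (by simpa using hi'), List.getElem?_replicate] at hi
        split_ifs at hi
        simp at hi
      · have := (List.getElem?_eq_some_iff.1 hi).1
        simp at this
        omega

/-- Let `g, h, c` be integers with `c > 0` and `g = 2h + c > 0`, and set
`h₀ := ⌈c/2⌉ − 1` and `c₀ := c − 2h₀`.  Then for every integer `k > 0` and every partition
`{I_hdl, I_crscp}` of `[2, h+c+1]` with `|I_hdl| = h` and `|I_crscp| = c`, the Dyck grid
`D_{162^(2g)·k}^{(h+h₀, c₀)}` contains the mixed surface grid of order `k` with `h` handles
and `c` crosscaps as a minor. -/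
theorem dyckGrid_contains_mixedGrid (g h c h₀ c₀ k : ℕ)
    (hc : 0 < c) (hg : g = 2 * h + c)
    (hh₀ : h₀ = (c + 1) / 2 - 1) (hc₀ : c₀ = c - 2 * h₀)
    (hk : 0 < k)
    (Ih Ic : Finset ℕ)
    (hpart : Ih ∪ Ic = Finset.Icc 2 (h + c + 1)) (hdisj : Disjoint Ih Ic)
    (hIh : Ih.card = h) (hIc : Ic.card = c) :
    IsMinorOf (mixedGrid k (h + c + 1) Ih Ic) (dyckGrid (162 ^ (2 * g) * k) (h + h₀) c₀) := by
  have hmem : ∀ i, i ∈ Ih ∪ Ic → 2 ≤ i ∧ i < h + c + 2 := by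
    intro i hi
    rw [hpart, Finset.mem_Icc] at hi
    omega
  obtain ⟨g', L, hgl, hty, hE, hG⟩ :=
    exists_word k ((List.range (h + c)).map (fun i => decide (i + 2 ∈ Ih)))
  have hlen : L.length = h + c := by
    have := congrArg List.length hty
    simpa using this
  have hcount : L.countP Blk.isH = h := by
    have h1 := count_types (m := h + c) (Ih := Ih)
      (fun i hi => hmem i (Finset.mem_union_left _ hi))
    rw [← hty, List.countP_map] at h1
    exact h1.trans hIh
  have hget : ∀ i, 2 ≤ i → i < h + c + 2 →
      (L.map Blk.isH)[i - 2]? = some (decide (i ∈ Ih)) := by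
    intro i h1 h2
    rw [hty, List.getElem?_map, List.getElem?_range (by omega)]
    simp [Nat.sub_add_cancel h1]
  refine minor_trans (target_minor (L := L) hk hgl hE (by omega) ?_ ?_) ?_
  · intro i hi
    obtain ⟨h1, h2⟩ := hmem i (Finset.mem_union_left _ hi)
    exact ⟨h1, by rw [hget i h1 h2]; simp [hi]⟩
  · intro i hi
    obtain ⟨h1, h2⟩ := hmem i (Finset.mem_union_right _ hi)
    have h3 : i ∉ Ih := fun h4 => Finset.disjoint_left.1 hdisj h4 hi
    exact ⟨h1, by rw [hget i h1 h2]; simp [h3]⟩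
  · subst hc₀ hg
    exact main_aux h c h₀ k _ hc (by omega) hk (final_bound h c h₀ k (by omega) hc) g' L hgl hE hG
      hcount hlen
end
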